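/- Every planar graph with girth at least 5 is (I,F)-colorable. -/

import Mathlib

open SimpleGraph

namespace IFPaper

variable {V : Type}

/-- An `(I,F)`-coloring of a graph, encoded as a Boolean coloring where
`true` means color `I` and `false` means color `F`:  the `I`-colored vertices
form an independent set and the `F`-colored vertices induce a forest
(no cycle has all of its vertices colored `F`). -/
def IFColoring (G : SimpleGraph V) (c : V → Bool) : Prop :=
  (∀ ⦃u v : V⦄, G.Adj u v → c u = true → c v = false) ∧
  (∀ (v : V) (w : G.Walk v v), w.IsCycle → ¬ (∀ x ∈ w.support, c x = false))

/-- A graph is `(I,F)`-colorable if it admits an `(I,F)`-coloring. -/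
def IFColorable (G : SimpleGraph V) : Prop := ∃ c : V → Bool, IFColoring G c

/-- An `(I,F)`-coloring of the subgraph of `G` induced on the set `S`. -/
def IFColoringOn (G : SimpleGraph V) (S : Set V) (c : V → Bool) : Prop :=
  (∀ ⦃u v : V⦄, u ∈ S → v ∈ S → G.Adj u v → c u = true → c v = false) ∧
  (∀ (v : V) (w : G.Walk v v), w.IsCycle → (∀ x ∈ w.support, x ∈ S) →
    ¬ (∀ x ∈ w.support, c x = false))

/-- A splitting `F`-path of (the vertex set `Q` of) a cycle: a path all of whose
vertices get color `F`, whose two endpoints lie on `Q`, and all of whose other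
vertices (at least one) do not lie on `Q`. -/
def IsSplittingFPath (G : SimpleGraph V) (Q : Set V) (c : V → Bool)
    {a b : V} (p : G.Walk a b) : Prop :=
  p.IsPath ∧ (∀ x ∈ p.support, c x = false) ∧ a ∈ Q ∧ b ∈ Q ∧ 2 ≤ p.length ∧
  ∀ x ∈ p.support, x ≠ a → x ≠ b → x ∉ Q

/-- A super IF-coloring of `(G, Q)`: an `(I,F)`-coloring of `G` with no
splitting `F`-path of `Q`. -/
def SuperIFColoring (G : SimpleGraph V) (Q : Set V) (c : V → Bool) : Prop :=
  IFColoring G c ∧ ∀ (a b : V) (p : G.Walk a b), ¬ IsSplittingFPath G Q c p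

/-- `d* ≥ 3`: any two distinct cycles of length at most `5` are at distance at
least `3`. -/
def Cycles5Apart (G : SimpleGraph V) : Prop :=
  ∀ ⦃u v : V⦄ (c1 : G.Walk u u) (c2 : G.Walk v v),
    c1.IsCycle → c2.IsCycle → c1.length ≤ 5 → c2.length ≤ 5 →
    {e : Sym2 V | e ∈ c1.edges} ≠ {e : Sym2 V | e ∈ c2.edges} →
    ∀ x ∈ c1.support, ∀ y ∈ c2.support, 3 ≤ G.dist x y

/-- A claw of the cycle `C`: a vertex not on `C` with three neighbors on `C`. -/
def HasClaw (G : SimpleGraph V) {v : V} (C : G.Walk v v) : Prop :=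
  ∃ x : V, x ∉ C.support ∧ ∃ a b c : V, a ∈ C.support ∧ b ∈ C.support ∧ c ∈ C.support ∧
    a ≠ b ∧ a ≠ c ∧ b ≠ c ∧ G.Adj x a ∧ G.Adj x b ∧ G.Adj x c

/-- A triclaw of the cycle `C`: a triangle `x y z` disjoint from `C`, joined by
three edges to three distinct vertices of `C`. -/
def HasTriclaw (G : SimpleGraph V) {v : V} (C : G.Walk v v) : Prop :=
  ∃ x y z : V, x ∉ C.support ∧ y ∉ C.support ∧ z ∉ C.support ∧
    G.Adj x y ∧ G.Adj y z ∧ G.Adj x z ∧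
    ∃ a b c : V, a ∈ C.support ∧ b ∈ C.support ∧ c ∈ C.support ∧
      a ≠ b ∧ a ≠ c ∧ b ≠ c ∧ G.Adj x a ∧ G.Adj y b ∧ G.Adj z c

/-- A bad cycle is a `9`-cycle having a claw or a triclaw. -/
def IsBadCycle (G : SimpleGraph V) {v : V} (C : G.Walk v v) : Prop :=
  C.IsCycle ∧ C.length = 9 ∧ (HasClaw G C ∨ HasTriclaw G C)

/-- A good cycle is a cycle that is not bad. -/
def IsGoodCycle (G : SimpleGraph V) {v : V} (C : G.Walk v v) : Prop :=
  C.IsCycle ∧ ¬ IsBadCycle G C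

/-- The interior of an arc parametrized by `[0,1]`. -/
def ArcInterior (γ : ℝ → ℝ × ℝ) : Set (ℝ × ℝ) := γ '' Set.Ioo 0 1

/-- The image of an arc parametrized by `[0,1]`. -/
def ArcImage (γ : ℝ → ℝ × ℝ) : Set (ℝ × ℝ) := γ '' Set.Icc 0 1

/-- A plane embedding of a simple graph: an injective placement of the vertices
in the plane together with, for every edge, a simple arc joining the images of
its endpoints, such that arcs meet only at common endpoints and no arc passes
through a vertex. -/
structure IsPlaneEmbedding (G : SimpleGraph V) (vtx : V → ℝ × ℝ)
    (arc : V → V → ℝ → ℝ × ℝ) : Prop where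
  vtx_inj : Function.Injective vtx
  arc_cont : ∀ ⦃u v : V⦄, G.Adj u v → ContinuousOn (arc u v) (Set.Icc 0 1)
  arc_injOn : ∀ ⦃u v : V⦄, G.Adj u v → Set.InjOn (arc u v) (Set.Icc 0 1)
  arc_start : ∀ ⦃u v : V⦄, G.Adj u v → arc u v 0 = vtx u
  arc_end : ∀ ⦃u v : V⦄, G.Adj u v → arc u v 1 = vtx v
  arc_symm : ∀ ⦃u v : V⦄, G.Adj u v → ∀ t : ℝ, arc v u t = arc u v (1 - t)
  arc_avoids_vtx : ∀ ⦃u v : V⦄, G.Adj u v → ∀ w : V, vtx w ∉ ArcInterior (arc u v)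
  arc_disjoint : ∀ ⦃u v u' v' : V⦄, G.Adj u v → G.Adj u' v' → s(u, v) ≠ s(u', v') →
    ArcInterior (arc u v) ∩ ArcInterior (arc u' v') = ∅

/-- A graph is planar if it admits a plane embedding. -/
def IsPlanarGraph (G : SimpleGraph V) : Prop :=
  ∃ (vtx : V → ℝ × ℝ) (arc : V → V → ℝ → ℝ × ℝ), IsPlaneEmbedding G vtx arc

/-- The subset of the plane covered by a plane drawing of `G`. -/
def Drawing (G : SimpleGraph V) (vtx : V → ℝ × ℝ) (arc : V → V → ℝ → ℝ × ℝ) :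
    Set (ℝ × ℝ) :=
  Set.range vtx ∪ ⋃ (u : V) (v : V) (_ : G.Adj u v), ArcImage (arc u v)

/-- The subset of the plane covered by the drawing of a walk `w`. -/
def WalkDrawing (G : SimpleGraph V) (arc : V → V → ℝ → ℝ × ℝ)
    {a b : V} (w : G.Walk a b) : Set (ℝ × ℝ) :=
  ⋃ (u : V) (v : V) (_ : G.Adj u v) (_ : s(u, v) ∈ w.edges), ArcImage (arc u v)

/-- A face of a plane drawing: a connected component of the complement of the
drawing. -/
def IsFace (G : SimpleGraph V) (vtx : V → ℝ × ℝ) (arc : V → V → ℝ → ℝ × ℝ)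
    (f : Set (ℝ × ℝ)) : Prop :=
  ∃ p : ℝ × ℝ, p ∉ Drawing G vtx arc ∧
    f = connectedComponentIn (Drawing G vtx arc)ᶜ p

/-- The outer face: the unbounded face. -/
def IsOuterFace (G : SimpleGraph V) (vtx : V → ℝ × ℝ) (arc : V → V → ℝ → ℝ × ℝ)
    (f : Set (ℝ × ℝ)) : Prop :=
  IsFace G vtx arc f ∧ ¬ Bornology.IsBounded f

/-- A vertex is on a face if its image lies on the boundary of the face. -/
def VertexOnFace (vtx : V → ℝ × ℝ) (f : Set (ℝ × ℝ)) (v : V) : Prop :=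
  vtx v ∈ frontier f

/-- The face `f` is bounded by the (closed) walk `w`. -/
def FaceBoundedBy (G : SimpleGraph V) (vtx : V → ℝ × ℝ) (arc : V → V → ℝ → ℝ × ℝ)
    (f : Set (ℝ × ℝ)) {a : V} (w : G.Walk a a) : Prop :=
  IsFace G vtx arc f ∧ frontier f = WalkDrawing G arc w

/-- A vertex lies (strictly) inside the cycle `C` of the plane graph. -/
def VertexInsideCycle (G : SimpleGraph V) (vtx : V → ℝ × ℝ)
    (arc : V → V → ℝ → ℝ × ℝ) {a : V} (C : G.Walk a a) (v : V) : Prop :=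
  vtx v ∉ WalkDrawing G arc C ∧
  Bornology.IsBounded (connectedComponentIn (WalkDrawing G arc C)ᶜ (vtx v))

/-- A vertex lies (strictly) outside the cycle `C` of the plane graph. -/
def VertexOutsideCycle (G : SimpleGraph V) (vtx : V → ℝ × ℝ)
    (arc : V → V → ℝ → ℝ × ℝ) {a : V} (C : G.Walk a a) (v : V) : Prop :=
  vtx v ∉ WalkDrawing G arc C ∧
  ¬ Bornology.IsBounded (connectedComponentIn (WalkDrawing G arc C)ᶜ (vtx v))

/-- A cycle of a plane graph is separating if its interior and its exterior
each contain a vertex of the graph. -/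
def IsSeparatingCycle (G : SimpleGraph V) (vtx : V → ℝ × ℝ)
    (arc : V → V → ℝ → ℝ × ℝ) {a : V} (C : G.Walk a a) : Prop :=
  (∃ v : V, VertexInsideCycle G vtx arc C v) ∧
  (∃ v : V, VertexOutsideCycle G vtx arc C v)

/-- The cycle `C` has no chord in `G`. -/
def Chordless (G : SimpleGraph V) {a : V} (C : G.Walk a a) : Prop :=
  ∀ ⦃u v : V⦄, u ∈ C.support → v ∈ C.support → G.Adj u v → s(u, v) ∈ C.edges

/-- The precoloring `c0` of the cycle `C0` extends to a super IF-coloring of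
`(G, C0)`. -/
def ExtendsToSuper (G : SimpleGraph V) {v0 : V} (C0 : G.Walk v0 v0)
    (c0 : V → Bool) : Prop :=
  ∃ c : V → Bool, SuperIFColoring G {x | x ∈ C0.support} c ∧
    ∀ x ∈ C0.support, c x = c0 x

/-- A counterexample to the extension theorem: a planar graph with `d* ≥ 3`, a
good cycle `C0` of length at most `9`, and an `(I,F)`-coloring of `G[V(C0)]`
which does not extend to a super IF-coloring of `(G, C0)`. -/
def IsCounterexample (G : SimpleGraph V) {v0 : V} (C0 : G.Walk v0 v0)
    (c0 : V → Bool) : Prop :=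
  IsPlanarGraph G ∧ Cycles5Apart G ∧ IsGoodCycle G C0 ∧ C0.length ≤ 9 ∧
  IFColoringOn G {x | x ∈ C0.support} c0 ∧ ¬ ExtendsToSuper G C0 c0

/-- The quantity `|V(G)| + |E(G)|`. -/
noncomputable def graphSize {V : Type} [Fintype V] (G : SimpleGraph V) : ℕ :=
  Fintype.card V + G.edgeSet.ncard

/-- A minimal counterexample to the extension theorem: one minimizing
`|V(G)| + |E(G)|` among all counterexamples. -/
def IsMinimalCounterexample [Fintype V] (G : SimpleGraph V) {v0 : V}
    (C0 : G.Walk v0 v0) (c0 : V → Bool) : Prop :=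
  IsCounterexample G C0 c0 ∧
  ∀ (n : ℕ) (G' : SimpleGraph (Fin n)) (v0' : Fin n) (C0' : G'.Walk v0' v0')
    (c0' : Fin n → Bool), IsCounterexample G' C0' c0' →
      graphSize G ≤ graphSize G'

/-- A chord of the cycle `C` splitting it into two cycles of lengths `l1` and
`l2`: an edge between two non-consecutive vertices of `C` together with two
cycles of lengths `l1` and `l2` which both use the chord, use otherwise only
edges of `C`, and together partition the edges of `C`. -/
def HasChordSplit (G : SimpleGraph V) {a : V} (C : G.Walk a a) (l1 l2 : ℕ) : Prop :=
  ∃ u v : V, u ∈ C.support ∧ v ∈ C.support ∧ G.Adj u v ∧ s(u, v) ∉ C.edges ∧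
    ∃ (c1 c2 : G.Walk u u), c1.IsCycle ∧ c2.IsCycle ∧
      c1.length = l1 ∧ c2.length = l2 ∧
      s(u, v) ∈ c1.edges ∧ s(u, v) ∈ c2.edges ∧
      (∀ e ∈ c1.edges, e ≠ s(u, v) → e ∈ C.edges) ∧
      (∀ e ∈ c2.edges, e ≠ s(u, v) → e ∈ C.edges) ∧
      (∀ e ∈ C.edges, (e ∈ c1.edges ↔ e ∉ c2.edges))

/-- A `(l1, l2, l3)`-claw of the cycle `C`: a claw which together with `C`
forms three cycles of lengths `l1`, `l2` and `l3`. -/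
def HasClawSplit (G : SimpleGraph V) {a : V} (C : G.Walk a a) (l1 l2 l3 : ℕ) : Prop :=
  ∃ x : V, x ∉ C.support ∧ ∃ v1 v2 v3 : V,
    v1 ∈ C.support ∧ v2 ∈ C.support ∧ v3 ∈ C.support ∧
    v1 ≠ v2 ∧ v1 ≠ v3 ∧ v2 ≠ v3 ∧ G.Adj x v1 ∧ G.Adj x v2 ∧ G.Adj x v3 ∧
    ∃ (w1 w2 w3 : G.Walk x x), w1.IsCycle ∧ w2.IsCycle ∧ w3.IsCycle ∧
      w1.length = l1 ∧ w2.length = l2 ∧ w3.length = l3 ∧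
      (∀ e ∈ w1.edges, e ∈ C.edges ∨ e = s(x, v1) ∨ e = s(x, v2) ∨ e = s(x, v3)) ∧
      (∀ e ∈ w2.edges, e ∈ C.edges ∨ e = s(x, v1) ∨ e = s(x, v2) ∨ e = s(x, v3)) ∧
      (∀ e ∈ w3.edges, e ∈ C.edges ∨ e = s(x, v1) ∨ e = s(x, v2) ∨ e = s(x, v3)) ∧
      (∀ e ∈ C.edges, (e ∈ w1.edges ∧ e ∉ w2.edges ∧ e ∉ w3.edges) ∨
        (e ∉ w1.edges ∧ e ∈ w2.edges ∧ e ∉ w3.edges) ∨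
        (e ∉ w1.edges ∧ e ∉ w2.edges ∧ e ∈ w3.edges))

/-- A special `9`-cycle: a `9`-cycle having a `(3,8)`-chord or a
`(5,5,5)`-claw. -/
def IsSpecial9Cycle (G : SimpleGraph V) {a : V} (C : G.Walk a a) : Prop :=
  C.IsCycle ∧ C.length = 9 ∧ (HasChordSplit G C 3 8 ∨ HasClawSplit G C 5 5 5)

/-- Two cycles are normally adjacent if they share exactly one edge and
exactly two vertices. -/
def NormallyAdjacent (G : SimpleGraph V) {a b : V}
    (c1 : G.Walk a a) (c2 : G.Walk b b) : Prop :=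
  (∃ e : Sym2 V, {e' : Sym2 V | e' ∈ c1.edges} ∩ {e' : Sym2 V | e' ∈ c2.edges} = {e}) ∧
  (∃ x y : V, x ≠ y ∧ {z : V | z ∈ c1.support} ∩ {z : V | z ∈ c2.support} = {x, y})

/-- A `3`-fold cover `(H, L)` of `G`. -/
def IsDPCover (G : SimpleGraph V) {W : Type} (H : SimpleGraph W)
    (L : V → Finset W) : Prop :=
  (∀ v : V, (L v).card = 3) ∧
  (∀ ⦃u v : V⦄, u ≠ v → Disjoint (L u) (L v)) ∧
  (∀ v : V, ∀ a ∈ L v, ∀ b ∈ L v, ¬ H.Adj a b) ∧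
  (∀ ⦃a b : W⦄, H.Adj a b → ∃ u v : V, G.Adj u v ∧ a ∈ L u ∧ b ∈ L v) ∧
  (∀ ⦃u v : V⦄, u ≠ v → ∀ a ∈ L u, ∀ b ∈ L v, ∀ b' ∈ L v,
    H.Adj a b → H.Adj a b' → b = b')

/-- `G` is DP-`3`-colorable: for every `3`-fold cover `(H, L)` of `G` there is
an independent transversal picking one vertex from each fiber. -/
def DP3Colorable (G : SimpleGraph V) : Prop :=
  ∀ (W : Type) (H : SimpleGraph W) (L : V → Finset W), IsDPCover G H L →
    ∃ f : V → W, (∀ v : V, f v ∈ L v) ∧ ∀ u v : V, ¬ H.Adj (f u) (f v)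

section Degeneracy
open Classical

variable {U : Type*}

lemma isChain_of_infix {r : U → U → Prop} {l l' : List U} (hl : l.IsChain r) (h : l' <:+: l) :
    l'.IsChain r := by
  obtain ⟨s, t, rfl⟩ := h
  exact (List.isChain_append.1 (List.isChain_append.1 hl).1).2.1

/-- The number of neighbours of `t` in the finite set `D`, as an integer. -/
noncomputable def nbrCount (G : SimpleGraph U) (D : Finset U) (t : U) : ℤ :=
  ∑ d ∈ D, if G.Adj d t then 1 else 0

/-- Weak degeneracy with a save operation: the vertices of `X` can be removed one at a time while
the budget `f` stays positive on the remaining vertices.  Removing `u` costs each remaining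
neighbour of `u` one unit, except that one neighbour with a smaller budget than `u` may be
spared. -/
inductive WD (G : SimpleGraph U) : Finset U → (U → ℤ) → Prop
  | empty (f : U → ℤ) : WD G ∅ f
  | delete {X : Finset U} {f : U → ℤ} (u : U) (hu : u ∈ X) (h1 : 1 ≤ f u)
      (h : WD G (X.erase u) (fun t => f t - if G.Adj u t then 1 else 0)) : WD G X f
  | save {X : Finset U} {f : U → ℤ} (u w : U) (hu : u ∈ X) (hw : w ∈ X) (huw : G.Adj u w)
      (hf : f w < f u)
      (h : WD G (X.erase u) (fun t => f t - if G.Adj u t ∧ t ≠ w then 1 else 0)) : WD G X f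

variable {G : SimpleGraph U}

lemma nbrCount_nonneg (D : Finset U) (t : U) : 0 ≤ nbrCount G D t :=
  Finset.sum_nonneg fun d _ => by split_ifs <;> simp

lemma nbrCount_union {D D' : Finset U} (h : Disjoint D D') (t : U) :
    nbrCount G (D ∪ D') t = nbrCount G D t + nbrCount G D' t :=
  Finset.sum_union h

lemma nbrCount_erase {D : Finset U} {u : U} (hu : u ∈ D) (t : U) :
    nbrCount G D t = nbrCount G (D.erase u) t + if G.Adj u t then 1 else 0 :=
  (Finset.sum_erase_add D _ hu).symm

lemma nbrCount_insert {D : Finset U} {u : U} (hu : u ∉ D) (t : U) :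
    nbrCount G (insert u D) t = nbrCount G D t + if G.Adj u t then 1 else 0 := by
  rw [nbrCount, Finset.sum_insert hu, add_comm]; rfl

lemma WD.pos {X : Finset U} {f : U → ℤ} (h : WD G X f) : ∀ t ∈ X, 1 ≤ f t := by
  induction h with
  | empty f => simp
  | @delete X f u hu h1 h ih =>
    intro t ht
    by_cases htu : t = u
    · rwa [htu]
    · have := ih t (by simp [htu, ht])
      beta_reduce at this; split_ifs at this <;> omega
  | @save X f u w hu hw huw hf h ih =>
    intro t ht
    by_cases htu : t = u
    · have := ih w (by simp [hw, huw.ne'])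
      simp at this
      rw [htu]; omega
    · have := ih t (by simp [htu, ht])
      beta_reduce at this; split_ifs at this <;> omega

lemma WD.mono {X : Finset U} {f : U → ℤ} (h : WD G X f) :
    ∀ {g : U → ℤ}, (∀ t ∈ X, f t ≤ g t) → WD G X g := by
  induction h with
  | empty f => intro g _; exact WD.empty g
  | @delete X f u hu h1 h ih =>
    intro g hg
    refine WD.delete u hu (h1.trans (hg u hu)) (ih fun t ht => ?_)
    have := hg t (Finset.mem_of_mem_erase ht)
    simp only; omega
  | @save X f u w hu hw huw hf h ih =>
    intro g hg
    by_cases hlt : g w < g u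
    · refine WD.save u w hu hw huw hlt (ih fun t ht => ?_)
      have := hg t (Finset.mem_of_mem_erase ht)
      simp only; omega
    · have hpos := (WD.save u w hu hw huw hf h).pos u hu
      refine WD.delete u hu (hpos.trans (hg u hu)) (ih fun t ht => ?_)
      have h1 := hg t (Finset.mem_of_mem_erase ht)
      have h2 := hg u hu
      by_cases htw : t = w
      · subst htw
        simp [huw]
        omega
      · simp [htw]; omega

lemma WD.seq {X Y : Finset U} {f : U → ℤ} (h : WD G X f) :
    ∀ {f' : U → ℤ}, WD G Y f' → Disjoint X Y → (∀ t ∈ Y, f' t ≤ f t - nbrCount G X t) →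
      WD G (X ∪ Y) f := by
  induction h with
  | empty f =>
    intro f' h' _ hf
    rw [Finset.empty_union]
    exact h'.mono fun t ht => by simpa [nbrCount] using hf t ht
  | @delete X f u hu h1 h ih =>
    intro f' h' hd hf
    have huY : u ∉ Y := Finset.disjoint_left.1 hd hu
    refine WD.delete u (Finset.mem_union_left _ hu) h1 ?_
    rw [Finset.erase_union_distrib, Finset.erase_eq_of_notMem huY]
    refine ih h' (hd.mono_left (Finset.erase_subset _ _)) fun t ht => ?_
    have := hf t ht
    rw [nbrCount_erase hu] at this
    simp only; omega
  | @save X f u w hu hw huw hf h ih =>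
    intro f' h' hd hff
    have huY : u ∉ Y := Finset.disjoint_left.1 hd hu
    refine WD.save u w (Finset.mem_union_left _ hu) (Finset.mem_union_left _ hw) huw hf ?_
    rw [Finset.erase_union_distrib, Finset.erase_eq_of_notMem huY]
    refine ih h' (hd.mono_left (Finset.erase_subset _ _)) fun t ht => ?_
    have := hff t ht
    have htw : t ≠ w := fun e => Finset.disjoint_left.1 hd hw (e ▸ ht)
    rw [nbrCount_erase hu] at this
    simp only [htw, ne_eq, not_false_eq_true, and_true]; omega

/-- The number of `F`-coloured neighbours of `u` in `X` that precede `u` in the order `ρ`. -/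
noncomputable def earlierCount (G : SimpleGraph U) (X : Finset U) (c : U → Bool) (ρ : U → ℤ)
    (u : U) : ℤ :=
  ∑ v ∈ X, if G.Adj v u ∧ c v = false ∧ ρ v < ρ u then 1 else 0

lemma exists_lower_bound (X : Finset U) (ρ : U → ℤ) : ∃ m, ∀ t ∈ X, m ≤ ρ t := by
  obtain ⟨M, hM⟩ := Finset.exists_le (X.image fun t => -ρ t)
  exact ⟨-M, fun t ht => neg_le.1 (hM _ (Finset.mem_image_of_mem _ ht))⟩

lemma WD.exists_order {n : ℕ} : ∀ {X : Finset U} {fI fF : U → ℤ}, X.card = n →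
    WD G X (fun t => fI t + fF t) → (∀ t ∈ X, 0 ≤ fI t ∧ fI t ≤ 1) →
    (∀ t ∈ X, 0 ≤ fF t ∧ fF t ≤ 2) →
    ∃ (c : U → Bool) (ρ : U → ℤ), Set.InjOn ρ X ∧
      (∀ u ∈ X, ∀ v ∈ X, G.Adj u v → c u = true → c v = false) ∧
      (∀ u ∈ X, c u = true → 1 ≤ fI u) ∧
      (∀ u ∈ X, c u = false → earlierCount G X c ρ u < fF u) := by
  induction n with
  | zero =>
    intro X fI fF hX _ _ _
    obtain rfl := Finset.card_eq_zero.1 hX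
    exact ⟨fun _ => true, fun _ => 0, by simp⟩
  | succ n ih =>
    intro X fI fF hX h hI hF
    -- colour a vertex `u` with `I`
    have colI : ∀ u ∈ X, 1 ≤ fI u → ∀ w, (w ∈ X → G.Adj u w → fI w < fI u) →
        WD G (X.erase u) (fun t => fI t + fF t - if G.Adj u t ∧ t ≠ w then 1 else 0) →
        ∃ (c : U → Bool) (ρ : U → ℤ), Set.InjOn ρ X ∧
          (∀ u ∈ X, ∀ v ∈ X, G.Adj u v → c u = true → c v = false) ∧
          (∀ u ∈ X, c u = true → 1 ≤ fI u) ∧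
          (∀ u ∈ X, c u = false → earlierCount G X c ρ u < fF u) := by
      intro u hu hu1 w hw hWD
      obtain ⟨c, ρ, hinj, hind, hc1, hc0⟩ := ih (X := X.erase u)
        (fI := fun t => if G.Adj u t then 0 else fI t) (fF := fF)
        (by rw [Finset.card_erase_of_mem hu, hX]; rfl)
        (hWD.mono fun t ht => by
          have h1 := hI t (Finset.mem_of_mem_erase ht)
          have h2 := hI u hu
          by_cases hadj : G.Adj u t
          · by_cases htw : t = w
            · have := hw (htw ▸ Finset.mem_of_mem_erase ht) (htw ▸ hadj)
              subst htw
              simp [hadj]; omega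
            · simp [hadj, htw]; omega
          · simp [hadj])
        (fun t ht => by
          have h1 := hI t (Finset.mem_of_mem_erase ht)
          split_ifs <;> omega)
        (fun t ht => hF t (Finset.mem_of_mem_erase ht))
      obtain ⟨m, hm'⟩ := exists_lower_bound X ρ
      have hnadj : ∀ t ∈ X, t ≠ u → c t = true → ¬ G.Adj u t := by
        intro t ht htu hct hadj
        have := hc1 t (by simp [ht, htu]) hct
        simp [hadj] at this
      refine ⟨Function.update c u true, Function.update ρ u (m - 1), ?_, ?_, ?_, ?_⟩
      · intro s hs t ht hst
        have h1 := hm' s hs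
        have h2 := hm' t ht
        by_cases hsu : s = u <;> by_cases htu : t = u
        · rw [hsu, htu]
        · subst hsu; simp [Function.update_of_ne htu] at hst; omega
        · subst htu; simp [Function.update_of_ne hsu] at hst; omega
        · rw [Function.update_of_ne hsu, Function.update_of_ne htu] at hst
          exact hinj (by simpa [hsu] using hs) (by simpa [htu] using ht) hst
      · intro s hs t ht hst hcs
        by_cases hsu : s = u
        · subst hsu
          rw [Function.update_of_ne hst.ne']
          by_contra hct
          exact hnadj t ht hst.ne' (by simpa using hct) hst
        · rw [Function.update_of_ne hsu] at hcs
          have htu : t ≠ u := by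
            rintro rfl
            exact hnadj s hs hsu hcs hst.symm
          rw [Function.update_of_ne htu]
          exact hind s (by simp [hs, hsu]) t (by simp [ht, htu]) hst hcs
      · intro s hs hcs
        by_cases hsu : s = u
        · rwa [hsu]
        · rw [Function.update_of_ne hsu] at hcs
          have := hc1 s (by simp [hs, hsu]) hcs
          split_ifs at this
          · omega
          · exact this
      · intro s hs hcs
        by_cases hsu : s = u
        · subst hsu; simp at hcs
        · rw [Function.update_of_ne hsu] at hcs
          refine lt_of_le_of_lt (le_of_eq ?_) (hc0 s (by simp [hs, hsu]) hcs)
          rw [earlierCount, ← Finset.sum_erase_add _ _ hu, earlierCount]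
          simp only [Function.update_self]
          simp only [Bool.true_eq_false, false_and, and_false, if_false, add_zero]
          refine Finset.sum_congr rfl fun v hv => ?_
          rw [Function.update_of_ne (Finset.ne_of_mem_erase hv),
            Function.update_of_ne (Finset.ne_of_mem_erase hv), Function.update_of_ne hsu]
    have colF : ∀ u ∈ X, 1 ≤ fF u → ∀ w, (w ∈ X → G.Adj u w → fF w < fF u) →
        WD G (X.erase u) (fun t => fI t + fF t - if G.Adj u t ∧ t ≠ w then 1 else 0) →
        ∃ (c : U → Bool) (ρ : U → ℤ), Set.InjOn ρ X ∧
          (∀ u ∈ X, ∀ v ∈ X, G.Adj u v → c u = true → c v = false) ∧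
          (∀ u ∈ X, c u = true → 1 ≤ fI u) ∧
          (∀ u ∈ X, c u = false → earlierCount G X c ρ u < fF u) := by
      intro u hu hu1 w hw hWD
      obtain ⟨c, ρ, hinj, hind, hc1, hc0⟩ := ih (X := X.erase u) (fI := fI)
        (fF := fun t => if G.Adj u t ∧ t ≠ w then max 0 (fF t - 1) else fF t)
        (by rw [Finset.card_erase_of_mem hu, hX]; rfl)
        (hWD.mono fun t ht => by
          by_cases hadj : G.Adj u t ∧ t ≠ w
          · simp [hadj]; omega
          · rw [if_neg hadj, if_neg hadj]; simp)
        (fun t ht => hI t (Finset.mem_of_mem_erase ht))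
        (fun t ht => by
          have h1 := hF t (Finset.mem_of_mem_erase ht)
          split_ifs <;> omega)
      obtain ⟨m, hm'⟩ := exists_lower_bound X ρ
      have hnn : ∀ s, ∀ v ∈ X.erase u,
          (0 : ℤ) ≤ if G.Adj v s ∧ c v = false ∧ ρ v < ρ s then 1 else 0 := by
        intro s v _; split_ifs <;> simp
      -- `w` has no earlier neighbour when it is coloured `F`
      have hwF : w ∈ X → G.Adj u w → c w = false → fF u = 2 ∧ fF w = 1 ∧
          ∀ v ∈ X.erase u, G.Adj v w → c v = false → ρ w ≤ ρ v := by
        intro hwX hadj hcw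
        have h1 := hc0 w (by simp [hwX, hadj.ne']) hcw
        simp only [ne_eq, not_true_eq_false, and_false, if_false] at h1
        have h2 := hw hwX hadj
        have h3 := hF u hu
        have h4 : 0 ≤ earlierCount G (X.erase u) c ρ w := Finset.sum_nonneg (hnn w)
        refine ⟨by omega, by omega, fun v hv hvw hcv => ?_⟩
        by_contra hlt
        push Not at hlt
        have := Finset.single_le_sum (hnn w) hv
        rw [if_pos ⟨hvw, hcv, hlt⟩] at this
        change 1 ≤ earlierCount G (X.erase u) c ρ w at this
        omega
      set ρ' : U → ℤ := fun t => if t = u then m - 1 else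
        if t = w ∧ G.Adj u w ∧ c w = false then m - 2 else ρ t with hρ'
      refine ⟨Function.update c u false, ρ', ?_, ?_, ?_, ?_⟩
      · intro s hs t ht hst
        have h1 := hm' s hs
        have h2 := hm' t ht
        by_cases hsu : s = u <;> by_cases htu : t = u
        · rw [hsu, htu]
        · simp only [hρ', hsu, htu, if_true, if_false] at hst
          split_ifs at hst <;> omega
        · simp only [hρ', hsu, htu, if_true, if_false] at hst
          split_ifs at hst <;> omega
        · simp only [hρ', hsu, htu, if_false] at hst
          split_ifs at hst with h3 h4 h4
          · rw [h3.1, h4.1]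
          · omega
          · omega
          · exact hinj (by simpa [hsu] using hs) (by simpa [htu] using ht) hst
      · intro s hs t ht hst hcs
        by_cases htu : t = u
        · simp [htu]
        · rw [Function.update_of_ne htu]
          by_cases hsu : s = u
          · subst hsu; simp at hcs
          · rw [Function.update_of_ne hsu] at hcs
            exact hind s (by simp [hs, hsu]) t (by simp [ht, htu]) hst hcs
      · intro s hs hcs
        by_cases hsu : s = u
        · subst hsu; simp at hcs
        · rw [Function.update_of_ne hsu] at hcs
          exact hc1 s (by simp [hs, hsu]) hcs
      · intro s hs hcs
        by_cases hsu : s = u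
        · subst hsu
          by_cases hwc : w ∈ X ∧ G.Adj s w ∧ c w = false
          · obtain ⟨h1, -, -⟩ := hwF hwc.1 hwc.2.1 hwc.2.2
            rw [h1]
            refine lt_of_le_of_lt (b := 1) ?_ (by norm_num)
            rw [earlierCount, ← Finset.sum_erase_add _ _ hwc.1]
            have : ∑ v ∈ X.erase w, (if G.Adj v s ∧ Function.update c s false v = false ∧
                ρ' v < ρ' s then (1 : ℤ) else 0) = 0 := by
              refine Finset.sum_eq_zero fun v hv => if_neg ?_
              rintro ⟨hv1, -, hv2⟩
              simp only [hρ', hv1.ne, if_false, Finset.ne_of_mem_erase hv, false_and, if_true]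
                at hv2
              have := hm' v (Finset.mem_of_mem_erase hv)
              omega
            rw [this]
            split_ifs <;> simp
          · refine lt_of_le_of_lt (le_of_eq ?_) (show (0 : ℤ) < fF s by omega)
            refine Finset.sum_eq_zero fun v hv => if_neg ?_
            rintro ⟨hv1, -, hv2⟩
            have h2 : ¬ (v = w ∧ G.Adj s w ∧ c w = false) := by
              rintro ⟨rfl, h⟩; exact hwc ⟨hv, h⟩
            simp only [hρ', hv1.ne, if_false, h2, if_true] at hv2
            have := hm' v hv
            omega
        · rw [Function.update_of_ne hsu] at hcs
          have hse : s ∈ X.erase u := by simp [hs, hsu]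
          have hc := hc0 s hse hcs
          by_cases hsw : s = w ∧ G.Adj u w
          · obtain ⟨rfl, hadj⟩ := hsw
            obtain ⟨-, h1, -⟩ := hwF hs hadj hcs
            rw [h1]
            refine lt_of_le_of_lt (le_of_eq ?_) zero_lt_one
            refine Finset.sum_eq_zero fun v hv => if_neg ?_
            rintro ⟨hv1, -, hv2⟩
            simp only [hρ', hsu, hv1.ne, if_false, hadj, hcs, and_true, if_true] at hv2
            have := hm' v hv
            split_ifs at hv2 <;> omega
          · have hρs : ρ' s = ρ s := by
              simp only [hρ', hsu, if_false]
              exact if_neg fun h => hsw ⟨h.1, h.2.1⟩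
            have hle : earlierCount G X (Function.update c u false) ρ' s ≤
                earlierCount G (X.erase u) c ρ s + if G.Adj u s then 1 else 0 := by
              rw [earlierCount, ← Finset.sum_erase_add _ _ hu, earlierCount]
              refine add_le_add (Finset.sum_le_sum fun v hv => ?_) ?_
              · rw [Function.update_of_ne (Finset.ne_of_mem_erase hv), hρs]
                by_cases hvw : v = w ∧ G.Adj u w ∧ c w = false
                · obtain ⟨rfl, hadj, hcv⟩ := hvw
                  obtain ⟨-, -, h3⟩ := hwF (Finset.mem_of_mem_erase hv) hadj hcv
                  by_cases hvs : G.Adj v s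
                  · have h4 := h3 s hse hvs.symm hcs
                    have h5 : ρ v ≠ ρ s := fun e => hvs.ne (hinj hv hse e)
                    rw [if_pos (c := G.Adj v s ∧ c v = false ∧ ρ v < ρ s) ⟨hvs, hcv, by omega⟩]
                    split_ifs <;> simp
                  · simp [hvs]
                · have : ρ' v = ρ v := by
                    simp only [hρ', Finset.ne_of_mem_erase hv, if_false]
                    exact if_neg hvw
                  rw [this]
              · by_cases h : G.Adj u s <;> simp [h]
                split_ifs <;> simp
            have h0 : 0 ≤ earlierCount G (X.erase u) c ρ s := Finset.sum_nonneg (hnn s)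
            by_cases hadj : G.Adj u s
            · have : s ≠ w := fun e => hsw ⟨e, e ▸ hadj⟩
              rw [if_pos ⟨hadj, this⟩] at hc
              rw [if_pos hadj] at hle
              omega
            · rw [if_neg (fun h => hadj h.1)] at hc
              rw [if_neg hadj] at hle
              omega
    cases h with
    | empty => simp at hX
    | delete u hu h1 h =>
      beta_reduce at h1
      have hWD : WD G (X.erase u) (fun t => fI t + fF t - if G.Adj u t ∧ t ≠ u then 1 else 0) :=
        h.mono fun t ht => by
          simp only [ne_eq, Finset.ne_of_mem_erase ht, not_false_eq_true, and_true, le_refl]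
      by_cases hc : 1 ≤ fI u
      · exact colI u hu hc u (fun _ h => (G.loopless.irrefl u h).elim) hWD
      · exact colF u hu (by omega) u (fun _ h => (G.loopless.irrefl u h).elim) hWD
    | save u w hu hw huw hf h =>
      beta_reduce at hf
      have h1 := hI w hw
      have h2 := hF w hw
      by_cases hc : fI w < fI u
      · exact colI u hu (by omega) w (fun _ _ => hc) h
      · exact colF u hu (by omega) w (fun _ _ => by omega) h

/-- A weakly degenerate set with constant budget three has an `(I,F)`-colouring. -/
lemma WD.exists_coloring {X : Finset U} (h : WD G X (fun _ => 3)) :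
    ∃ c : U → Bool, (∀ u ∈ X, ∀ v ∈ X, G.Adj u v → c u = true → c v = false) ∧
      ∀ (v : U) (p : G.Walk v v), p.IsCycle → (∀ x ∈ p.support, x ∈ X) →
        ¬ ∀ x ∈ p.support, c x = false := by
  obtain ⟨c, ρ, hinj, hind, -, hc⟩ := WD.exists_order (n := X.card) (X := X)
    (fI := fun _ => 1) (fF := fun _ => 2) rfl (by simpa using h) (by simp) (by simp)
  refine ⟨c, hind, fun v p hp hpX hpc => ?_⟩
  obtain ⟨u, hu, hmax⟩ := Finset.exists_max_image p.support.toFinset ρ ⟨v, by simp⟩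
  rw [List.mem_toFinset] at hu
  set q := p.rotate u hu with hq
  have hqc : q.IsCycle := hp.rotate hu
  have hsub : ∀ x ∈ q.support, x ∈ p.support := by
    intro x hx
    rw [hq] at hx
    simpa using hx
  have hlt : ∀ x ∈ q.support, G.Adj x u → G.Adj x u ∧ c x = false ∧ ρ x < ρ u := by
    intro x hx hxu
    have hx' := hsub x hx
    refine ⟨hxu, hpc x hx', lt_of_le_of_ne (hmax x (by simpa using hx')) fun e => ?_⟩
    exact hxu.ne (hinj (hpX x hx') (hpX u hu) e)
  have h1 := hlt q.snd (q.getVert_mem_support 1) (q.adj_snd hqc.not_nil).symm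
  have h2 := hlt q.penultimate (q.getVert_mem_support _) (q.adj_penultimate hqc.not_nil)
  have hne : q.snd ≠ q.penultimate := hqc.snd_ne_penultimate
  have hlt2 := hc u (hpX u hu) (hpc u hu)
  have hle : ∑ v ∈ ({q.snd, q.penultimate} : Finset U),
      (if G.Adj v u ∧ c v = false ∧ ρ v < ρ u then (1 : ℤ) else 0) ≤ earlierCount G X c ρ u := by
    refine Finset.sum_le_sum_of_subset_of_nonneg ?_ fun v _ _ => by split_ifs <;> simp
    intro x hx
    simp only [Finset.mem_insert, Finset.mem_singleton] at hx
    rcases hx with rfl | rfl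
    · exact hpX _ (hsub _ (q.getVert_mem_support 1))
    · exact hpX _ (hsub _ (q.getVert_mem_support _))
  rw [Finset.sum_pair hne, if_pos h1, if_pos h2] at hle
  omega

end Degeneracy

section Compactness

lemma IFColorable.of_finite_parts {U : Type} {G : SimpleGraph U}
    (h : ∀ X : Finset U, ∃ c : U → Bool,
      (∀ u ∈ X, ∀ v ∈ X, G.Adj u v → c u = true → c v = false) ∧
      ∀ (v : U) (p : G.Walk v v), p.IsCycle → (∀ x ∈ p.support, x ∈ X) →
        ¬ ∀ x ∈ p.support, c x = false) : IFColorable G := by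
  classical
  choose c hc1 hc2 using h
  obtain ⟨F, hF⟩ := Ultrafilter.exists_le (Filter.atTop : Filter (Finset U))
  have hmem : ∀ X : Finset U, ∀ᶠ W in (F : Filter (Finset U)), X ⊆ W := fun X =>
    hF (Filter.eventually_ge_atTop X)
  have key : ∀ x, decide (∀ᶠ W in (F : Filter (Finset U)), c W x = true) = false →
      ∀ᶠ W in (F : Filter (Finset U)), c W x = false := by
    intro x hx
    rw [decide_eq_false_iff_not, ← Ultrafilter.eventually_not] at hx
    simpa using hx
  refine ⟨fun x => decide (∀ᶠ W in (F : Filter (Finset U)), c W x = true), ?_, ?_⟩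
  · intro u v huv hu
    rw [decide_eq_true_eq] at hu
    rw [decide_eq_false_iff_not]
    intro hv
    obtain ⟨W, ⟨h1, h2⟩, h3⟩ := ((hu.and hv).and (hmem {u, v})).exists
    have := hc1 W u (h3 (by simp)) v (h3 (by simp)) huv h1
    simp [h2] at this
  · intro v p hp hall
    have : ∀ᶠ W in (F : Filter (Finset U)), ∀ x ∈ p.support.toFinset, c W x = false :=
      (Filter.eventually_all_finset _).2 fun x hx => key x (hall x (by simpa using hx))
    obtain ⟨W, h1, h2⟩ := (this.and (hmem p.support.toFinset)).exists
    exact hc2 W v p hp (fun x hx => h2 (by simpa using hx)) fun x hx => h1 x (by simpa using hx)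

end Compactness

section ParityDrawings
open Classical

variable {U : Type*}

/-- The crossing parity of the pairs `ab` and `cd`, computed from winding numbers `n` and
directions `τ`. -/
def crossParity (n : U → U → U → ZMod 2) (τ : U → U → ZMod 2) (a b c d : U) : ZMod 2 :=
  n a b c + n a b d + n c d a + n c d b + τ c a + τ c b + τ d a + τ d b

/-- An algebraic shadow of a plane drawing of the graph with adjacency relation `E`: `n a b t` is
the parity of the winding of the arc `ab` around `t`, and `τ a b` is the side on which `b` lies
of `a`.  Independent edges cross evenly. -/
structure ParityDrawing (E : U → U → Prop) where
  n : U → U → U → ZMod 2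
  τ : U → U → ZMod 2
  n_symm : ∀ a b t, n a b t = n b a t
  τ_add : ∀ a b, a ≠ b → τ a b + τ b a = 1
  cross : ∀ a b c d, E a b → E c d → a ≠ c → a ≠ d → b ≠ c → b ≠ d → crossParity n τ a b c d = 0

/-- The adjacency relation of `G` on `W` together with an apex `z` joined to `S`. -/
def Apex (G : SimpleGraph U) (z : U) (W S : Finset U) (a b : U) : Prop :=
  (a ∈ W ∧ b ∈ W ∧ G.Adj a b) ∨ (a = z ∧ b ∈ S) ∨ (b = z ∧ a ∈ S)

/-- The sum of `n` over the consecutive pairs of a list. -/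
def pathSum (n : U → U → U → ZMod 2) : List U → U → ZMod 2
  | [], _ => 0
  | [_], _ => 0
  | a :: b :: l, t => n a b t + pathSum n (b :: l) t

lemma pathSum_append (n : U → U → U → ZMod 2) (l₁ l₂ : List U) (u t : U) :
    pathSum n (l₁ ++ u :: l₂) t = pathSum n (l₁ ++ [u]) t + pathSum n (u :: l₂) t := by
  induction l₁ with
  | nil => simp [pathSum]
  | cons a l ih =>
    cases l with
    | nil => simp [pathSum]
    | cons b l =>
      simp only [List.cons_append, pathSum] at ih ⊢
      rw [ih, add_assoc]

lemma pathSum_reverse {n : U → U → U → ZMod 2} (hn : ∀ a b t, n a b t = n b a t) (l : List U)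
    (t : U) : pathSum n l.reverse t = pathSum n l t := by
  induction l with
  | nil => rfl
  | cons a l ih =>
    cases l with
    | nil => rfl
    | cons b l =>
      rw [List.reverse_cons, List.reverse_cons, List.append_assoc, List.singleton_append,
        pathSum_append, ← List.reverse_cons, ih, pathSum, pathSum, pathSum, hn b a]
      ring

lemma pathSum_congr {n n' : U → U → U → ZMod 2} {l : List U} {t : U}
    (h : ∀ a b, a ∈ l → b ∈ l.tail → n' a b t = n a b t) : pathSum n' l t = pathSum n l t := by
  induction l with
  | nil => rfl
  | cons a l ih =>
    cases l with
    | nil => rfl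
    | cons b l =>
      rw [pathSum, pathSum, h a b (by simp) (by simp),
        ih fun x y hx hy => h x y (List.mem_cons_of_mem _ hx) (by
          simp only [List.tail_cons] at hy ⊢; exact List.mem_cons_of_mem _ hy)]

namespace ParityDrawing

variable {E E' : U → U → Prop}

/-- Restrict a parity drawing to a subgraph. -/
def mono (D : ParityDrawing E) (h : ∀ a b, E' a b → E a b) : ParityDrawing E' :=
  { D with cross := fun a b c d h1 h2 => D.cross a b c d (h _ _ h1) (h _ _ h2) }

/-- The side of `t` with respect to the closed curve through `z` and the path `R`. -/
def side (D : ParityDrawing E) (z : U) (R : List U) (t : U) : ZMod 2 :=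
  pathSum D.n (z :: (R ++ [z])) t

lemma telescope (D : ParityDrawing E) {c d b : U} (hcd : E c d) {l : List U} : ∀ {a : U},
    List.IsChain E (a :: (l ++ [b])) → (∀ e ∈ a :: (l ++ [b]), e ≠ c ∧ e ≠ d) →
    pathSum D.n (a :: (l ++ [b])) c + pathSum D.n (a :: (l ++ [b])) d + D.n c d a + D.n c d b +
      D.τ c a + D.τ c b + D.τ d a + D.τ d b = 0 := by
  induction l with
  | nil =>
    intro a h hne
    simp only [List.nil_append, List.isChain_cons_cons, List.mem_cons, List.not_mem_nil,
      or_false, forall_eq_or_imp, forall_eq] at h hne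
    have := D.cross a b c d h.1 hcd hne.1.1 hne.1.2 hne.2.1 hne.2.2
    simp only [crossParity] at this
    simp only [List.nil_append, pathSum]
    grind
  | cons x l ih =>
    intro a h hne
    simp only [List.cons_append, List.isChain_cons_cons] at h
    have h1 := ih h.2 fun e he => hne e (List.mem_cons_of_mem _ he)
    have ha := hne a (by simp)
    have hx := hne x (by simp)
    have := D.cross a x c d h.1 hcd ha.1 ha.2 hx.1 hx.2
    simp only [crossParity] at this
    simp only [List.cons_append, pathSum]
    grind

end ParityDrawing

section Apex

variable {G : SimpleGraph U} {z : U} {W S : Finset U}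

lemma Apex.mono {W' S' : Finset U} (hW : W' ⊆ W) (hS : S' ⊆ S) (a b : U)
    (h : Apex G z W' S' a b) : Apex G z W S a b := by
  rcases h with ⟨h1, h2, h3⟩ | ⟨h1, h2⟩ | ⟨h1, h2⟩
  · exact Or.inl ⟨hW h1, hW h2, h3⟩
  · exact Or.inr (Or.inl ⟨h1, hS h2⟩)
  · exact Or.inr (Or.inr ⟨h1, hS h2⟩)

/-- A parity drawing of an apex graph is determined by the crossings within `W` and the crossings
of the apex edges with edges in `W`. -/
def ParityDrawing.ofApex (hz : z ∉ W) (n : U → U → U → ZMod 2)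
    (τ : U → U → ZMod 2) (n_symm : ∀ a b t, n a b t = n b a t)
    (τ_add : ∀ a b, a ≠ b → τ a b + τ b a = 1)
    (hW : ∀ a ∈ W, ∀ b ∈ W, ∀ c ∈ W, ∀ d ∈ W, G.Adj a b → G.Adj c d → a ≠ c → a ≠ d → b ≠ c →
      b ≠ d → crossParity n τ a b c d = 0)
    (hS : ∀ s ∈ S, ∀ c ∈ W, ∀ d ∈ W, G.Adj c d → s ≠ c → s ≠ d → crossParity n τ z s c d = 0) :
    ParityDrawing (Apex G z W S) where
  n := n
  τ := τ
  n_symm := n_symm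
  τ_add := τ_add
  cross := by
    intro a b c d hab hcd hac had hbc hbd
    rcases hab with ⟨ha, hb, hab⟩ | ⟨ha, hb⟩ | ⟨hb, ha⟩ <;>
      rcases hcd with ⟨hc, hd, hcd⟩ | ⟨hc, hd⟩ | ⟨hd, hc⟩
    · exact hW a ha b hb c hc d hd hab hcd hac had hbc hbd
    · subst hc
      have := hS d hd a ha b hb hab had.symm hbd.symm
      have h1 := τ_add a c hac
      have h2 := τ_add a d had
      have h3 := τ_add b c hbc
      have h4 := τ_add b d hbd
      simp only [crossParity] at this ⊢
      grind
    · subst hd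
      have := hS c hc a ha b hb hab hac.symm hbc.symm
      have h1 := τ_add a c hac
      have h2 := τ_add a d had
      have h3 := τ_add b c hbc
      have h4 := τ_add b d hbd
      have h5 := n_symm c d a
      have h6 := n_symm c d b
      simp only [crossParity] at this ⊢
      grind
    · subst ha
      exact hS b hb c hc d hd hcd hbc hbd
    · exact (hac (ha.trans hc.symm)).elim
    · exact (had (ha.trans hd.symm)).elim
    · subst hb
      have := hS a ha c hc d hd hcd hac had
      have h5 := n_symm a b c
      have h6 := n_symm a b d
      simp only [crossParity] at this ⊢
      grind
    · exact (hbc (hb.trans hc.symm)).elim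
    · exact (hbd (hb.trans hd.symm)).elim

/-- A path of `G` in `W` with both ends in `S`. -/
structure SPath (G : SimpleGraph U) (W S : Finset U) (R : List U) : Prop where
  ne_nil : R ≠ []
  chain : R.IsChain G.Adj
  nodup : R.Nodup
  mem : ∀ x ∈ R, x ∈ W
  head : ∀ x ∈ R.head?, x ∈ S
  last : ∀ x ∈ R.getLast?, x ∈ S

lemma SPath.reverse {R : List U} (h : SPath G W S R) : SPath G W S R.reverse where
  ne_nil := by simpa using h.ne_nil
  chain := by
    rw [List.isChain_reverse]
    exact h.chain.imp fun a b => G.adj_symm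
  nodup := List.nodup_reverse.2 h.nodup
  mem := fun x hx => h.mem x (List.mem_reverse.1 hx)
  head := by simpa using h.last
  last := by simpa using h.head

lemma isChain_apex {R : List U} (hc : R.IsChain G.Adj) (hm : ∀ x ∈ R, x ∈ W) :
    R.IsChain (Apex G z W S) := by
  induction R with
  | nil => simp
  | cons a l ih =>
    cases l with
    | nil => simp
    | cons b l =>
      rw [List.isChain_cons_cons] at hc ⊢
      exact ⟨Or.inl ⟨hm a (by simp), hm b (by simp), hc.1⟩,
        ih hc.2 fun x hx => hm x (List.mem_cons_of_mem _ hx)⟩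

lemma SPath.isChain_apex {R : List U} (h : SPath G W S R) :
    (z :: (R ++ [z])).IsChain (Apex G z W S) := by
  rw [List.isChain_cons, List.isChain_append]
  refine ⟨fun y hy => ?_, IFPaper.isChain_apex h.chain h.mem, by simp, fun x hx y hy => ?_⟩
  · rw [List.head?_append_of_ne_nil _ h.ne_nil] at hy
    exact Or.inr (Or.inl ⟨rfl, h.head y hy⟩)
  · simp only [List.head?_cons, Option.mem_def, Option.some.injEq] at hy
    exact Or.inr (Or.inr ⟨hy.symm, h.last x hx⟩)

namespace ParityDrawing

lemma side_eq_of_adj (D : ParityDrawing (Apex G z W S)) (hz : z ∉ W) {R : List U}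
    (hR : SPath G W S R) {c d : U} (hc : c ∈ W) (hd : d ∈ W) (hcR : c ∉ R) (hdR : d ∉ R)
    (hcd : G.Adj c d) : D.side z R c = D.side z R d := by
  have := D.telescope (c := c) (d := d) (Or.inl ⟨hc, hd, hcd⟩) (hR.isChain_apex (z := z)) (by
    intro e he
    simp only [List.mem_cons, List.mem_append, List.not_mem_nil, or_false] at he
    rcases he with rfl | he | rfl
    · exact ⟨fun h => hz (h ▸ hc), fun h => hz (h ▸ hd)⟩
    · exact ⟨fun h => hcR (h ▸ he), fun h => hdR (h ▸ he)⟩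
    · exact ⟨fun h => hz (h ▸ hc), fun h => hz (h ▸ hd)⟩)
  simp only [side]
  grind

lemma side_reverse (D : ParityDrawing (Apex G z W S)) (R : List U) (t : U) :
    D.side z R.reverse t = D.side z R t := by
  have : z :: (R.reverse ++ [z]) = (z :: (R ++ [z])).reverse := by simp
  rw [side, this, pathSum_reverse D.n_symm, side]

/-- Deleting a vertex `v ∈ S` and joining the apex to the neighbours of `v`. -/
lemma contract (D : ParityDrawing (Apex G z W S)) (hz : z ∉ W) (hSW : S ⊆ W) {v : U}
    (hv : v ∈ S) : Nonempty (ParityDrawing (Apex G z (W.erase v)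
      ((S ∪ W.filter (G.Adj v)).erase v))) := by
  have hzv : z ≠ v := fun h => hz (h ▸ hSW hv)
  refine ⟨ofApex (fun h => hz (Finset.mem_of_mem_erase h))
    (fun a b t => if a = z ∧ b ∉ S then D.n z v t + D.n v b t else
      if b = z ∧ a ∉ S then D.n z v t + D.n v a t else D.n a b t) D.τ ?_ D.τ_add ?_ ?_⟩
  · intro a b t
    have := D.n_symm a b t
    have hzS : z ∉ S := fun h => hz (hSW h)
    by_cases ha : a = z <;> by_cases hb : b = z
    · rw [ha, hb]
    · simp [ha, hb]; split_ifs <;> grind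
    · simp [ha, hb]; split_ifs <;> grind
    · simp [ha, hb, this]
  · intro a ha b hb c hc d hd hab hcd hac had hbc hbd
    have hne : ∀ x ∈ W.erase v, x ≠ z := fun x hx h => hz (h ▸ Finset.mem_of_mem_erase hx)
    simp only [crossParity, hne a ha, hne b hb, hne c hc, hne d hd, false_and, if_false]
    exact D.cross a b c d
      (Or.inl ⟨Finset.mem_of_mem_erase ha, Finset.mem_of_mem_erase hb, hab⟩)
      (Or.inl ⟨Finset.mem_of_mem_erase hc, Finset.mem_of_mem_erase hd, hcd⟩) hac had hbc hbd
  · intro s hs c hc d hd hcd hsc hsd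
    have hne : ∀ x ∈ W.erase v, x ≠ z := fun x hx h => hz (h ▸ Finset.mem_of_mem_erase hx)
    have hcv := Finset.ne_of_mem_erase hc
    have hdv := Finset.ne_of_mem_erase hd
    have hcd' : Apex G z W S c d :=
      Or.inl ⟨Finset.mem_of_mem_erase hc, Finset.mem_of_mem_erase hd, hcd⟩
    simp only [Finset.mem_erase, Finset.mem_union, Finset.mem_filter] at hs
    have hsz : s ≠ z := by
      rintro rfl
      exact hz (hs.2.elim (fun h => hSW h) (fun h => h.1))
    by_cases hsS : s ∈ S
    · simp only [crossParity, hsS, hne c hc, hne d hd, hsz, false_and, not_true_eq_false,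
        and_false, if_false]
      exact D.cross z s c d (Or.inr (Or.inl ⟨rfl, hsS⟩)) hcd' (hne c hc).symm (hne d hd).symm
        hsc hsd
    · have hsW := (hs.2.resolve_left hsS)
      have h1 := D.cross z v c d (Or.inr (Or.inl ⟨rfl, hv⟩)) hcd' (hne c hc).symm
        (hne d hd).symm hcv.symm hdv.symm
      have h2 := D.cross v s c d (Or.inl ⟨hSW hv, hsW.1, hsW.2⟩) hcd' hcv.symm hdv.symm hsc hsd
      simp only [crossParity, hsS, hne c hc, hne d hd, true_and, not_false_eq_true,
        if_true, false_and, if_false] at h1 h2 ⊢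
      grind

/-- Joining the apex to a single vertex. -/
lemma pendant (D : ParityDrawing (Apex G z W ∅)) (hz : z ∉ W) {v : U} (hv : v ∈ W) :
    Nonempty (ParityDrawing (Apex G z W {v})) := by
  have hvz : v ≠ z := fun h => hz (h ▸ hv)
  refine ⟨ofApex hz
    (fun a b t => if a = z ∨ b = z then 0 else if t = z then D.n a b v else D.n a b t)
    (fun a b => if a = z then (if b = v then 1 else D.τ v b) else
      if b = z then (if a = v then 0 else D.τ a v) else D.τ a b) ?_ ?_ ?_ ?_⟩
  · intro a b t
    simp only [D.n_symm a b, or_comm]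
  · intro a b hab
    by_cases ha : a = z
    · subst ha
      by_cases hb : b = v
      · simp [hb, hvz]
      · simp [hab.symm, hb, D.τ_add v b (Ne.symm hb)]
    · by_cases hb : b = z
      · subst hb
        by_cases hav : a = v
        · simp [hav, hvz]
        · simp [ha, hav, D.τ_add a v hav]
      · simp [ha, hb, D.τ_add a b hab]
  · intro a ha b hb c hc d hd hab hcd hac had hbc hbd
    have hne : ∀ x ∈ W, x ≠ z := fun x hx h => hz (h ▸ hx)
    simp only [crossParity, hne a ha, hne b hb, hne c hc, hne d hd, or_self, if_false]
    exact D.cross a b c d (Or.inl ⟨ha, hb, hab⟩) (Or.inl ⟨hc, hd, hcd⟩) hac had hbc hbd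
  · intro s hs c hc d hd hcd hsc hsd
    rw [Finset.mem_singleton] at hs
    subst hs
    have hne : ∀ x ∈ W, x ≠ z := fun x hx h => hz (h ▸ hx)
    simp only [crossParity, hne c hc, hne d hd, hvz, hsc.symm, hsd.symm, or_false,
      if_true, if_false, or_self]
    grind

/-- Adding an edge from the apex to a vertex of a closed curve with one empty side. -/
lemma add_edge (D : ParityDrawing (Apex G z W S)) (hz : z ∉ W) {R₁ R₂ : List U}
    {u : U} (hR : SPath G W S (R₁ ++ u :: R₂)) (hchord : ∀ c ∈ R₁, ∀ d ∈ R₂, ¬ G.Adj c d)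
    (h₁ : R₁ ≠ []) (h₂ : R₂ ≠ []) {K : ZMod 2}
    (hK : ∀ t ∈ W, t ∉ R₁ ++ u :: R₂ → D.side z (R₁ ++ u :: R₂) t = K) :
    ∃ D' : ParityDrawing (Apex G z W (insert u S)),
      (∀ t ∈ W, t ∉ R₁ ++ [u] → D'.side z (R₁ ++ [u]) t = 0) ∧
      (∀ t ∈ W, t ∉ u :: R₂ → D'.side z (u :: R₂) t = K) ∧
      ∀ a b t, ¬ (a = z ∧ b = u) → ¬ (a = u ∧ b = z) → D'.n a b t = D.n a b t := by
  have huW : u ∈ W := hR.mem u (by simp)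
  have huz : u ≠ z := fun h => hz (h ▸ huW)
  have hne : ∀ x ∈ W, x ≠ z := fun x hx h => hz (h ▸ hx)
  have hnd := hR.nodup
  rw [List.nodup_append] at hnd
  have hu1 : u ∉ R₁ := fun h => hnd.2.2 u h u (by simp) rfl
  have hu2 : u ∉ R₂ := (List.nodup_cons.1 hnd.2.1).1
  have h12 : ∀ x ∈ R₁, x ∉ R₂ := fun x hx h => hnd.2.2 x hx x (by simp [h]) rfl
  have hm1 : ∀ x ∈ R₁, x ∈ W := fun x hx => hR.mem x (by simp [hx])
  have hm2 : ∀ x ∈ R₂, x ∈ W := fun x hx => hR.mem x (by simp [hx])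
  have hch := hR.isChain_apex (z := z)
  have hc1 : (z :: (R₁ ++ [u])).IsChain (Apex G z W S) := by
    have : z :: (R₁ ++ u :: R₂ ++ [z]) = (z :: (R₁ ++ [u])) ++ (R₂ ++ [z]) := by simp
    rw [this, List.isChain_append] at hch
    exact hch.1
  have hc2 : (u :: (R₂ ++ [z])).IsChain (Apex G z W S) := by
    have : z :: (R₁ ++ u :: R₂ ++ [z]) = (z :: R₁) ++ (u :: (R₂ ++ [z])) := by simp
    rw [this, List.isChain_append] at hch
    exact hch.2.1
  have hside : ∀ t, D.side z (R₁ ++ u :: R₂) t =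
      pathSum D.n (z :: (R₁ ++ [u])) t + pathSum D.n (u :: (R₂ ++ [z])) t := by
    intro t
    have : z :: (R₁ ++ u :: R₂ ++ [z]) = (z :: R₁) ++ u :: (R₂ ++ [z]) := by simp
    rw [side, this, pathSum_append]; rfl
  set n' : U → U → U → ZMod 2 := fun a b t => if (a = z ∧ b = u) ∨ (a = u ∧ b = z) then
    (if t ∈ R₁ then pathSum D.n (u :: (R₂ ++ [z])) t + K else pathSum D.n (z :: (R₁ ++ [u])) t)
    else D.n a b t with hn'
  have hnew : ∀ t, n' z u t = if t ∈ R₁ then pathSum D.n (u :: (R₂ ++ [z])) t + K else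
      pathSum D.n (z :: (R₁ ++ [u])) t := fun t => by simp [hn']
  have hold : ∀ a b t, ¬ (a = z ∧ b = u) → ¬ (a = u ∧ b = z) → n' a b t = D.n a b t :=
    fun a b t h1 h2 => if_neg (not_or.2 ⟨h1, h2⟩)
  have hsymm : ∀ a b t, n' a b t = n' b a t := by
    intro a b t
    by_cases h : (a = z ∧ b = u) ∨ (a = u ∧ b = z)
    · have h' : (b = z ∧ a = u) ∨ (b = u ∧ a = z) := by tauto
      simp only [hn', if_pos h, if_pos h']
    · have h' : ¬ ((b = z ∧ a = u) ∨ (b = u ∧ a = z)) := by tauto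
      simp only [hn', if_neg h, if_neg h', D.n_symm a b]
  let D' : ParityDrawing (Apex G z W (insert u S)) := ofApex hz n' D.τ hsymm D.τ_add
    (by
      intro a ha b hb c hc d hd hab hcd hac had hbc hbd
      simp only [crossParity]
      rw [hold a b _ (fun h => hne a ha h.1) (fun h => hne b hb h.2),
        hold a b _ (fun h => hne a ha h.1) (fun h => hne b hb h.2),
        hold c d _ (fun h => hne c hc h.1) (fun h => hne d hd h.2),
        hold c d _ (fun h => hne c hc h.1) (fun h => hne d hd h.2)]
      exact D.cross a b c d (Or.inl ⟨ha, hb, hab⟩) (Or.inl ⟨hc, hd, hcd⟩) hac had hbc hbd)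
    (by
      intro s hs c hc d hd hcd hsc hsd
      have hcd' : Apex G z W S c d := Or.inl ⟨hc, hd, hcd⟩
      simp only [crossParity]
      rw [hold c d _ (fun h => hne c hc h.1) (fun h => hne d hd h.2),
        hold c d _ (fun h => hne c hc h.1) (fun h => hne d hd h.2)]
      by_cases hsu : s = u
      · subst hsu
        rw [hnew, hnew]
        have t1 : c ∉ R₁ → d ∉ R₁ → _ := fun h1 h2 => D.telescope hcd' hc1 (by
          intro e he
          simp only [List.mem_cons, List.mem_append, List.not_mem_nil, or_false] at he
          rcases he with rfl | he | rfl
          · exact ⟨(hne c hc).symm, (hne d hd).symm⟩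
          · exact ⟨fun h => h1 (h ▸ he), fun h => h2 (h ▸ he)⟩
          · exact ⟨hsc, hsd⟩)
        have t2 : c ∉ R₂ → d ∉ R₂ → _ := fun h1 h2 => D.telescope hcd' hc2 (by
          intro e he
          simp only [List.mem_cons, List.mem_append, List.not_mem_nil, or_false] at he
          rcases he with rfl | he | rfl
          · exact ⟨hsc, hsd⟩
          · exact ⟨fun h => h1 (h ▸ he), fun h => h2 (h ▸ he)⟩
          · exact ⟨(hne c hc).symm, (hne d hd).symm⟩)
        have hKc : c ∉ R₁ → c ∉ R₂ → _ := fun h1 h2 => (hside c).symm.trans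
          (hK c hc (by simp [h1, h2, hsc.symm]))
        have hKd : d ∉ R₁ → d ∉ R₂ → _ := fun h1 h2 => (hside d).symm.trans
          (hK d hd (by simp [h1, h2, hsd.symm]))
        by_cases h1 : c ∈ R₁ <;> by_cases h2 : d ∈ R₁
        · have := t2 (h12 c h1) (h12 d h2)
          simp only [h1, h2, if_true]
          grind
        · have h3 : d ∉ R₂ := fun h => hchord c h1 d h hcd
          have h4 := t2 (h12 c h1) h3
          have h5 := hKd h2 h3
          simp only [h1, h2, if_true, if_false]
          grind
        · have h3 : c ∉ R₂ := fun h => hchord d h2 c h hcd.symm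
          have h4 := t2 h3 (h12 d h2)
          have h5 := hKc h1 h3
          simp only [h1, h2, if_true, if_false]
          grind
        · have := t1 h1 h2
          simp only [h1, h2, if_false]
          grind
      · rw [hold z s _ (fun h => hsu h.2) (fun h => huz h.1.symm),
          hold z s _ (fun h => hsu h.2) (fun h => huz h.1.symm)]
        have hsS : s ∈ S := (Finset.mem_insert.1 hs).resolve_left hsu
        exact D.cross z s c d (Or.inr (Or.inl ⟨rfl, hsS⟩)) hcd' (hne c hc).symm (hne d hd).symm
          hsc hsd)
  have hD'n : D'.n = n' := rfl
  have hzR1 : z ∉ R₁ := fun h => hz (hm1 z h)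
  have hzR2 : z ∉ R₂ := fun h => hz (hm2 z h)
  have hps1 : ∀ t, pathSum n' (z :: (R₁ ++ [u])) t = pathSum D.n (z :: (R₁ ++ [u])) t := by
    intro t
    obtain ⟨a, l, rfl⟩ := List.exists_cons_of_ne_nil h₁
    simp only [List.cons_append, pathSum]
    have hau : a ≠ u := fun h => hu1 (by simp [h])
    rw [hold z a t (fun h => hau h.2) (fun h => huz h.1.symm)]
    congr 1
    refine pathSum_congr fun x y hx hy => hold x y t ?_ ?_
    · rintro ⟨rfl, -⟩
      simp only [List.mem_cons, List.mem_append, List.not_mem_nil, or_false] at hx hzR1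
      grind
    · rintro ⟨-, rfl⟩
      simp only [List.tail_cons, List.mem_append, List.mem_cons, List.not_mem_nil,
        or_false] at hy hzR1
      grind
  have hps2 : ∀ t, pathSum n' (u :: (R₂ ++ [z])) t = pathSum D.n (u :: (R₂ ++ [z])) t := by
    intro t
    obtain ⟨a, l, rfl⟩ := List.exists_cons_of_ne_nil h₂
    simp only [List.cons_append, pathSum]
    have haz : a ≠ z := fun h => hzR2 (by simp [h])
    rw [hold u a t (fun h => huz h.1) (fun h => haz h.2)]
    congr 1
    refine pathSum_congr fun x y hx hy => hold x y t ?_ ?_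
    · rintro ⟨-, rfl⟩
      simp only [List.tail_cons, List.mem_append, List.mem_cons, List.not_mem_nil,
        or_false] at hy hu2
      grind
    · rintro ⟨rfl, -⟩
      simp only [List.mem_append, List.mem_cons, List.not_mem_nil, or_false] at hx hu2
      grind
  refine ⟨D', fun t ht htR => ?_, fun t ht htR => ?_, hold⟩
  · have : z :: (R₁ ++ [u] ++ [z]) = (z :: R₁) ++ u :: [z] := by simp
    rw [side, this, pathSum_append, List.cons_append, hD'n, hps1]
    have h1 : t ∉ R₁ := fun h => htR (by simp [h])
    simp only [pathSum, add_zero]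
    rw [hsymm, hnew, if_neg h1]
    grind
  · rw [side, List.cons_append, pathSum, hD'n, hps2, hnew]
    have h2 : t ≠ u ∧ t ∉ R₂ := by simpa using htR
    split_ifs with h1
    · grind
    · rw [← hK t ht (by simp [h1, h2.1, h2.2]), hside]

/-- The rotation at an apex neighbour `s`: a path leaving `s` separates two consecutive corners. -/
lemma side_ne (D : ParityDrawing (Apex G z W S)) (hz : z ∉ W) (hSW : S ⊆ W) {s l r k : U}
    {Q : List U} (hs : s ∈ S) (hl : l ∈ S) (hr : r ∈ S) (hk : k ∈ S) (hsl : G.Adj s l)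
    (hsr : G.Adj s r) (hlr : l ≠ r) {K₁ K₂ : ZMod 2}
    (hK₁ : ∀ t ∈ W, t ∉ [s, l] → D.side z [s, l] t = K₁)
    (hK₂ : ∀ t ∈ W, t ∉ [s, r] → D.side z [s, r] t = K₂)
    (hR : SPath G W S (s :: (Q ++ [k]))) (hlR : l ∉ s :: (Q ++ [k]))
    (hrR : r ∉ s :: (Q ++ [k])) :
    D.side z (s :: (Q ++ [k])) l + D.side z (s :: (Q ++ [k])) r = 1 := by
  have hne : ∀ x ∈ W, x ≠ z := fun x hx h => hz (h ▸ hx)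
  have hzs := (hne s (hSW hs)).symm
  have hzl := (hne l (hSW hl)).symm
  have hzr := (hne r (hSW hr)).symm
  have hzk := (hne k (hSW hk)).symm
  have hsk : s ≠ k := by
    have := hR.nodup
    rw [List.nodup_cons] at this
    exact fun h => this.1 (by simp [h])
  have hkl : k ≠ l := fun h => hlR (by simp [h])
  have hkr : k ≠ r := fun h => hrR (by simp [h])
  have hch := isChain_apex (z := z) (S := S) hR.chain hR.mem
  have hne' : ∀ y, y ∉ s :: (Q ++ [k]) → ∀ e ∈ s :: (Q ++ [k]), e ≠ z ∧ e ≠ y :=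
    fun y hy e he => ⟨hne e (hR.mem e he), fun h => hy (h ▸ he)⟩
  have a1 := D.telescope (c := z) (d := l) (Or.inr (Or.inl ⟨rfl, hl⟩)) hch (hne' l hlR)
  have b1 := D.telescope (c := z) (d := r) (Or.inr (Or.inl ⟨rfl, hr⟩)) hch (hne' r hrR)
  have a2 := D.cross l s k z (Or.inl ⟨hSW hl, hSW hs, hsl.symm⟩) (Or.inr (Or.inr ⟨rfl, hk⟩))
    hkl.symm hzl.symm hsk hzs.symm
  have b2 := D.cross r s k z (Or.inl ⟨hSW hr, hSW hs, hsr.symm⟩) (Or.inr (Or.inr ⟨rfl, hk⟩))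
    hkr.symm hzr.symm hsk hzs.symm
  have c1 := D.cross z l r s (Or.inr (Or.inl ⟨rfl, hl⟩)) (Or.inl ⟨hSW hr, hSW hs, hsr.symm⟩)
    hzr hzs hlr hsl.ne'
  have c2 := D.cross l s z r (Or.inl ⟨hSW hl, hSW hs, hsl.symm⟩) (Or.inr (Or.inl ⟨rfl, hr⟩))
    hzl.symm hlr hzs.symm hsr.ne
  have a3 := (hK₁ k (hSW hk) (by simp [hsk.symm, hkl])).trans
    (hK₁ r (hSW hr) (by simp [hsr.ne', hlr.symm])).symm
  have b3 := (hK₂ k (hSW hk) (by simp [hsk.symm, hkr])).trans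
    (hK₂ l (hSW hl) (by simp [hsl.ne', hlr])).symm
  have hside : ∀ t, D.side z (s :: (Q ++ [k])) t =
      D.n z s t + pathSum D.n (s :: (Q ++ [k])) t + D.n k z t := by
    intro t
    have : z :: (s :: (Q ++ [k]) ++ [z]) = (z :: s :: Q) ++ k :: [z] := by simp
    rw [side, this, pathSum_append]
    simp [pathSum]
  rw [hside, hside]
  simp only [crossParity] at a2 b2 c1 c2
  simp only [side, List.cons_append, List.nil_append, pathSum, add_zero] at a3 b3
  have t1 := D.τ_add z s hzs
  have t2 := D.τ_add z l hzl
  have t3 := D.τ_add z r hzr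
  have t4 := D.τ_add z k hzk
  have t5 := D.τ_add s l hsl.ne
  have t6 := D.τ_add s r hsr.ne
  have t7 := D.τ_add s k hsk
  have t8 := D.τ_add l r hlr
  have t9 := D.τ_add k l hkl
  have t10 := D.τ_add k r hkr
  rw [D.n_symm k z, D.n_symm l s, D.n_symm l s] at a2
  rw [D.n_symm k z, D.n_symm r s, D.n_symm r s] at b2
  rw [D.n_symm r s, D.n_symm r s] at c1
  rw [D.n_symm l s, D.n_symm l s] at c2
  rw [D.n_symm l z, D.n_symm l z] at a3
  rw [D.n_symm r z, D.n_symm r z] at b3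
  rw [D.n_symm k z l, D.n_symm k z r]
  grind

end ParityDrawing

/-- No edge joins two vertices of the list that are not consecutive. -/
def NoChord (G : SimpleGraph U) : List U → Prop
  | [] => True
  | [_] => True
  | a :: b :: l => (∀ x ∈ l, ¬ G.Adj a x) ∧ NoChord G (b :: l)

lemma ParityDrawing.add_all (hz : z ∉ W) {R : List U} : ∀ {S : Finset U},
    ∀ D : ParityDrawing (Apex G z W S), S ⊆ W → SPath G W S R → NoChord G R →
    ∀ {K : ZMod 2}, (∀ t ∈ W, t ∉ R → D.side z R t = K) →
    Nonempty (ParityDrawing (Apex G z W (S ∪ R.toFinset))) := by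
  induction R with
  | nil => intro S D _ hR; exact (hR.ne_nil rfl).elim
  | cons a l ih =>
    intro S D hSW hR hN K hK
    have haS : a ∈ S := hR.head a (by simp)
    rcases l with _ | ⟨b, _ | ⟨c, l⟩⟩
    · refine ⟨D.mono (Apex.mono subset_rfl ?_)⟩
      intro x; simp only [List.toFinset_cons, List.toFinset_nil, Finset.mem_union,
        Finset.mem_insert, Finset.notMem_empty, or_false]
      rintro (h | rfl)
      exacts [h, haS]
    · have hbS : b ∈ S := hR.last b (by simp)
      refine ⟨D.mono (Apex.mono subset_rfl ?_)⟩
      intro x; simp only [List.toFinset_cons, List.toFinset_nil, Finset.mem_union,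
        Finset.mem_insert, Finset.notMem_empty, or_false]
      rintro (h | rfl | rfl)
      exacts [h, haS, hbS]
    · obtain ⟨D', -, h2, -⟩ := D.add_edge hz (R₁ := [a]) (u := b) (R₂ := c :: l) hR
        (by simpa using hN.1) (by simp) (by simp) hK
      obtain ⟨D''⟩ := ih D' (Finset.insert_subset (hR.mem b (by simp)) hSW)
        { ne_nil := by simp
          chain := (List.isChain_cons_cons.1 hR.chain).2
          nodup := (List.nodup_cons.1 hR.nodup).2
          mem := fun x hx => hR.mem x (List.mem_cons_of_mem _ hx)
          head := by simp
          last := fun x hx => Finset.mem_insert_of_mem (hR.last x (by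
            rw [List.getLast?_cons_cons]; exact hx)) } hN.2 h2
      refine ⟨D''.mono (Apex.mono subset_rfl ?_)⟩
      intro x
      simp only [List.toFinset_cons, Finset.mem_union, Finset.mem_insert]
      rintro (h | rfl | h)
      exacts [Or.inl (Or.inr h), Or.inl (Or.inr haS), Or.inr h]

/-- The vertices of `W` off the path `R` whose side is `κ`. -/
noncomputable def ParityDrawing.cls (D : ParityDrawing (Apex G z W S)) (R : List U) (κ : ZMod 2) :
    Finset U :=
  W.filter fun t => t ∉ R ∧ D.side z R t = κ

lemma ParityDrawing.mem_cls {D : ParityDrawing (Apex G z W S)} {R : List U} {κ : ZMod 2} {t : U} :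
    t ∈ D.cls R κ ↔ t ∈ W ∧ t ∉ R ∧ D.side z R t = κ := by
  simp [cls]

/-- The part of a drawing on one side of a path through the apex, with the whole path joined to
the apex. -/
lemma ParityDrawing.split (D : ParityDrawing (Apex G z W S)) (hz : z ∉ W) {R : List U}
    (hR : SPath G W S R) (hN : NoChord G R) (κ : ZMod 2) :
    Nonempty (ParityDrawing (Apex G z (D.cls R κ ∪ R.toFinset)
      (S ∩ D.cls R κ ∪ R.toFinset))) := by
  have hsub : D.cls R κ ∪ R.toFinset ⊆ W := by
    intro x hx
    rcases Finset.mem_union.1 hx with h | h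
    · exact (D.mem_cls.1 h).1
    · exact hR.mem x (List.mem_toFinset.1 h)
  obtain ⟨D'⟩ := ParityDrawing.add_all (fun h => hz (hsub h)) (R := R)
    (S := S ∩ (D.cls R κ ∪ R.toFinset)) (W := D.cls R κ ∪ R.toFinset)
    (D.mono (Apex.mono hsub Finset.inter_subset_left)) Finset.inter_subset_right
    { hR with
      mem := fun x hx => Finset.mem_union_right _ (List.mem_toFinset.2 hx)
      head := fun x hx => Finset.mem_inter.2 ⟨hR.head x hx, Finset.mem_union_right _
        (List.mem_toFinset.2 (List.mem_of_mem_head? hx))⟩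
      last := fun x hx => Finset.mem_inter.2 ⟨hR.last x hx, Finset.mem_union_right _
        (List.mem_toFinset.2 (List.mem_of_mem_getLast? hx))⟩ } hN (K := κ) (by
      intro t ht htR
      rcases Finset.mem_union.1 ht with h | h
      · exact (D.mem_cls.1 h).2.2
      · exact (htR (List.mem_toFinset.1 h)).elim)
  refine ⟨D'.mono (Apex.mono subset_rfl ?_)⟩
  intro x hx
  simp only [Finset.mem_union, Finset.mem_inter] at hx ⊢
  tauto

end Apex
end ParityDrawings

section PlaneDrawings
open Classical Complex

/-- The curve `γ` has winding number `m`, measured from the principal values of the logarithm. -/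
def Winds (γ : ℝ → ℂ) (m : ℤ) : Prop :=
  ∃ g : ℝ → ℂ, Continuous g ∧ (∀ s, exp (g s) = γ s) ∧
    g 1 - g 0 = log (γ 1) - log (γ 0) + m * (2 * Real.pi * I)

lemma exists_lift_exp {f : ℝ × ℝ → ℂ} (hf : Continuous f) (h0 : ∀ x, f x ≠ 0) :
    ∃ g : ℝ × ℝ → ℂ, Continuous g ∧ ∀ x, exp (g x) = f x := by
  have hs : IsSimplyConnected (Set.univ : Set (ℝ × ℝ)) := by
    rw [IsSimplyConnected]
    exact (Homeomorph.Set.univ (ℝ × ℝ)).toHomotopyEquiv.simplyConnectedSpace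
  obtain ⟨g, hg, he⟩ := Complex.exists_continuousOn_eqOn_exp_comp hs isOpen_univ
    hf.continuousOn (by rintro ⟨x, -, hx⟩; exact h0 x hx)
  exact ⟨g, continuousOn_univ.1 hg, fun x => he (Set.mem_univ x)⟩

lemma lift_unique {g h : ℝ → ℂ} (hg : Continuous g) (hh : Continuous h)
    (he : ∀ s, exp (g s) = exp (h s)) (h0 : g 0 = h 0) : g = h := by
  refine Complex.isCoveringMap_exp.eq_of_comp_eq hg hh ?_ 0 h0
  funext s
  exact Subtype.ext (he s)

lemma Winds.of_lift {γ g : ℝ → ℂ} (hg : Continuous g) (he : ∀ s, exp (g s) = γ s) :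
    ∃ m, Winds γ m := by
  have key : ∀ s, ∃ k : ℤ, g s = log (γ s) + k * (2 * Real.pi * I) := fun s => by
    apply Complex.exp_eq_exp_iff_exists_int.1
    rw [Complex.exp_log (by rw [← he]; exact Complex.exp_ne_zero _), he]
  obtain ⟨k, hk⟩ := key 1
  obtain ⟨l, hl⟩ := key 0
  refine ⟨k - l, g, hg, he, ?_⟩
  rw [hk, hl]; push_cast; ring

lemma Winds.eq_of_lift {γ g : ℝ → ℂ} {m : ℤ} (h : Winds γ m) (hg : Continuous g)
    (he : ∀ s, exp (g s) = γ s) :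
    g 1 - g 0 = log (γ 1) - log (γ 0) + m * (2 * Real.pi * I) := by
  obtain ⟨f, hf, hfe, hm⟩ := h
  have hfg : (fun s => f s + (g 0 - f 0)) = g := by
    apply lift_unique (by fun_prop) hg
    · intro s
      rw [Complex.exp_add, Complex.exp_sub, hfe, he, he, hfe, div_self, mul_one]
      rw [← he]; exact Complex.exp_ne_zero _
    · ring
  rw [← hm, ← hfg]; ring

lemma Winds.unique {γ : ℝ → ℂ} {m m' : ℤ} (h : Winds γ m) (h' : Winds γ m') : m = m' := by
  obtain ⟨f, hf, hfe, hm⟩ := h'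
  have := h.eq_of_lift hf hfe
  rw [hm, add_right_inj] at this
  have := mul_right_cancel₀ Complex.two_pi_I_ne_zero this
  exact_mod_cast this.symm

lemma Winds.reverse {γ : ℝ → ℂ} {m : ℤ} (h : Winds γ m) : Winds (fun s => γ (1 - s)) (-m) := by
  obtain ⟨f, hf, hfe, hm⟩ := h
  refine ⟨fun s => f (1 - s), by fun_prop, fun s => hfe _, ?_⟩
  simp only [sub_self, sub_zero]
  push_cast
  linear_combination -hm

/-- The parity of the winding number. -/
noncomputable def windParity (γ : ℝ → ℂ) : ZMod 2 :=
  if h : ∃ m, Winds γ m then (h.choose : ZMod 2) else 0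

lemma Winds.parity {γ : ℝ → ℂ} {m : ℤ} (h : Winds γ m) : windParity γ = m := by
  have : ∃ m, Winds γ m := ⟨m, h⟩
  rw [windParity, dif_pos this, this.choose_spec.unique h]

lemma windParity_reverse (γ : ℝ → ℂ) : windParity (fun s => γ (1 - s)) = windParity γ := by
  by_cases h : ∃ m, Winds γ m
  · obtain ⟨m, h⟩ := h
    rw [h.parity, h.reverse.parity]
    push_cast
    exact ZMod.neg_eq_self_mod_two _
  · have : ¬ ∃ m, Winds (fun s => γ (1 - s)) m := by
      rintro ⟨m, hm⟩
      exact h ⟨_, by simpa using hm.reverse⟩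
    rw [windParity, windParity, dif_neg h, dif_neg this]

/-- The half plane containing `w`. -/
noncomputable def halfPlane (w : ℂ) : ℤ := if 0 < arg w then 1 else 0

lemma log_neg_eq {w : ℂ} (hw : w ≠ 0) :
    log (-w) = log w + (1 - 2 * (halfPlane w : ℂ)) * (Real.pi * I) := by
  have key : arg (-w) = arg w + (1 - 2 * (halfPlane w : ℝ)) * Real.pi := by
    rw [halfPlane]
    split_ifs with h
    · have : 0 < w.im ∨ w.im = 0 ∧ w.re < 0 := by
        by_contra hc
        rw [← Complex.arg_neg_eq_arg_sub_pi_iff] at hc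
        rcases lt_trichotomy w.im 0 with h1 | h1 | h1
        · exact absurd (Complex.arg_neg_iff.2 h1) (by linarith)
        · rw [Complex.arg_neg_eq_arg_sub_pi_iff] at hc
          have : 0 ≤ w.re := by
            by_contra h2; exact hc (Or.inr ⟨h1, by linarith⟩)
          exact absurd h (by rw [Complex.arg_eq_zero_iff.2 ⟨this, h1⟩]; exact lt_irrefl 0)
        · rw [Complex.arg_neg_eq_arg_sub_pi_iff] at hc
          exact hc (Or.inl h1)
      rw [Complex.arg_neg_eq_arg_sub_pi_iff.2 this]; push_cast; ring
    · have : w.im < 0 ∨ w.im = 0 ∧ 0 < w.re := by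
        rcases lt_trichotomy w.im 0 with h1 | h1 | h1
        · exact Or.inl h1
        · refine Or.inr ⟨h1, ?_⟩
          by_contra h2
          rcases lt_or_eq_of_le (not_lt.1 h2) with h3 | h3
          · rw [Complex.arg_eq_pi_iff.2 ⟨h3, h1⟩] at h
            exact h Real.pi_pos
          · exact hw (Complex.ext h3 h1)
        · exfalso
          rcases lt_or_eq_of_le (Complex.arg_nonneg_iff.2 h1.le) with h2 | h2
          · exact h h2
          · have := Complex.arg_eq_zero_iff.1 h2.symm
            linarith [this.2]
      rw [Complex.arg_neg_eq_arg_add_pi_iff.2 this]; push_cast; ring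
  rw [Complex.log, Complex.log, key, norm_neg]
  push_cast; ring

lemma halfPlane_neg {w : ℂ} (hw : w ≠ 0) : halfPlane w + halfPlane (-w) = 1 := by
  have h1 := log_neg_eq hw
  have h2 := log_neg_eq (neg_ne_zero.2 hw)
  rw [neg_neg, h1] at h2
  have : ((halfPlane w + halfPlane (-w) : ℤ) : ℂ) * (2 * Real.pi * I) =
      ((1 : ℤ) : ℂ) * (2 * Real.pi * I) := by
    push_cast; linear_combination h2
  exact_mod_cast mul_right_cancel₀ Complex.two_pi_I_ne_zero this

lemma Winds.crossing {α β : ℝ → ℂ} (hα : Continuous α) (hβ : Continuous β)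
    (h : ∀ s t, α s ≠ β t) {m₁ m₂ m₃ m₄ : ℤ} (h₁ : Winds (fun s => α s - β 0) m₁)
    (h₂ : Winds (fun s => α s - β 1) m₂) (h₃ : Winds (fun s => β s - α 0) m₃)
    (h₄ : Winds (fun s => β s - α 1) m₄) :
    m₁ + m₄ - m₂ - m₃ - halfPlane (β 0 - α 1) + halfPlane (β 0 - α 0) + halfPlane (β 1 - α 1) -
      halfPlane (β 1 - α 0) = 0 := by
  obtain ⟨L, hL, he⟩ := exists_lift_exp (f := fun x => α x.1 - β x.2) (by fun_prop)
    fun x => sub_ne_zero.2 (h x.1 x.2)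
  have e₁ := h₁.eq_of_lift (g := fun s => L (s, 0)) (by fun_prop) fun s => he (s, 0)
  have e₂ := h₂.eq_of_lift (g := fun s => L (s, 1)) (by fun_prop) fun s => he (s, 1)
  have hpi : ∀ x, exp (L x + Real.pi * I) = β x.2 - α x.1 := fun x => by
    rw [Complex.exp_add, Complex.exp_pi_mul_I, he]; ring
  have e₃ := h₃.eq_of_lift (g := fun s => L (0, s) + Real.pi * I) (by fun_prop)
    fun s => hpi (0, s)
  have e₄ := h₄.eq_of_lift (g := fun s => L (1, s) + Real.pi * I) (by fun_prop)
    fun s => hpi (1, s)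
  have hl : ∀ s t, log (α s - β t) =
      log (β t - α s) + (1 - 2 * (halfPlane (β t - α s) : ℂ)) * (Real.pi * I) := fun s t => by
    rw [← log_neg_eq (sub_ne_zero.2 (h s t).symm), neg_sub]
  rw [hl, hl] at e₁ e₂
  have : ((m₁ + m₄ - m₂ - m₃ - halfPlane (β 0 - α 1) + halfPlane (β 0 - α 0) +
      halfPlane (β 1 - α 1) - halfPlane (β 1 - α 0) : ℤ) : ℂ) * (2 * Real.pi * I) =
      ((0 : ℤ) : ℂ) * (2 * Real.pi * I) := by
    push_cast
    linear_combination -e₁ + e₂ + e₃ - e₄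
  exact_mod_cast mul_right_cancel₀ Complex.two_pi_I_ne_zero this

/-- The curve in `ℂ` traced by an arc, continued constantly outside `[0, 1]`. -/
noncomputable def clampedArc (γ : ℝ → ℝ × ℝ) (s : ℝ) : ℂ :=
  Complex.equivRealProdCLM.symm (γ (max 0 (min 1 s)))

lemma clampedArc_reverse {γ γ' : ℝ → ℝ × ℝ} (h : ∀ t, γ' t = γ (1 - t)) (s : ℝ) :
    clampedArc γ' s = clampedArc γ (1 - s) := by
  rw [clampedArc, clampedArc, h]
  congr 2
  rcases le_total 0 s with h0 | h0 <;> rcases le_total s 1 with h1 | h1 <;> grind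

lemma continuous_clampedArc {γ : ℝ → ℝ × ℝ} (h : ContinuousOn γ (Set.Icc 0 1)) :
    Continuous (clampedArc γ) := by
  unfold clampedArc
  refine Complex.equivRealProdCLM.symm.continuous.comp ?_
  exact h.comp_continuous (by fun_prop) fun s => ⟨by simp, by simp⟩

lemma clampedArc_ne {γ δ : ℝ → ℝ × ℝ} (h : ∀ s ∈ Set.Icc (0 : ℝ) 1, ∀ t ∈ Set.Icc (0 : ℝ) 1,
    γ s ≠ δ t) (s t : ℝ) : clampedArc γ s ≠ clampedArc δ t := by
  unfold clampedArc
  exact fun he => h _ ⟨by simp, by simp⟩ _ ⟨by simp, by simp⟩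
    (Complex.equivRealProdCLM.symm.injective he)

lemma IsPlaneEmbedding.arc_ne {V : Type} {G : SimpleGraph V} {vtx : V → ℝ × ℝ}
    {arc : V → V → ℝ → ℝ × ℝ} (h : IsPlaneEmbedding G vtx arc) {a b c d : V} (hab : G.Adj a b)
    (hcd : G.Adj c d) (hac : a ≠ c) (had : a ≠ d) (hbc : b ≠ c) (hbd : b ≠ d) {s t : ℝ}
    (hs : s ∈ Set.Icc (0 : ℝ) 1) (ht : t ∈ Set.Icc (0 : ℝ) 1) : arc a b s ≠ arc c d t := by
  have key : ∀ {a b} (hab : G.Adj a b) {s : ℝ}, s ∈ Set.Icc (0 : ℝ) 1 →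
      arc a b s = vtx a ∨ arc a b s = vtx b ∨ arc a b s ∈ ArcInterior (arc a b) := by
    intro a b hab s hs
    rcases eq_or_lt_of_le hs.1 with h0 | h0
    · exact Or.inl (by rw [← h0, h.arc_start hab])
    rcases eq_or_lt_of_le hs.2 with h1 | h1
    · exact Or.inr (Or.inl (by rw [h1, h.arc_end hab]))
    exact Or.inr (Or.inr ⟨s, ⟨h0, h1⟩, rfl⟩)
  have hd := h.arc_disjoint hab hcd (by simp [hac, had])
  intro he
  have hv := fun w => h.arc_avoids_vtx hab w
  have hw := fun w => h.arc_avoids_vtx hcd w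
  have hi := fun x y => @h.vtx_inj x y
  rcases key hab hs with h1 | h1 | h1 <;> rcases key hcd ht with h2 | h2 | h2
  all_goals first
    | exact hac (hi _ _ (h1.symm.trans (he.trans h2)))
    | exact had (hi _ _ (h1.symm.trans (he.trans h2)))
    | exact hbc (hi _ _ (h1.symm.trans (he.trans h2)))
    | exact hbd (hi _ _ (h1.symm.trans (he.trans h2)))
    | exact hw _ (by rw [← h1, he]; exact h2)
    | exact hv _ (by rw [← h2, ← he]; exact h1)
    | exact (Set.eq_empty_iff_forall_notMem.1 hd) _ ⟨h1, by rw [he]; exact h2⟩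

lemma IsPlaneEmbedding.clampedArc_zero {V : Type} {G : SimpleGraph V} {vtx : V → ℝ × ℝ}
    {arc : V → V → ℝ → ℝ × ℝ} (h : IsPlaneEmbedding G vtx arc) {a b : V} (hab : G.Adj a b) :
    clampedArc (arc a b) 0 = Complex.equivRealProdCLM.symm (vtx a) := by
  simp [clampedArc, h.arc_start hab]

lemma IsPlaneEmbedding.clampedArc_one {V : Type} {G : SimpleGraph V} {vtx : V → ℝ × ℝ}
    {arc : V → V → ℝ → ℝ × ℝ} (h : IsPlaneEmbedding G vtx arc) {a b : V} (hab : G.Adj a b) :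
    clampedArc (arc a b) 1 = Complex.equivRealProdCLM.symm (vtx b) := by
  simp [clampedArc, h.arc_end hab]

/-- A plane embedding has a parity drawing. -/
lemma IsPlaneEmbedding.nonempty_parityDrawing {V : Type} {G : SimpleGraph V} {vtx : V → ℝ × ℝ}
    {arc : V → V → ℝ → ℝ × ℝ} (h : IsPlaneEmbedding G vtx arc) :
    Nonempty (ParityDrawing G.Adj) := by
  set p : V → ℂ := fun v => Complex.equivRealProdCLM.symm (vtx v) with hp
  have hpi : Function.Injective p := Complex.equivRealProdCLM.symm.injective.comp h.vtx_inj
  have hlift : ∀ {γ : ℝ → ℂ}, Continuous γ → (∀ s, γ s ≠ 0) → ∃ m, Winds γ m := by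
    intro γ hγ h0
    obtain ⟨g, hg, he⟩ := exists_lift_exp (f := fun x => γ x.1) (by fun_prop) fun x => h0 x.1
    exact Winds.of_lift (g := fun s => g (s, 0)) (by fun_prop) fun s => he (s, 0)
  refine ⟨⟨fun a b t => if G.Adj a b then windParity (fun s => clampedArc (arc a b) s - p t) else 0,
    fun x y => (halfPlane (p x - p y) : ZMod 2), ?_, ?_, ?_⟩⟩
  · intro a b t
    by_cases hab : G.Adj a b
    · rw [if_pos hab, if_pos hab.symm, ← windParity_reverse]
      congr 1
      funext s
      rw [clampedArc_reverse (h.arc_symm hab.symm), sub_sub_cancel]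
    · rw [if_neg hab, if_neg fun h => hab h.symm]
  · intro a b hab
    have := halfPlane_neg (sub_ne_zero.2 (hpi.ne hab))
    rw [neg_sub] at this
    exact_mod_cast congrArg (Int.cast : ℤ → ZMod 2) this
  · intro a b c d hab hcd hac had hbc hbd
    have hα := continuous_clampedArc (h.arc_cont hab)
    have hβ := continuous_clampedArc (h.arc_cont hcd)
    have hne := clampedArc_ne (γ := arc a b) (δ := arc c d)
      fun s hs t ht => h.arc_ne hab hcd hac had hbc hbd hs ht
    have a0 := h.clampedArc_zero hab
    have a1 := h.clampedArc_one hab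
    have b0 := h.clampedArc_zero hcd
    have b1 := h.clampedArc_one hcd
    obtain ⟨m₁, h₁⟩ := hlift (γ := fun s => clampedArc (arc a b) s - clampedArc (arc c d) 0)
      (by fun_prop) fun s => sub_ne_zero.2 (hne s 0)
    obtain ⟨m₂, h₂⟩ := hlift (γ := fun s => clampedArc (arc a b) s - clampedArc (arc c d) 1)
      (by fun_prop) fun s => sub_ne_zero.2 (hne s 1)
    obtain ⟨m₃, h₃⟩ := hlift (γ := fun s => clampedArc (arc c d) s - clampedArc (arc a b) 0)
      (by fun_prop) fun s => sub_ne_zero.2 (hne 0 s).symm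
    obtain ⟨m₄, h₄⟩ := hlift (γ := fun s => clampedArc (arc c d) s - clampedArc (arc a b) 1)
      (by fun_prop) fun s => sub_ne_zero.2 (hne 1 s).symm
    have key := congrArg (Int.cast : ℤ → ZMod 2) (Winds.crossing hα hβ hne h₁ h₂ h₃ h₄)
    push_cast at key
    rw [← h₁.parity, ← h₂.parity, ← h₃.parity, ← h₄.parity] at key
    simp only [a0, a1, b0, b1] at key
    simp only [crossParity, if_pos hab, if_pos hcd, hp]
    grind

/-- A parity drawing of a graph extends by an isolated apex. -/
lemma ParityDrawing.nonempty_apex {V : Type} {G : SimpleGraph V} (D : ParityDrawing G.Adj)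
    (W : Finset (Option V)) :
    Nonempty (ParityDrawing (Apex (G.map Function.Embedding.some) none W ∅)) := by
  refine ⟨⟨fun a b t => a.elim 0 fun a => b.elim 0 fun b => t.elim 0 fun t => D.n a b t,
    fun x y => y.elim 1 fun y => x.elim 0 fun x => D.τ x y, ?_, ?_, ?_⟩⟩
  · rintro (_ | a) (_ | b) (_ | t) <;> simp [D.n_symm]
  · rintro (_ | a) (_ | b) hab <;> simp at hab ⊢
    exact D.τ_add a b hab
  · rintro a b c d (⟨-, -, hab⟩ | h | h) (⟨-, -, hcd⟩ | h' | h') <;> try simp at *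
    obtain ⟨-, a, b, hab, rfl, rfl⟩ := hab
    obtain ⟨-, c, d, hcd, rfl, rfl⟩ := hcd
    intro h1 h2 h3 h4
    simpa [crossParity] using D.cross a b c d hab hcd (by simpa using h1) (by simpa using h2)
      (by simpa using h3) (by simpa using h4)

end PlaneDrawings

section Budgets
open Classical

variable {U : Type*} {G : SimpleGraph U}

/-- The budget of a vertex once the vertices of `D` have been removed; the vertices of `A` start
with one unit less. -/
noncomputable def cap (G : SimpleGraph U) (A D : Finset U) (t : U) : ℤ :=
  3 - (if t ∈ A then 1 else 0) - nbrCount G D t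

lemma nbrCount_eq_card (D : Finset U) (t : U) :
    nbrCount G D t = ((D.filter fun d => G.Adj d t).card : ℤ) := by
  rw [nbrCount, Finset.card_filter]; push_cast; rfl

lemma nbrCount_le_of_forall {D D' : Finset U} {t : U} (h : ∀ d ∈ D, G.Adj d t → d ∈ D') :
    nbrCount G D t ≤ nbrCount G D' t := by
  rw [nbrCount_eq_card, nbrCount_eq_card]
  refine Int.ofNat_le.2 (Finset.card_le_card fun d hd => ?_)
  rw [Finset.mem_filter] at hd ⊢
  exact ⟨h d hd.1 hd.2, hd.2⟩

lemma nbrCount_le_one {D : Finset U} {t : U}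
    (h : ∀ x ∈ D, ∀ y ∈ D, G.Adj x t → G.Adj y t → x = y) : nbrCount G D t ≤ 1 := by
  rw [nbrCount_eq_card]
  refine Int.ofNat_le.2 (Finset.card_le_one.2 fun x hx y hy => ?_)
  rw [Finset.mem_filter] at hx hy
  exact h x hx.1 y hy.1 hx.2 hy.2

lemma nbrCount_eq_zero {D : Finset U} {t : U} (h : ∀ x ∈ D, ¬ G.Adj x t) :
    nbrCount G D t = 0 := by
  rw [nbrCount]
  exact Finset.sum_eq_zero fun x hx => if_neg (h x hx)

lemma cap_le_cap {A A' D D' : Finset U} {t : U} (hA : t ∈ A → t ∈ A')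
    (hD : ∀ d ∈ D, G.Adj d t → d ∈ D') : cap G A' D' t ≤ cap G A D t := by
  have := nbrCount_le_of_forall hD
  rw [cap, cap]
  split_ifs <;> first | omega | exact absurd (hA ‹_›) ‹_›

lemma cap_union {A D X : Finset U} (h : Disjoint D X) (t : U) :
    cap G A (D ∪ X) t = cap G A D t - nbrCount G X t := by
  rw [cap, cap, nbrCount_union h]; ring

lemma WD.delete_cap {X A D : Finset U} {u : U} (hu : u ∈ X) (huD : u ∉ D)
    (h1 : 1 ≤ cap G A D u) (h : WD G (X.erase u) (cap G A (insert u D))) :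
    WD G X (cap G A D) := by
  refine WD.delete u hu h1 (h.mono fun t _ => le_of_eq ?_)
  rw [cap, cap, nbrCount_insert huD]; ring

lemma WD.save_cap {X A D : Finset U} {u w : U} (hu : u ∈ X) (hw : w ∈ X) (huw : G.Adj u w)
    (huD : u ∉ D) (huA : u ∉ A) (hwA : w ∈ A) (h0 : nbrCount G D u = 0)
    (h : WD G (X.erase u) (cap G (A.erase w) (insert u D))) : WD G X (cap G A D) := by
  refine WD.save u w hu hw huw ?_ (h.mono fun t _ => ?_)
  · have := nbrCount_nonneg (G := G) D w
    rw [cap, cap, if_pos hwA, if_neg huA, h0]; omega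
  · rw [cap, cap, nbrCount_insert huD]
    by_cases ht : t = w
    · subst ht; simp [hwA, huw]; omega
    · simp only [Finset.mem_erase, ht, ne_eq, not_false_eq_true, true_and, and_true]
      omega

lemma WD.glue {W D W₁ D₁ W₂ D₂ A : Finset U} {e : U} (h₁ : WD G (W₁ \ D₁) (cap G A D₁))
    (h₂ : WD G (W₂ \ D₂) (cap G A D₂)) (hDW : D ⊆ W) (hW₁ : W₁ ⊆ W) (hW₂ : W₂ ⊆ W)
    (hW : ∀ t ∈ W, t ∈ W₁ ∨ t ∈ W₂) (hD₁ : D₁ ⊆ D) (hDW₁ : ∀ t ∈ D, t ∈ W₁ → t ∈ D₁)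
    (hN₁ : ∀ t ∈ W₁, t ∉ D → ∀ d ∈ D, G.Adj d t → d ∈ D₁) (h12 : ∀ t ∈ W₁, t ∈ W₂ → t ∈ D₂)
    (hDW₂ : ∀ t ∈ D, t ∈ W₂ → t ∈ D₂) (hD₂ : D₂ ⊆ W₂)
    (hN₂ : ∀ t ∈ W₂, t ∉ D₂ → ∀ d ∈ W, G.Adj d t → d ∈ W₂)
    (he : ∀ x ∈ D₂, x ∉ W₁ → x ∉ D → x = e ∧ 1 ≤ cap G A (D ∪ W₁) e) :
    WD G (W \ D) (cap G A D) := by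
  set X₁ := W₁ \ D₁ with hX₁
  have hdis : Disjoint D X₁ := Finset.disjoint_left.2 fun t ht h => by
    rw [hX₁, Finset.mem_sdiff] at h
    exact h.2 (hDW₁ t ht h.1)
  have hsub : X₁ ⊆ W \ D := fun t ht => Finset.mem_sdiff.2
    ⟨hW₁ (Finset.mem_sdiff.1 ht).1, fun h => Finset.disjoint_left.1 hdis h ht⟩
  have hfirst : WD G X₁ (cap G A D) := h₁.mono fun t ht => by
    rw [Finset.mem_sdiff] at ht
    exact cap_le_cap id fun d hd => hN₁ t ht.1 (fun h => ht.2 (hDW₁ t h ht.1)) d hd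
  have hDX : D ∪ X₁ = D ∪ W₁ := by
    ext t; simp only [hX₁, Finset.mem_union, Finset.mem_sdiff]
    constructor
    · rintro (h | h); exacts [Or.inl h, Or.inr h.1]
    · rintro (h | h)
      · exact Or.inl h
      · by_cases h' : t ∈ D₁
        · exact Or.inl (hD₁ h')
        · exact Or.inr ⟨h, h'⟩
  have hlast : ∀ D', (∀ d ∈ D', d ∈ W ∧ (d ∈ D₂ ∨ d ∈ D ∨ d ∈ W₁)) →
      WD G (W₂ \ D₂) (cap G A D') := fun D' hD' => h₂.mono fun t ht => by
    rw [Finset.mem_sdiff] at ht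
    refine cap_le_cap id fun d hd hdt => ?_
    have hdW := hN₂ t ht.1 ht.2 d (hD' d hd).1 hdt
    rcases (hD' d hd).2 with h | h | h
    exacts [h, hDW₂ d h hdW, h12 d h hdW]
  have hsecond : WD G ((W \ D) \ X₁) (cap G A (D ∪ X₁)) := by
    rw [hDX]
    by_cases hE : ∃ x ∈ D₂, x ∉ W₁ ∧ x ∉ D
    · obtain ⟨x, hx, hxW, hxD⟩ := hE
      obtain ⟨rfl, hcap⟩ := he x hx hxW hxD
      refine WD.delete_cap (u := x) ?_ (by simp [hxW, hxD]) hcap ?_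
      · simp only [hX₁, Finset.mem_sdiff]
        exact ⟨⟨hW₂ (hD₂ hx), hxD⟩, fun h => hxW h.1⟩
      · have : ((W \ D) \ X₁).erase x = W₂ \ D₂ := by
          ext t
          simp only [hX₁, Finset.mem_erase, Finset.mem_sdiff]
          constructor
          · rintro ⟨h1, ⟨h2, h3⟩, h4⟩
            have h5 : t ∉ W₁ := fun h => h4 ⟨h, fun h' => h3 (hD₁ h')⟩
            exact ⟨(hW t h2).resolve_left h5, fun h => h1 (he t h h5 h3).1⟩
          · rintro ⟨h1, h2⟩
            exact ⟨fun h => h2 (h ▸ hx), ⟨hW₂ h1, fun h => h2 (hDW₂ t h h1)⟩,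
              fun h => h2 (h12 t h.1 h1)⟩
        rw [this]
        refine hlast _ fun d hd => ?_
        simp only [Finset.mem_insert, Finset.mem_union] at hd
        rcases hd with rfl | hd | hd
        exacts [⟨hW₂ (hD₂ hx), Or.inl hx⟩, ⟨hDW hd, Or.inr (Or.inl hd)⟩,
          ⟨hW₁ hd, Or.inr (Or.inr hd)⟩]
    · push Not at hE
      have : (W \ D) \ X₁ = W₂ \ D₂ := by
        ext t
        simp only [hX₁, Finset.mem_sdiff]
        constructor
        · rintro ⟨⟨h2, h3⟩, h4⟩
          have h5 : t ∉ W₁ := fun h => h4 ⟨h, fun h' => h3 (hD₁ h')⟩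
          exact ⟨(hW t h2).resolve_left h5, fun h => h3 (hE t h h5)⟩
        · rintro ⟨h1, h2⟩
          exact ⟨⟨hW₂ h1, fun h => h2 (hDW₂ t h h1)⟩, fun h => h2 (h12 t h.1 h1)⟩
      rw [this]
      refine hlast _ fun d hd => ?_
      rcases Finset.mem_union.1 hd with hd | hd
      exacts [⟨hDW hd, Or.inr (Or.inl hd)⟩, ⟨hW₁ hd, Or.inr (Or.inr hd)⟩]
  have := hfirst.seq hsecond Finset.disjoint_sdiff fun t _ => (cap_union hdis t).le
  rwa [Finset.union_sdiff_of_subset hsub] at this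

end Budgets

section Configurations
open Classical

variable {U : Type*} {G : SimpleGraph U} {z : U} {W A : Finset U} {P : List U}

/-- The data of the extension statement: a path `P` on the outer face of the graph induced on `W`,
whose vertices have been removed, and an independent set `A` of vertices of the outer face, each
of which has lost one unit of budget. -/
structure Conf (G : SimpleGraph U) (z : U) (W : Finset U) (P : List U) (A : Finset U) : Prop where
  z_notMem : z ∉ W
  nodup : P.Nodup
  chain : P.IsChain G.Adj
  sub : ∀ x ∈ P, x ∈ W
  length_le : P.length ≤ 6
  A_sub : ∀ a ∈ A, a ∈ W
  A_notMem : ∀ a ∈ A, a ∉ P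
  indep : ∀ a ∈ A, ∀ b ∈ A, ¬ G.Adj a b
  one : ∀ a ∈ A, ∀ p ∈ P, ∀ q ∈ P, G.Adj a p → G.Adj a q → p = q
  head : ∀ a ∈ A, ∀ p ∈ P.head?, G.Adj a p → P.length ≤ 5
  last : ∀ a ∈ A, ∀ p ∈ P.getLast?, G.Adj a p → P.length ≤ 5
  both : ∀ a ∈ A, ∀ p ∈ P.head?, G.Adj a p → ∀ b ∈ A, ∀ q ∈ P.getLast?, G.Adj b q → P.length ≤ 4
  drawing : Nonempty (ParityDrawing (Apex G z W (P.toFinset ∪ A)))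

/-- The conclusion of the extension statement. -/
def Good (G : SimpleGraph U) (W : Finset U) (P : List U) (A : Finset U) : Prop :=
  WD G (W \ P.toFinset) (cap G A P.toFinset)

/-- A minimal counterexample to the extension statement, in a graph without cycles of length
three or four. -/
structure MinCE (G : SimpleGraph U) (z : U) (W : Finset U) (P : List U) (A : Finset U) : Prop where
  conf : Conf G z W P A
  tri : ∀ {a b c}, G.Adj a b → G.Adj b c → G.Adj a c → False
  sq : ∀ {x y a b}, x ≠ y → G.Adj a x → G.Adj a y → G.Adj b x → G.Adj b y → a = b
  ih : ∀ W' P' A', Conf G z W' P' A' → 7 * W'.card + P.length < 7 * W.card + P'.length →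
    Good G W' P' A'
  bad : ¬ Good G W P A

lemma Conf.reverse (h : Conf G z W P A) : Conf G z W P.reverse A where
  z_notMem := h.z_notMem
  nodup := List.nodup_reverse.2 h.nodup
  chain := by
    rw [List.isChain_reverse]
    exact h.chain.imp fun a b => G.adj_symm
  sub := fun x hx => h.sub x (List.mem_reverse.1 hx)
  length_le := by simpa using h.length_le
  A_sub := h.A_sub
  A_notMem := fun a ha hP => h.A_notMem a ha (List.mem_reverse.1 hP)
  indep := h.indep
  one := fun a ha p hp q hq => h.one a ha p (List.mem_reverse.1 hp) q (List.mem_reverse.1 hq)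
  head := by simpa using h.last
  last := by simpa using h.head
  both := by
    simp only [List.head?_reverse, List.getLast?_reverse, List.length_reverse]
    exact fun a ha p hp hap b hb q hq hbq => h.both b hb q hq hbq a ha p hp hap
  drawing := by simpa using h.drawing

namespace MinCE

lemma reverse (h : MinCE G z W P A) : MinCE G z W P.reverse A where
  conf := h.conf.reverse
  tri := h.tri
  sq := h.sq
  ih := by simpa using h.ih
  bad := by simpa [Good] using h.bad

lemma ih_card (h : MinCE G z W P A) {W' : Finset U} {P' : List U} {A' : Finset U}
    (hc : Conf G z W' P' A') {v : U} (hv : v ∈ W) (hv' : v ∉ W') (hW : W' ⊆ W) :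
    Good G W' P' A' := by
  refine h.ih W' P' A' hc ?_
  have : W'.card < W.card := Finset.card_lt_card
    (Finset.ssubset_iff_subset_ne.2 ⟨hW, fun he => hv' (he ▸ hv)⟩)
  have := h.conf.length_le
  omega

lemma ih_cons (h : MinCE G z W P A) {P' : List U} {A' : Finset U}
    (hc : Conf G z W P' A') (hP : P.length < P'.length) : Good G W P' A' :=
  h.ih W P' A' hc (by omega)

/-- Shrinking a configuration to a subset of the vertices. -/
lemma _root_.IFPaper.Conf.restrict (h : Conf G z W P A) {W' : Finset U} {P' : List U}
    (hW : W' ⊆ W) (hP : P' <:+: P) (hPW : ∀ x ∈ P', x ∈ W')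
    (hhead : ∀ a ∈ A, a ∈ W' → ∀ p ∈ P'.head?, G.Adj a p → P'.length ≤ 5)
    (hlast : ∀ a ∈ A, a ∈ W' → ∀ p ∈ P'.getLast?, G.Adj a p → P'.length ≤ 5)
    (hboth : ∀ a ∈ A, a ∈ W' → ∀ p ∈ P'.head?, G.Adj a p → ∀ b ∈ A, b ∈ W' →
      ∀ q ∈ P'.getLast?, G.Adj b q → P'.length ≤ 4) :
    Conf G z W' P' (A ∩ W') where
  z_notMem := fun hz => h.z_notMem (hW hz)
  nodup := h.nodup.sublist hP.sublist
  chain := isChain_of_infix h.chain hP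
  sub := hPW
  length_le := hP.length_le.trans h.length_le
  A_sub := fun a ha => (Finset.mem_inter.1 ha).2
  A_notMem := fun a ha haP => h.A_notMem a (Finset.mem_inter.1 ha).1 (hP.subset haP)
  indep := fun a ha b hb => h.indep a (Finset.mem_inter.1 ha).1 b (Finset.mem_inter.1 hb).1
  one := fun a ha p hp q hq => h.one a (Finset.mem_inter.1 ha).1 p (hP.subset hp) q (hP.subset hq)
  head := fun a ha => hhead a (Finset.mem_inter.1 ha).1 (Finset.mem_inter.1 ha).2
  last := fun a ha => hlast a (Finset.mem_inter.1 ha).1 (Finset.mem_inter.1 ha).2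
  both := fun a ha p hp hap b hb => hboth a (Finset.mem_inter.1 ha).1 (Finset.mem_inter.1 ha).2
    p hp hap b (Finset.mem_inter.1 hb).1 (Finset.mem_inter.1 hb).2
  drawing := by
    obtain ⟨D⟩ := h.drawing
    refine ⟨D.mono (Apex.mono hW fun x hx => ?_)⟩
    simp only [Finset.mem_union, List.mem_toFinset, Finset.mem_inter] at hx ⊢
    exact hx.imp (fun hx => hP.subset hx) And.left

/-- The two parts of `W` obtained by cutting along a path cannot both be good. -/
lemma glue_false (h : MinCE G z W P A) {W₁ W₂ A₁ A₂ : Finset U} {P₁ P₂ : List U} {e : U}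
    (h₁ : Good G W₁ P₁ A₁) (h₂ : Good G W₂ P₂ A₂)
    (hA₁ : ∀ t ∈ W₁, t ∉ P₁ → t ∈ A → t ∈ A₁) (hA₂ : ∀ t ∈ W₂, t ∉ P₂ → t ∈ A → t ∈ A₂)
    (hW₁ : W₁ ⊆ W) (hW₂ : W₂ ⊆ W) (hW : ∀ t ∈ W, t ∈ W₁ ∨ t ∈ W₂)
    (hP₁ : ∀ x ∈ P₁, x ∈ P) (hPW₁ : ∀ t ∈ P, t ∈ W₁ → t ∈ P₁)
    (hN₁ : ∀ t ∈ W₁, t ∉ P → ∀ d ∈ P, G.Adj d t → d ∈ P₁) (h12 : ∀ t ∈ W₁, t ∈ W₂ → t ∈ P₂)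
    (hPW₂ : ∀ t ∈ P, t ∈ W₂ → t ∈ P₂) (hP₂ : ∀ x ∈ P₂, x ∈ W₂)
    (hN₂ : ∀ t ∈ W₂, t ∉ P₂ → ∀ d ∈ W, G.Adj d t → d ∈ W₂)
    (he : ∀ x ∈ P₂, x ∉ W₁ → x ∉ P → x = e ∧ 1 ≤ cap G A (P.toFinset ∪ W₁) e) : False := by
  have hmono : ∀ {W' A' : Finset U} {P' : List U}, Good G W' P' A' →
      (∀ t ∈ W', t ∉ P' → t ∈ A → t ∈ A') → WD G (W' \ P'.toFinset) (cap G A P'.toFinset) := by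
    intro W' A' P' hg hA
    refine WD.mono hg fun t ht => ?_
    rw [Finset.mem_sdiff, List.mem_toFinset] at ht
    exact cap_le_cap (hA t ht.1 ht.2) fun d hd _ => hd
  refine h.bad
    (WD.glue (e := e) (hmono h₁ hA₁) (hmono h₂ hA₂) ?_ hW₁ hW₂ hW ?_ ?_ ?_ ?_ ?_ ?_ ?_ ?_)
  all_goals simp only [List.mem_toFinset, Finset.subset_iff]
  exacts [h.conf.sub, hP₁, hPW₁, hN₁, h12, hPW₂, hP₂, hN₂, he]

/-- All vertices of a path avoiding `R` lie on the same side of `R`. -/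
lemma _root_.IFPaper.ParityDrawing.side_eq_of_chain {S : Finset U}
    (D : ParityDrawing (Apex G z W S)) (hz : z ∉ W)
    {R : List U} (hR : SPath G W S R) : ∀ {L : List U}, L.IsChain G.Adj → (∀ x ∈ L, x ∈ W) →
    (∀ x ∈ L, x ∉ R) → ∀ x ∈ L, ∀ y ∈ L, D.side z R x = D.side z R y := by
  intro L
  induction L with
  | nil => simp
  | cons a l ih =>
    intro hc hm hn
    have key : ∀ x ∈ l, D.side z R a = D.side z R x := by
      cases l with
      | nil => simp
      | cons b l =>
        rw [List.isChain_cons_cons] at hc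
        intro x hx
        rw [D.side_eq_of_adj hz hR (hm a (by simp)) (hm b (by simp)) (hn a (by simp))
          (hn b (by simp)) hc.1]
        exact ih hc.2 (fun x hx => hm x (List.mem_cons_of_mem _ hx))
          (fun x hx => hn x (List.mem_cons_of_mem _ hx)) b (by simp) x hx
    intro x hx y hy
    have hx' : D.side z R a = D.side z R x :=
      (List.mem_cons.1 hx).elim (fun h => by rw [h]) (key x)
    have hy' : D.side z R a = D.side z R y :=
      (List.mem_cons.1 hy).elim (fun h => by rw [h]) (key y)
    exact hx'.symm.trans hy'

end MinCE
end Configurations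

section Cutting
open Classical

variable {U : Type*} {G : SimpleGraph U} {z : U} {W S A : Finset U} {P : List U}

/-- All vertices of `W` off the path `R` are on the same side of it. -/
def ParityDrawing.ConstSide (D : ParityDrawing (Apex G z W S)) (R : List U) : Prop :=
  ∃ K, ∀ t ∈ W, t ∉ R → D.side z R t = K

lemma ParityDrawing.ConstSide.reverse {D : ParityDrawing (Apex G z W S)} {R : List U}
    (h : D.ConstSide R) : D.ConstSide R.reverse := by
  obtain ⟨K, hK⟩ := h
  exact ⟨K, fun t ht htR => by rw [D.side_reverse]; exact hK t ht (by simpa using htR)⟩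

lemma ParityDrawing.ConstSide.swap {D : ParityDrawing (Apex G z W S)} {a b : U}
    (h : D.ConstSide [a, b]) : D.ConstSide [b, a] := h.reverse

/-- Adding an edge from the apex to a vertex of a path with one empty side, with the effect on
the sides of other paths. -/
lemma ParityDrawing.exists_add_edge (D : ParityDrawing (Apex G z W S)) (hz : z ∉ W)
    {R₁ R₂ : List U} {u : U} (hR : SPath G W S (R₁ ++ u :: R₂))
    (hchord : ∀ c ∈ R₁, ∀ d ∈ R₂, ¬ G.Adj c d) (h₁ : R₁ ≠ []) (h₂ : R₂ ≠ [])
    (hK : D.ConstSide (R₁ ++ u :: R₂)) :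
    ∃ D' : ParityDrawing (Apex G z W (insert u S)), D'.ConstSide (R₁ ++ [u]) ∧
      D'.ConstSide (u :: R₂) ∧ ∀ R, u ∉ R → D.ConstSide R → D'.ConstSide R := by
  obtain ⟨K, hK⟩ := hK
  obtain ⟨D', ha, hb, hn⟩ := D.add_edge hz hR hchord h₁ h₂ hK
  refine ⟨D', ⟨_, ha⟩, ⟨_, hb⟩, fun R huR hD => ?_⟩
  obtain ⟨L, hL⟩ := hD
  have huz : u ≠ z := fun h => hz (h ▸ hR.mem u (by simp))
  refine ⟨L, fun t ht htR => (hL t ht htR).symm ▸ ?_⟩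
  rw [side, side]
  refine pathSum_congr fun a b ha hb => hn a b t (fun h => ?_) fun h => ?_
  · simp only [List.tail_cons, List.mem_append, List.mem_singleton] at hb
    exact hb.elim (fun hb => huR (h.2 ▸ hb)) fun hb => huz (h.2.symm.trans hb)
  · simp only [List.mem_cons, List.mem_append, List.not_mem_nil, or_false] at ha
    rcases ha with ha | ha | ha
    exacts [huz (h.1.symm.trans ha), huR (h.1 ▸ ha), huz (h.1.symm.trans ha)]

namespace MinCE

lemma not_adj_of_length_le_two (h : MinCE G z W P A) {c t : U} {L : List U}
    (hc : (c :: L).IsChain G.Adj) (hnd : (c :: L).Nodup) (hL : L.length ≤ 2) (ht : t ∉ L)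
    (htc : G.Adj t c) : ∀ y ∈ L, ¬ G.Adj t y := by
  match L with
  | [] => simp
  | [d] =>
    simp only [List.isChain_cons_cons, List.mem_singleton, forall_eq] at hc ⊢
    exact fun htd => h.tri htc hc.1 htd
  | [d, e] =>
    simp only [List.isChain_cons_cons, List.mem_cons, List.not_mem_nil, or_false,
      forall_eq_or_imp, forall_eq, List.nodup_cons, not_or] at hc hnd ht ⊢
    exact ⟨fun htd => h.tri htc hc.1 htd, fun hte => ht.1 (h.sq hnd.1.2 htc hte
      hc.1.symm hc.2.1)⟩
  | _ :: _ :: _ :: _ => simp at hL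

lemma noChord (h : MinCE G z W P A) {R : List U} (hc : R.IsChain G.Adj) (hnd : R.Nodup)
    (hR : R.length ≤ 4) : NoChord G R := by
  match R with
  | [] => trivial
  | [a] => trivial
  | [a, b] => exact ⟨by simp, trivial⟩
  | [a, b, c] =>
    simp only [List.isChain_cons_cons] at hc
    exact ⟨by simpa using fun hac => h.tri hc.1 hc.2.1 hac, by simp, trivial⟩
  | [a, b, c, d] =>
    simp only [List.isChain_cons_cons, List.mem_cons, List.not_mem_nil, or_false,
      List.nodup_cons, not_or] at hc hnd
    refine ⟨?_, by simpa using fun hbd => h.tri hc.2.1 hc.2.2.1 hbd, by simp, trivial⟩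
    simp only [List.mem_cons, List.not_mem_nil, or_false, forall_eq_or_imp, forall_eq]
    exact ⟨fun hac => h.tri hc.1 hc.2.1 hac, fun had =>
      hnd.1.2.1 (h.sq hnd.2.1.2 hc.1 had hc.2.1.symm hc.2.2.1)⟩
  | _ :: _ :: _ :: _ :: _ :: _ => simp only [List.length_cons] at hR; omega

/-- Cutting off a part of the graph which avoids `P`. -/
lemma cut_off (h : MinCE G z W P A) {C : Finset U} {R : List U}
    (hconf : Conf G z (C ∪ R.toFinset) R (A ∩ C)) (hCW : C ⊆ W) (hRW : ∀ x ∈ R, x ∈ W)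
    (hCR : ∀ x ∈ R, x ∉ C) (hP : ∀ p ∈ P, p ∉ C)
    (hN : ∀ t ∈ C, ∀ d ∈ W, G.Adj d t → d ∈ C ∨ d ∈ R) {c v : U} (hc : c ∈ C) (hv : v ∈ W)
    (hvC : v ∉ C) (hvR : v ∉ R) : False := by
  have hW₁ : Conf G z (W \ C) P (A ∩ (W \ C)) :=
    h.conf.restrict Finset.sdiff_subset List.infix_rfl
      (fun x hx => Finset.mem_sdiff.2 ⟨h.conf.sub x hx, hP x hx⟩) (fun a ha _ => h.conf.head a ha)
      (fun a ha _ => h.conf.last a ha)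
      (fun a ha _ p hp hap b hb _ q hq => h.conf.both a ha p hp hap b hb q hq)
  have hW₂ : C ∪ R.toFinset ⊆ W := Finset.union_subset hCW fun x hx =>
    hRW x (List.mem_toFinset.1 hx)
  refine h.glue_false (e := c) (h.ih_card hW₁ (hCW hc) (by simp [hc]) Finset.sdiff_subset)
    (h.ih_card hconf hv (by simp [hvC, hvR]) hW₂) ?_ ?_ Finset.sdiff_subset hW₂ ?_
    (fun _ => id) (fun _ ht _ => ht) (fun _ _ _ _ hd _ => hd) ?_ ?_ ?_ ?_ ?_
  all_goals simp only [Finset.mem_sdiff, Finset.mem_union, Finset.mem_inter, List.mem_toFinset]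
  · tauto
  · tauto
  · tauto
  · tauto
  · exact fun t ht h => h.resolve_left (hP t ht)
  · tauto
  · exact fun t ht htR d hd hdt => hN t (ht.resolve_right htR) d hd hdt
  · exact fun x hx hxW => (hxW ⟨hRW x hx, hCR x hx⟩).elim

/-- Cutting off one side of a short path when it avoids `P`. -/
lemma cut_zero (h : MinCE G z W P A) {W₀ : Finset U} (hW : W₀ ⊆ W)
    (D : ParityDrawing (Apex G z W₀ S)) (hA : ∀ a ∈ A, a ∈ W₀ → a ∈ S) {R : List U}
    (hR : SPath G W₀ S R) (hlen : R.length ≤ 4) {κ : ZMod 2}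
    (hone : ∀ b ∈ A, b ∈ D.cls R κ → ∀ x ∈ R, ∀ y ∈ R, G.Adj b x → G.Adj b y → x = y)
    (hP : ∀ p ∈ P, p ∉ D.cls R κ)
    (hcl : ∀ t ∈ D.cls R κ, ∀ d ∈ W, d ∉ W₀ → G.Adj d t → d ∈ R)
    {c v : U} (hc : c ∈ D.cls R κ) (hv : v ∈ W) (hvC : v ∉ D.cls R κ) (hvR : v ∉ R) : False := by
  have hz : z ∉ W₀ := fun hz => h.conf.z_notMem (hW hz)
  have hCW : D.cls R κ ⊆ W₀ := fun t ht => (D.mem_cls.1 ht).1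
  refine h.cut_off (C := D.cls R κ) (R := R) ?_ (hCW.trans hW) (fun x hx => hW (hR.mem x hx))
    (fun x hx hxC => (D.mem_cls.1 hxC).2.1 hx) hP ?_ hc hv hvC hvR
  · exact
    { z_notMem := by
        simp only [Finset.mem_union, List.mem_toFinset, not_or]
        exact ⟨fun h => hz (hCW h), fun h => hz (hR.mem z h)⟩
      nodup := hR.nodup
      chain := hR.chain
      sub := fun x hx => by simp [hx]
      length_le := by omega
      A_sub := fun a ha => Finset.mem_union_left _ (Finset.mem_inter.1 ha).2
      A_notMem := fun a ha => (D.mem_cls.1 (Finset.mem_inter.1 ha).2).2.1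
      indep := fun a ha b hb => h.conf.indep a (Finset.mem_inter.1 ha).1 b (Finset.mem_inter.1 hb).1
      one := fun a ha => hone a (Finset.mem_inter.1 ha).1 (Finset.mem_inter.1 ha).2
      head := fun _ _ _ _ _ => by omega
      last := fun _ _ _ _ _ => by omega
      both := fun _ _ _ _ _ _ _ _ _ _ => by omega
      drawing := by
        obtain ⟨D'⟩ := D.split hz hR (h.noChord hR.chain hR.nodup hlen) κ
        refine ⟨D'.mono (Apex.mono subset_rfl fun x hx => ?_)⟩
        simp only [Finset.mem_union, List.mem_toFinset, Finset.mem_inter] at hx ⊢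
        exact hx.symm.imp (fun hx => ⟨hA x hx.1 (hCW hx.2), hx.2⟩) id }
  · intro t ht d hd hdt
    by_cases hdW : d ∈ W₀
    · by_cases hdR : d ∈ R
      · exact Or.inr hdR
      · have ht' := D.mem_cls.1 ht
        refine Or.inl (D.mem_cls.2 ⟨hdW, hdR, ?_⟩)
        rw [D.side_eq_of_adj hz hR hdW ht'.1 hdR ht'.2.1 hdt, ht'.2.2]
    · exact Or.inr (hcl t ht d hd hdW hdt)

/-- A path with at most three vertices whose two sides are nonempty meets `P` on both sides. -/
lemma constSide_of_forall (h : MinCE G z W P A) (D : ParityDrawing (Apex G z W S)) (hA : A ⊆ S)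
    {R : List U} (hR : SPath G W S R) (hlen : R.length ≤ 3)
    (hP : ∀ p ∈ P, p ∉ R → ∀ q ∈ P, q ∉ R → D.side z R p = D.side z R q) : D.ConstSide R := by
  by_contra hcon
  have key : ∀ κ, (∀ p ∈ P, p ∉ D.cls R κ) → ∀ c ∈ W, c ∉ R → D.side z R c = κ → False := by
    intro κ hκ c hc hcR hcκ
    refine hcon ⟨κ, fun t ht htR => by_contra fun htκ => ?_⟩
    refine h.cut_zero subset_rfl D (fun a ha _ => hA ha) hR (by omega) ?_ hκ
      (fun _ _ d hd hdW => (hdW hd).elim) (D.mem_cls.2 ⟨hc, hcR, hcκ⟩) ht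
      (fun h => htκ (D.mem_cls.1 h).2.2) htR
    intro b hb hbC x hx y hy hbx hby
    have hbR := (D.mem_cls.1 hbC).2.1
    by_contra hxy
    have hnear : ∀ (R : List U), R.IsChain G.Adj → R.Nodup → R.length ≤ 3 → b ∉ R → ∀ x ∈ R,
        ∀ y ∈ R, G.Adj b x → G.Adj b y → x = y := by
      intro R hRc hRn hRl hbR
      induction R with
      | nil => simp
      | cons r l ih =>
        have hbl : b ∉ l := fun h => hbR (List.mem_cons_of_mem _ h)
        have hr := fun hbr => h.not_adj_of_length_le_two hRc hRn
          (by simp only [List.length_cons] at hRl; omega) hbl (t := b) hbr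
        have hl := ih hRc.tail (List.nodup_cons.1 hRn).2
          (by simp only [List.length_cons] at hRl; omega) hbl
        intro x hx y hy hbx hby
        rcases List.mem_cons.1 hx with hx | hx <;> rcases List.mem_cons.1 hy with hy | hy
        · rw [hx, hy]
        · exact (hr (hx ▸ hbx) y hy hby).elim
        · exact (hr (hy ▸ hby) x hx hbx).elim
        · exact hl x hx y hy hbx hby
    exact hxy (hnear R hR.chain hR.nodup hlen hbR x hx y hy hbx hby)
  have hex : ∃ c ∈ W, c ∉ R ∧ ∃ c' ∈ W, c' ∉ R ∧ D.side z R c ≠ D.side z R c' := by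
    by_contra hno
    push Not at hno
    by_cases hne : ∃ c ∈ W, c ∉ R
    · obtain ⟨c, hc, hcR⟩ := hne
      exact hcon ⟨_, fun t ht htR => hno t ht htR c hc hcR⟩
    · push Not at hne
      exact hcon ⟨0, fun t ht htR => (htR (hne t ht)).elim⟩
  obtain ⟨c, hc, hcR, c', hc', hcR', hne⟩ := hex
  by_cases hp : ∃ p ∈ P, p ∈ D.cls R (D.side z R c)
  · obtain ⟨p, hp, hpC⟩ := hp
    rw [D.mem_cls] at hpC
    refine key (D.side z R c') (fun q hq hqC => ?_) c' hc' hcR' rfl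
    rw [D.mem_cls] at hqC
    exact hne (hpC.2.2.symm.trans ((hP p hp hpC.2.1 q hq hqC.2.1).trans hqC.2.2))
  · push Not at hp
    exact key _ hp c hc hcR rfl

end MinCE
end Cutting

section Cutting
open Classical

variable {U : Type*} {G : SimpleGraph U} {z : U} {W S A : Finset U} {P : List U}

namespace MinCE

/-- Cutting along a path which leaves `P` at the end of the initial segment `P₁`. -/
lemma cut_core (h : MinCE G z W P A) (D : ParityDrawing (Apex G z W S)) {R : List U}
    (hR : SPath G W S R) {κ : ZMod 2} {P₁ post ext : List U} {r s : U}
    (h₁ : Conf G z (W \ D.cls R κ) P₁ (A ∩ (W \ D.cls R κ)))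
    (h₂ : Conf G z (D.cls R κ ∪ R.toFinset) (ext ++ R ++ post)
      ((A ∩ D.cls R κ).filter fun t => t ∉ ext))
    (hP : P = P₁ ++ post) (hpost : ∀ x ∈ post, x ∈ D.cls R κ) (hP₁ : ∀ x ∈ P₁, x ∉ D.cls R κ)
    (hNR : ∀ x ∈ R, x ∉ P → ∀ y ∈ post, ¬ G.Adj y x)
    (hext : ∀ x ∈ ext, x = r ∧ x ∈ A ∧ x ∈ D.cls R κ ∧ (∀ d ∈ P, ¬ G.Adj x d) ∧
      ∀ y ∈ R, G.Adj x y → y = s)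
    {c v : U} (hc : c ∈ D.cls R κ) (hv : v ∈ W) (hvC : v ∉ D.cls R κ) (hvR : v ∉ R) : False := by
  have hz := h.conf.z_notMem
  have hCW : D.cls R κ ⊆ W := fun t ht => (D.mem_cls.1 ht).1
  have hW₂ : D.cls R κ ∪ R.toFinset ⊆ W := Finset.union_subset hCW fun x hx =>
    hR.mem x (List.mem_toFinset.1 hx)
  have hadj : ∀ t ∈ W, t ∉ R → ∀ d ∈ D.cls R κ, G.Adj d t → t ∈ D.cls R κ := by
    intro t ht htR d hd hdt
    rw [D.mem_cls] at hd ⊢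
    refine ⟨ht, htR, ?_⟩
    rw [← hd.2.2, D.side_eq_of_adj hz hR hd.1 ht hd.2.1 htR hdt]
  have hmem : ∀ x, x ∈ P ↔ x ∈ P₁ ∨ x ∈ post := fun x => by rw [hP, List.mem_append]
  have hRC : ∀ x ∈ R, x ∉ D.cls R κ := fun x hx hxC => (D.mem_cls.1 hxC).2.1 hx
  refine h.glue_false (e := r) (h.ih_card h₁ (hCW hc) (by simp [hc]) Finset.sdiff_subset)
    (h.ih_card h₂ hv (by simp [hvC, hvR]) hW₂) ?_ ?_ Finset.sdiff_subset hW₂ ?_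
    (fun x hx => (hmem x).2 (Or.inl hx)) ?_ ?_ ?_ ?_ ?_ ?_ ?_
  all_goals simp only [Finset.mem_sdiff, Finset.mem_union, Finset.mem_inter, List.mem_toFinset,
    Finset.mem_filter, List.mem_append]
  · tauto
  · tauto
  · tauto
  · intro t ht htC
    exact ((hmem t).1 ht).resolve_right fun h => htC.2 (hpost t h)
  · intro t ht htP d hd hdt
    refine ((hmem d).1 hd).resolve_right fun hdp => ?_
    by_cases htR : t ∈ R
    · exact hNR t htR htP d hdp hdt
    · exact ht.2 (hadj t ht.1 htR d (hpost d hdp) hdt)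
  · tauto
  · intro t ht ht2
    rcases (hmem t).1 ht with h | h
    · exact Or.inl (Or.inr (ht2.resolve_left (hP₁ t h)))
    · exact Or.inr h
  · rintro x ((hx | hx) | hx)
    exacts [Or.inl (hext x hx).2.2.1, Or.inr hx, Or.inl (hpost x hx)]
  · intro t ht ht2 d hd hdt
    by_cases hdR : d ∈ R
    · exact Or.inr hdR
    · exact Or.inl (hadj d hd hdR t (ht.resolve_right fun h => ht2 (Or.inl (Or.inr h))) hdt.symm)
  · intro x hx hxW hxP
    have hx' : x ∈ ext := by
      rcases hx with (hx | hx) | hx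
      · exact hx
      · exact (hxW ⟨hR.mem x hx, hRC x hx⟩).elim
      · exact (hxP ((hmem x).2 (Or.inr hx))).elim
    obtain ⟨rfl, hxA, hxC, hxP', hxs⟩ := hext x hx'
    refine ⟨rfl, ?_⟩
    have : nbrCount G (P.toFinset ∪ (W \ D.cls R κ)) x ≤ 1 := by
      have key : ∀ d ∈ P.toFinset ∪ (W \ D.cls R κ), G.Adj d x → d = s := by
        intro d hd hdx
        rw [Finset.mem_union, List.mem_toFinset, Finset.mem_sdiff] at hd
        rcases hd with hd | hd
        · exact (hxP' d hd hdx.symm).elim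
        · refine hxs d (by_contra fun hdR => ?_) hdx.symm
          exact hd.2 (hadj d hd.1 hdR x hxC hdx.symm)
      exact nbrCount_le_one fun d hd d' hd' hdx hdx' =>
        (key d hd hdx).trans (key d' hd' hdx').symm
    rw [cap, if_pos hxA]
    omega

/-- `cut_core` for a path whose vertices, apart from the last ones, are not joined to the rest. -/
lemma cut_aux (h : MinCE G z W P A) (D : ParityDrawing (Apex G z W S)) (hPS : ∀ x ∈ P, x ∈ S)
    (hAS : A ⊆ S) {R : List U} (hR : SPath G W S R) (hRlen : R.length ≤ 4) {κ : ZMod 2}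
    {P₁ post ext : List U} {r s : U} (hP : P = P₁ ++ post)
    (hh₁ : ∀ a ∈ A, a ∉ D.cls R κ → ∀ p ∈ P₁.head?, G.Adj a p → P₁.length ≤ 5)
    (hl₁ : ∀ a ∈ A, a ∉ D.cls R κ → ∀ p ∈ P₁.getLast?, G.Adj a p → P₁.length ≤ 5)
    (hb₁ : ∀ a ∈ A, a ∉ D.cls R κ → ∀ p ∈ P₁.head?, G.Adj a p → ∀ b ∈ A, b ∉ D.cls R κ →
      ∀ q ∈ P₁.getLast?, G.Adj b q → P₁.length ≤ 4)
    (hchain : (ext ++ R ++ post).IsChain G.Adj) (hlen : (ext ++ R ++ post).length ≤ 6)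
    (hone : ∀ a ∈ A, a ∈ D.cls R κ → a ∉ ext → ∀ p ∈ R ++ post, ∀ q ∈ R ++ post, G.Adj a p →
      G.Adj a q → p = q)
    (hh₂ : ∀ a ∈ A, a ∈ D.cls R κ → a ∉ ext → ∀ p ∈ (R ++ post).head?, G.Adj a p →
      (R ++ post).length ≤ 5)
    (hl₂ : ∀ a ∈ A, a ∈ D.cls R κ → a ∉ ext → ∀ p ∈ (R ++ post).getLast?, G.Adj a p →
      (ext ++ R ++ post).length ≤ 5)
    (hb₂ : ∀ a ∈ A, a ∈ D.cls R κ → a ∉ ext → ∀ p ∈ (R ++ post).head?, G.Adj a p →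
      ∀ b ∈ A, b ∈ D.cls R κ → b ∉ ext → ∀ q ∈ (R ++ post).getLast?, G.Adj b q →
      (R ++ post).length ≤ 4)
    (hpost : ∀ x ∈ post, x ∈ D.cls R κ) (hP₁ : ∀ x ∈ P₁, x ∉ D.cls R κ)
    (hNR : ∀ x ∈ R, x ∉ P → ∀ y ∈ post, ¬ G.Adj y x) (hext : ext = [] ∨ ext = [r])
    (hr : r ∈ ext → r ∈ A ∧ r ∈ D.cls R κ ∧ (∀ d ∈ P, ¬ G.Adj r d) ∧ ∀ y ∈ R, G.Adj r y → y = s)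
    {c v : U} (hc : c ∈ D.cls R κ) (hv : v ∈ W) (hvC : v ∉ D.cls R κ) (hvR : v ∉ R) : False := by
  have hz := h.conf.z_notMem
  have hnd := h.conf.nodup
  rw [hP, List.nodup_append] at hnd
  have hxr : ∀ x ∈ ext, x = r := by rcases hext with he | he <;> simp [he]
  have hrP : ∀ x ∈ ext, x ∈ A ∧ x ∉ P := fun x hx => by
    obtain rfl := hxr x hx
    exact ⟨(hr hx).1, h.conf.A_notMem x (hr hx).1⟩
  have hx' : ∀ x ∈ ext, x ∈ D.cls R κ := fun x hx => by
    obtain rfl := hxr x hx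
    exact (hr hx).2.1
  have hRC : ∀ x ∈ D.cls R κ, x ∉ R := fun x hx => (D.mem_cls.1 hx).2.1
  refine h.cut_core D hR (P₁ := P₁) (post := post) (ext := ext) (r := r) (s := s) ?_ ?_ hP hpost
    hP₁ hNR ?_ hc hv hvC hvR
  · refine h.conf.restrict Finset.sdiff_subset ⟨[], post, by simp [hP]⟩
      (fun x hx => Finset.mem_sdiff.2 ⟨h.conf.sub x (by simp [hP, hx]), hP₁ x hx⟩)
      (fun a ha haW => hh₁ a ha (Finset.mem_sdiff.1 haW).2)
      (fun a ha haW => hl₁ a ha (Finset.mem_sdiff.1 haW).2)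
      (fun a ha haW p hp hap b hb hbW => hb₁ a ha (Finset.mem_sdiff.1 haW).2 p hp hap b hb
        (Finset.mem_sdiff.1 hbW).2)
  · have hmem : ∀ {a}, a ∈ (A ∩ D.cls R κ).filter (fun t => t ∉ ext) →
        a ∈ A ∧ a ∈ D.cls R κ ∧ a ∉ ext := by simp +contextual
    have hnA : ∀ {a}, a ∈ A → ∀ x ∈ ext, ¬ G.Adj a x := fun ha x hx =>
      h.conf.indep _ ha x (hrP x hx).1
    have hhd : ∀ {a p}, a ∈ A → p ∈ (ext ++ R ++ post).head? → G.Adj a p →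
        ext = [] ∧ p ∈ (R ++ post).head? := by
      intro a p ha hp hap
      rcases hext with rfl | rfl
      · exact ⟨rfl, by simpa using hp⟩
      · exact (hnA ha p (by simp at hp; simp [hp]) hap).elim
    have hne : R ++ post ≠ [] := by simp [hR.ne_nil]
    refine
    { z_notMem := ?_
      nodup := ?_
      chain := hchain
      sub := ?_
      length_le := hlen
      A_sub := fun a ha => Finset.mem_union_left _ (hmem ha).2.1
      A_notMem := ?_
      indep := fun a ha b hb => h.conf.indep a (hmem ha).1 b (hmem hb).1
      one := ?_
      head := ?_
      last := ?_
      both := ?_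
      drawing := ?_ }
    · simp only [Finset.mem_union, List.mem_toFinset, not_or]
      exact ⟨fun h => hz (D.mem_cls.1 h).1, fun h => hz (hR.mem z h)⟩
    · rw [List.append_assoc, List.nodup_append, List.nodup_append]
      refine ⟨by rcases hext with rfl | rfl <;> simp, ⟨hR.nodup, hnd.2.1, ?_⟩, ?_⟩
      · rintro x hx y hy rfl
        exact hRC x (hpost x hy) hx
      · rintro x hx y hy rfl
        rcases List.mem_append.1 hy with hy | hy
        · exact hRC x (hx' x hx) hy
        · exact (hrP x hx).2 (by simp [hP, hy])
    · intro x hx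
      simp only [List.mem_append, Finset.mem_union, List.mem_toFinset] at hx ⊢
      rcases hx with (hx | hx) | hx
      exacts [Or.inl (hx' x hx), Or.inr hx, Or.inl (hpost x hx)]
    · intro a ha hap
      simp only [List.mem_append] at hap
      rcases hap with (hx | hx) | hx
      exacts [(hmem ha).2.2 hx, hRC a (hmem ha).2.1 hx,
        h.conf.A_notMem a (hmem ha).1 (by simp [hP, hx])]
    · intro a ha p hp q hq hap haq
      rw [List.append_assoc, List.mem_append] at hp hq
      exact hone a (hmem ha).1 (hmem ha).2.1 (hmem ha).2.2 p
        (hp.resolve_left fun h => hnA (hmem ha).1 p h hap) q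
        (hq.resolve_left fun h => hnA (hmem ha).1 q h haq) hap haq
    · intro a ha p hp hap
      obtain ⟨he, hp⟩ := hhd (hmem ha).1 hp hap
      subst he
      simpa using hh₂ a (hmem ha).1 (hmem ha).2.1 (hmem ha).2.2 p hp hap
    · intro a ha p hp hap
      rw [List.append_assoc, List.getLast?_append_of_ne_nil _ hne] at hp
      exact hl₂ a (hmem ha).1 (hmem ha).2.1 (hmem ha).2.2 p hp hap
    · intro a ha p hp hap b hb q hq hbq
      obtain ⟨he, hp⟩ := hhd (hmem ha).1 hp hap
      rw [List.append_assoc, List.getLast?_append_of_ne_nil _ hne] at hq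
      have := hb₂ a (hmem ha).1 (hmem ha).2.1 (hmem ha).2.2 p hp hap b (hmem hb).1 (hmem hb).2.1
        (hmem hb).2.2 q hq hbq
      subst he
      simpa using this
    · obtain ⟨D'⟩ := D.split hz hR (h.noChord hR.chain hR.nodup hRlen) κ
      refine ⟨D'.mono (Apex.mono subset_rfl fun x hx => ?_)⟩
      simp only [Finset.mem_union, List.mem_toFinset, Finset.mem_inter, Finset.mem_filter,
        List.mem_append] at hx ⊢
      rcases hx with ((hx | hx) | hx) | hx
      · exact Or.inl ⟨hAS (hrP x hx).1, hx' x hx⟩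
      · exact Or.inr hx
      · exact Or.inl ⟨hPS x (by simp [hP, hx]), hpost x hx⟩
      · exact Or.inl ⟨hAS hx.1.1, hx.1.2⟩
  · intro x hx
    obtain rfl := hxr x hx
    exact ⟨rfl, hr hx⟩

end MinCE
end Cutting

section Reductions
open Classical

variable {U : Type*} {G : SimpleGraph U} {z : U} {W S A : Finset U} {P : List U}

/-- The two sides of a path leaving a path `P` of edges with one empty side. -/
lemma ParityDrawing.side_ne_of_chain (D : ParityDrawing (Apex G z W S)) (hz : z ∉ W) (hSW : S ⊆ W)
    {pre post Q : List U} {c k : U} (hP : P = pre ++ c :: post) (hc : P.IsChain G.Adj)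
    (hnd : P.Nodup) (hS : ∀ x ∈ P, x ∈ S)
    (hconst : ∀ l p q r, P = l ++ p :: q :: r → D.ConstSide [p, q])
    (hR : SPath G W S (c :: (Q ++ [k]))) (hdis : ∀ x ∈ pre ++ post, x ∉ c :: (Q ++ [k])) :
    ∀ x ∈ pre, ∀ y ∈ post,
      D.side z (c :: (Q ++ [k])) x + D.side z (c :: (Q ++ [k])) y = 1 := by
  subst hP
  intro x hx y hy
  obtain ⟨pre', l, rfl⟩ := (List.eq_nil_or_concat pre).resolve_left (List.ne_nil_of_mem hx)
  obtain ⟨r, post', rfl⟩ := List.exists_cons_of_ne_nil (List.ne_nil_of_mem hy)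
  have hl := hconst pre' l c (r :: post') (by simp)
  have hr := hconst (pre' ++ [l]) c r post' (by simp)
  obtain ⟨K₁, hK₁⟩ := hl.swap
  obtain ⟨K₂, hK₂⟩ := hr
  have hc2 := hc
  rw [List.isChain_append, List.isChain_cons_cons] at hc2
  have hlc : G.Adj l c := hc2.2.2 l (by simp) c (by simp)
  have hlr : l ≠ r := fun h => by simp [h, List.nodup_append] at hnd
  have := D.side_ne hz hSW (hS c (by simp)) (hS l (by simp)) (hS r (by simp))
    (hR.last k (by rw [← List.cons_append, List.getLast?_concat]; rfl)) hlc.symm hc2.2.1.1 hlr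
    hK₁ hK₂ hR
    (hdis l (by simp)) (hdis r (by simp))
  rw [D.side_eq_of_chain hz hR hc2.1 (fun x hx => hSW (hS x (by simp at hx ⊢; tauto)))
    (fun x hx => hdis x (by simp at hx ⊢; tauto)) x hx l (by simp),
    D.side_eq_of_chain hz hR hc2.2.1.2 (fun x hx => hSW (hS x (by simp at hx ⊢; tauto)))
    (fun x hx => hdis x (by simp at hx ⊢; tauto)) y hy r (by simp), this]

namespace MinCE

lemma length_prefix_le (h : MinCE G z W P A) {P₁ post : List U} (hP : P = P₁ ++ post)
    (hpost : post ≠ []) {a p : U} (ha : a ∈ A) (hp : p ∈ P₁.head?) (hap : G.Adj a p) :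
    P₁.length ≤ 4 := by
  have := h.conf.head a ha p (by
    rw [hP, List.head?_append_of_ne_nil _ (by rintro rfl; simp at hp)]; exact hp) hap
  have := List.length_pos_iff.2 hpost
  simp only [hP, List.length_append] at *
  omega

/-- Every edge of `P` has an empty side. -/
lemma constSide_edge (h : MinCE G z W P A) (D : ParityDrawing (Apex G z W S))
    (hPS : ∀ x ∈ P, x ∈ S) (hAS : A ⊆ S) :
    ∀ pre p q post, P = pre ++ p :: q :: post → D.ConstSide [p, q] := by
  intro pre p q post hP
  have hz := h.conf.z_notMem
  have hnd := h.conf.nodup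
  have hch := h.conf.chain
  have hl := h.conf.length_le
  rw [hP] at hnd hch
  rw [hP, List.length_append, List.length_cons, List.length_cons] at hl
  have hpq : G.Adj p q := by
    rw [List.isChain_append, List.isChain_cons_cons] at hch; exact hch.2.1.1
  have hR : SPath G W S [p, q] :=
    { ne_nil := by simp
      chain := by simpa using hpq
      nodup := by simpa using hpq.ne
      mem := fun x hx => h.conf.sub x (by rw [hP]; simp at hx ⊢; tauto)
      head := fun x hx => hPS x (by rw [hP]; simp at hx ⊢; tauto)
      last := fun x hx => hPS x (by rw [hP]; simp at hx ⊢; tauto) }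
  have hpre : ∀ x ∈ pre, x ∉ [p, q] := by
    intro x hx hx'
    rw [List.nodup_append] at hnd
    exact hnd.2.2 x hx x (by simp at hx' ⊢; tauto) rfl
  have hpost : ∀ x ∈ post, x ∉ [p, q] := by
    intro x hx hx'
    rw [List.nodup_append] at hnd
    simp at hnd hx'
    rcases hx' with rfl | rfl
    exacts [hnd.2.1.1.2 hx, hnd.2.1.2.1 hx]
  have hpre' : ∀ x ∈ pre, ∀ y ∈ pre, D.side z [p, q] x = D.side z [p, q] y :=
    D.side_eq_of_chain hz hR (List.isChain_append.1 hch).1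
      (fun x hx => h.conf.sub x (by simp [hP, hx])) hpre
  have hpost' : ∀ x ∈ post, ∀ y ∈ post, D.side z [p, q] x = D.side z [p, q] y :=
    D.side_eq_of_chain hz hR (List.isChain_append.1 hch).2.1.tail.tail
      (fun x hx => h.conf.sub x (by simp [hP, hx])) hpost
  suffices hs : ∀ x ∈ pre, ∀ y ∈ post, D.side z [p, q] x = D.side z [p, q] y by
    refine h.constSide_of_forall D hAS hR (by simp) fun x hx hxR y hy hyR => ?_
    have hm : ∀ x ∈ P, x ∉ [p, q] → x ∈ pre ∨ x ∈ post := fun x hx hxR => by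
      rw [hP] at hx
      simp at hx hxR
      tauto
    rcases hm x hx hxR with hx | hx <;> rcases hm y hy hyR with hy | hy
    exacts [hpre' x hx y hy, hs x hx y hy, (hs y hy x hx).symm, hpost' x hx y hy]
  intro x hx y hy
  by_contra hxy
  have hpne := List.ne_nil_of_mem hx
  have hqne := List.ne_nil_of_mem hy
  have hlpre := List.length_pos_iff.2 hpne
  have hlpost := List.length_pos_iff.2 hqne
  have hP' : P = (pre ++ [p, q]) ++ post := by simp [hP]
  have hP'' : P.reverse = ([p, q] ++ post).reverse ++ pre.reverse := by simp [hP]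
  have hsuf : ∀ a ∈ A, ∀ r ∈ ([p, q] ++ post).getLast?, G.Adj a r →
      ([p, q] ++ post).length ≤ 4 := fun a ha r hr har => by
    have := h.reverse.length_prefix_le hP'' (by simpa using hpne) ha (p := r)
      (by rw [List.head?_reverse]; exact hr) har
    rwa [List.length_reverse] at this
  refine h.cut_aux D hPS hAS hR (by simp) (κ := D.side z [p, q] y) (P₁ := pre ++ [p, q])
    (post := post) (ext := []) (r := p) (s := p) (c := y) (v := x) hP' ?_ ?_ ?_ ?_ ?_ ?_ ?_ ?_ ?_ ?_
    ?_ ?_ (Or.inl rfl) (by simp) ?_ ?_ ?_ ?_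
  · exact fun a ha _ p hp hap => (h.length_prefix_le hP' hqne ha hp hap).trans (by omega)
  · intros; simp only [List.length_append, List.length_cons, List.length_nil]; omega
  · exact fun a ha _ p hp hap _ _ _ _ _ _ => h.length_prefix_le hP' hqne ha hp hap
  · simpa using (List.isChain_append.1 hch).2.1
  · simp only [List.length_append, List.length_cons, List.length_nil]; omega
  · exact fun a ha _ _ p' hp q' hq => h.conf.one a ha p' (by rw [hP]; simp at hp ⊢; tauto) q'
      (by rw [hP]; simp at hq ⊢; tauto)
  · intros; simp only [List.length_append, List.length_cons, List.length_nil]; omega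
  · intro a ha _ _ r hr har
    simpa using (hsuf a ha r hr har).trans (by omega)
  · exact fun _ _ _ _ _ _ _ b hb _ _ r hr hbr => hsuf b hb r hr hbr
  · exact fun t ht => D.mem_cls.2 ⟨h.conf.sub t (by simp [hP, ht]), hpost t ht, hpost' t ht y hy⟩
  · intro t ht htC
    rw [D.mem_cls] at htC
    rcases List.mem_append.1 ht with ht | ht
    · exact hxy ((hpre' x hx t ht).trans htC.2.2)
    · exact htC.2.1 ht
  · exact fun t ht htP => (htP (by rw [hP]; simp at ht ⊢; tauto)).elim
  · exact D.mem_cls.2 ⟨h.conf.sub y (by simp [hP, hy]), hpost y hy, rfl⟩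
  · exact h.conf.sub x (by simp [hP, hx])
  · exact fun htC => hxy (D.mem_cls.1 htC).2.2
  · exact hpre x hx

/-- No vertex of `A` is joined to an interior vertex of `P`. -/
lemma not_adj_interior (h : MinCE G z W P A) {pre post : List U} {p a : U}
    (hP : P = pre ++ p :: post) (hpre : pre ≠ []) (hpost : post ≠ []) (ha : a ∈ A) :
    ¬ G.Adj a p := by
  intro hap
  obtain ⟨D⟩ := h.conf.drawing
  have hz := h.conf.z_notMem
  have hnd := h.conf.nodup
  have hch := h.conf.chain
  have hl := h.conf.length_le
  have haP := h.conf.A_notMem a ha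
  have hSW : P.toFinset ∪ A ⊆ W := fun x hx => by
    rcases Finset.mem_union.1 hx with hx | hx
    exacts [h.conf.sub x (List.mem_toFinset.1 hx), h.conf.A_sub x hx]
  have hPS : ∀ x ∈ P, x ∈ P.toFinset ∪ A := fun x hx => by simp [hx]
  have hAS : A ⊆ P.toFinset ∪ A := Finset.subset_union_right
  have hc := h.constSide_edge D hPS hAS
  have hsep₀ := fun {Q k} => D.side_ne_of_chain hz hSW (Q := Q) (k := k) hP hch hnd hPS hc
  rw [hP] at hnd hch
  rw [hP, List.length_append, List.length_cons] at hl
  have hlpre := List.length_pos_iff.2 hpre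
  have hlpost := List.length_pos_iff.2 hpost
  have hpW := h.conf.sub p (by simp [hP])
  have hR : SPath G W (P.toFinset ∪ A) [a, p] :=
    { ne_nil := by simp
      chain := by simpa using hap
      nodup := by simpa using hap.ne
      mem := by simp [h.conf.A_sub a ha, hpW]
      head := by simp [ha]
      last := by simp [hP] }
  have hdis : ∀ x ∈ pre ++ post, x ∉ [a, p] := by
    intro x hx hx'
    rw [List.nodup_append] at hnd
    simp only [List.mem_append, List.mem_cons, List.not_mem_nil, or_false] at hx hx'
    rcases hx' with rfl | rfl
    · exact haP (by rw [hP]; simp; tauto)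
    · rcases hx with hx | hx
      · exact hnd.2.2 x hx x (by simp) rfl
      · exact (List.nodup_cons.1 hnd.2.1).1 hx
  have hsep := hsep₀ (Q := []) (k := a) hR.reverse (by simpa [or_comm] using hdis)
  have hsr : ∀ t, D.side z (p :: ([] ++ [a])) t = D.side z [a, p] t :=
    fun t => D.side_reverse [a, p] t
  simp only [hsr] at hsep
  obtain ⟨x, hx⟩ := List.exists_mem_of_ne_nil pre hpre
  obtain ⟨y, hy⟩ := List.exists_mem_of_ne_nil post hpost
  have hP' : P = (pre ++ [p]) ++ post := by simp [hP]
  have hypost : ∀ t ∈ post, t ∈ D.cls [a, p] (D.side z [a, p] y) := fun t ht =>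
    D.mem_cls.2 ⟨h.conf.sub t (by simp [hP, ht]), hdis t (by simp [ht]), by
      have := hsep x hx t ht; have := hsep x hx y hy; grind⟩
  have hxpre : ∀ t ∈ pre, t ∉ D.cls [a, p] (D.side z [a, p] y) := fun t ht htC => by
    have := (D.mem_cls.1 htC).2.2; have := hsep t ht y hy; grind
  refine h.cut_aux D hPS hAS hR (by simp) (κ := D.side z [a, p] y) (P₁ := pre ++ [p])
    (post := post) (ext := []) (r := p) (s := p) (c := y) (v := x) hP' ?_ ?_ ?_ ?_ ?_ ?_ ?_ ?_ ?_
    hypost ?_ ?_ (Or.inl rfl) (by simp) (hypost y hy) ?_ (hxpre x hx) (hdis x (by simp [hx]))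
  · exact fun a ha _ p hp hap => (h.length_prefix_le hP' hpost ha hp hap).trans (by omega)
  · intros; simp only [List.length_append, List.length_cons, List.length_nil]; omega
  · exact fun a ha _ p hp hap _ _ _ _ _ _ => h.length_prefix_le hP' hpost ha hp hap
  · simpa [hap] using (List.isChain_append.1 hch).2.1
  · simp only [List.length_append, List.length_cons, List.length_nil]; omega
  · intro b hb _ _ p' hp q' hq hbp hbq
    have hm : ∀ x ∈ [a, p] ++ post, G.Adj b x → x ∈ P := fun x hx hbx => by
      simp only [List.mem_append, List.mem_cons, List.not_mem_nil, or_false] at hx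
      rcases hx with (rfl | rfl) | hx
      · exact (h.conf.indep b hb x ha hbx).elim
      · simp [hP]
      · simp [hP, hx]
    exact h.conf.one b hb p' (hm p' hp hbp) q' (hm q' hq hbq) hbp hbq
  · intro b hb _ _ q hq hbq
    simp only [List.cons_append, List.head?_cons, Option.mem_def, Option.some.injEq] at hq
    exact (h.conf.indep b hb a ha (hq ▸ hbq)).elim
  · intro b hb _ _ q hq hbq
    have := h.conf.last b hb q (by
      rw [List.getLast?_append_of_ne_nil _ hpost] at hq
      rw [hP', List.getLast?_append_of_ne_nil _ hpost]; exact hq) hbq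
    simp only [hP, List.nil_append, List.length_append, List.length_cons, List.length_nil] at this ⊢
    omega
  · intro b hb _ _ q hq hbq
    simp only [List.cons_append, List.head?_cons, Option.mem_def, Option.some.injEq] at hq
    exact (h.conf.indep b hb a ha (hq ▸ hbq)).elim
  · intro t ht htC
    rcases List.mem_append.1 ht with ht | ht
    · exact hxpre t ht htC
    · exact (D.mem_cls.1 htC).2.1 (by simp at ht; simp [ht])
  · intro t ht htP y hy hyt
    simp only [List.mem_cons, List.not_mem_nil, or_false] at ht
    rcases ht with rfl | rfl
    · have := h.conf.one t ha y (by simp [hP, hy]) p (by simp [hP]) hyt.symm hap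
      exact hdis y (by simp [hy]) (by simp [this])
    · exact htP (by simp [hP])
  · exact h.conf.sub x (by simp [hP, hx])

/-- A vertex of `A` cannot be used to extend `P`. -/
lemma extend_false (h : MinCE G z W P A) {a : U} (ha : a ∈ A) (hhead : ∀ p ∈ P.head?, G.Adj a p)
    (hlen : P.length ≤ 5)
    (hlast : ∀ b ∈ A, ∀ q ∈ P.getLast?, G.Adj b q → P.length ≤ 4) : False := by
  have haP := h.conf.A_notMem a ha
  have hg : Good G W (a :: P) (A.erase a) := by
    refine h.ih_cons ?_ (by simp)
    refine
    { z_notMem := h.conf.z_notMem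
      nodup := List.nodup_cons.2 ⟨haP, h.conf.nodup⟩
      chain := List.isChain_cons.2 ⟨hhead, h.conf.chain⟩
      sub := ?_
      length_le := by rw [List.length_cons]; omega
      A_sub := fun b hb => h.conf.A_sub b (Finset.mem_of_mem_erase hb)
      A_notMem := ?_
      indep := fun b hb c hc => h.conf.indep b (Finset.mem_of_mem_erase hb) c
        (Finset.mem_of_mem_erase hc)
      one := ?_
      head := ?_
      last := ?_
      both := ?_
      drawing := ?_ }
    · intro x hx
      rcases List.mem_cons.1 hx with rfl | hx
      exacts [h.conf.A_sub x ha, h.conf.sub x hx]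
    · intro b hb hbP
      rcases List.mem_cons.1 hbP with rfl | hx
      exacts [Finset.notMem_erase _ _ hb, h.conf.A_notMem b (Finset.mem_of_mem_erase hb) hx]
    · intro b hb p hp q hq hbp hbq
      have hbA := Finset.mem_of_mem_erase hb
      refine h.conf.one b hbA p ((List.mem_cons.1 hp).resolve_left ?_) q
        ((List.mem_cons.1 hq).resolve_left ?_) hbp hbq
      · rintro rfl; exact h.conf.indep b hbA p ha hbp
      · rintro rfl; exact h.conf.indep b hbA q ha hbq
    · intro b hb p hp hbp
      simp only [List.head?_cons, Option.mem_def, Option.some.injEq] at hp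
      exact (h.conf.indep b (Finset.mem_of_mem_erase hb) a ha (hp ▸ hbp)).elim
    · intro b hb q hq hbq
      cases P with
      | nil => simp
      | cons p P =>
        rw [List.getLast?_cons_cons] at hq
        have := hlast b (Finset.mem_of_mem_erase hb) q hq hbq
        rw [List.length_cons]
        omega
    · intro b hb p hp hbp
      simp only [List.head?_cons, Option.mem_def, Option.some.injEq] at hp
      exact (h.conf.indep b (Finset.mem_of_mem_erase hb) a ha (hp ▸ hbp)).elim
    · obtain ⟨D⟩ := h.conf.drawing
      refine ⟨D.mono (Apex.mono subset_rfl fun x hx => ?_)⟩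
      simp only [List.toFinset_cons, Finset.mem_union, Finset.mem_insert, Finset.mem_erase,
        List.mem_toFinset] at hx ⊢
      rcases hx with (rfl | hx) | hx
      exacts [Or.inr ha, Or.inl hx, Or.inr hx.2]
  refine h.bad (WD.delete_cap (u := a) ?_ (by simpa using haP) ?_ (WD.mono (f := cap G (A.erase a)
    (a :: P).toFinset) ?_ fun t ht => ?_))
  · simp [haP, h.conf.A_sub a ha]
  · have : nbrCount G P.toFinset a ≤ 1 := nbrCount_le_one fun x hx y hy hxa hya =>
      h.conf.one a ha x (List.mem_toFinset.1 hx) y (List.mem_toFinset.1 hy) hxa.symm hya.symm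
    rw [cap, if_pos ha]
    omega
  · have : (W \ P.toFinset).erase a = W \ (a :: P).toFinset := by
      ext t; simp only [List.toFinset_cons, Finset.mem_erase, Finset.mem_sdiff, Finset.mem_insert]
      tauto
    rw [this]
    exact hg
  · refine cap_le_cap (fun htA => Finset.mem_erase.2 ⟨(Finset.mem_erase.1 ht).1, htA⟩) ?_
    simp +contextual

lemma not_adj_head (h : MinCE G z W P A) {a p : U} (ha : a ∈ A) (hp : p ∈ P.head?) :
    ¬ G.Adj a p := by
  intro hap
  have hp' : ∀ q ∈ P.head?, q = p := fun q hq => Option.mem_unique hq hp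
  exact h.extend_false ha (fun q hq => hp' q hq ▸ hap) (h.conf.head a ha p hp hap)
    fun b hb q hq hbq => h.conf.both a ha p hp hap b hb q hq hbq

/-- No vertex of `A` is joined to `P`. -/
lemma not_adj (h : MinCE G z W P A) {a p : U} (ha : a ∈ A) (hp : p ∈ P) : ¬ G.Adj a p := by
  obtain ⟨pre, post, hP⟩ := List.append_of_mem hp
  by_cases hpre : pre = []
  · exact h.not_adj_head ha (by simp [hP, hpre])
  by_cases hpost : post = []
  · exact h.reverse.not_adj_head ha (by simp [hP, hpost])
  exact h.not_adj_interior hP hpre hpost ha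

lemma ne_nil (h : MinCE G z W P A) : P ≠ [] := by
  rintro rfl
  by_cases hA : A.Nonempty
  · obtain ⟨a, ha⟩ := hA
    exact h.extend_false ha (by simp) (by simp) (by simp)
  rw [Finset.not_nonempty_iff_eq_empty] at hA
  subst hA
  by_cases hW : W.Nonempty
  · obtain ⟨v, hv⟩ := hW
    have hg : Good G W [v] ∅ := by
      refine h.ih_cons ?_ (by simp)
      refine
      { z_notMem := h.conf.z_notMem
        nodup := by simp
        chain := by simp
        sub := by simpa using hv
        length_le := by simp
        A_sub := by simp
        A_notMem := by simp
        indep := by simp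
        one := by simp
        head := by simp
        last := by simp
        both := by simp
        drawing := ?_ }
      obtain ⟨D⟩ := h.conf.drawing
      obtain ⟨D'⟩ := (D.mono (Apex.mono subset_rfl (by simp)) :
        ParityDrawing (Apex G z W ∅)).pendant h.conf.z_notMem hv
      exact ⟨D'.mono (Apex.mono subset_rfl (by simp))⟩
    refine h.bad (WD.delete_cap (u := v) (by simpa using hv) (by simp) ?_ ?_)
    · simp [cap, nbrCount]
    · have : (W \ ([] : List U).toFinset).erase v = W \ [v].toFinset := by
        ext t; simp [and_comm]
      rw [this]
      exact hg
  · rw [Finset.not_nonempty_iff_eq_empty] at hW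
    subst hW
    exact h.bad (WD.empty _)

end MinCE
end Reductions

section Centers
open Classical

variable {U : Type*} {G : SimpleGraph U} {z : U} {W S A : Finset U} {P : List U}

namespace MinCE

/-- Cutting along a path whose last vertex is in `P` or in `A`; at most one inner vertex `m` of the
path has neighbours in `A` on the side which is cut off. -/
lemma cut (h : MinCE G z W P A) (D : ParityDrawing (Apex G z W S)) (hPS : ∀ x ∈ P, x ∈ S)
    (hAS : A ⊆ S) {s c r m : U} {Q : List U} (hR : SPath G W S (s :: (Q ++ [c])))
    (hQ : Q.length ≤ 2) (hc : c ∈ P ∨ c ∈ A) {κ : ZMod 2} {P₁ post ext : List U}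
    (hP : P = P₁ ++ post) (hjoin : ∀ y ∈ post.head?, G.Adj c y)
    (hlen : ext.length + Q.length + post.length ≤ 4) (hm : m = s → Q.length + post.length ≤ 3)
    (hRA : ∀ b ∈ A, b ∉ ext → D.side z (s :: (Q ++ [c])) b = κ → ∀ x ∈ s :: Q, x ≠ m →
      ¬ G.Adj b x)
    (hpost : ∀ x ∈ post, x ∉ s :: (Q ++ [c]) ∧ D.side z (s :: (Q ++ [c])) x = κ)
    (hP₁ : ∀ x ∈ P₁, x ∉ s :: (Q ++ [c]) → D.side z (s :: (Q ++ [c])) x ≠ κ)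
    (hNR : ∀ x ∈ s :: Q, ∀ y ∈ post, ¬ G.Adj y x) (hext : ext = [] ∨ ext = [r])
    (hr : r ∈ ext → r ∈ A ∧ r ∉ s :: (Q ++ [c]) ∧ D.side z (s :: (Q ++ [c])) r = κ ∧ G.Adj s r)
    {t v : U} (ht : t ∈ W) (htR : t ∉ s :: (Q ++ [c])) (htC : D.side z (s :: (Q ++ [c])) t = κ)
    (hv : v ∈ W) (hvR : v ∉ s :: (Q ++ [c])) (hvC : D.side z (s :: (Q ++ [c])) v ≠ κ) :
    False := by
  have hcA : ∀ b ∈ A, ¬ G.Adj b c := fun b hb hbc =>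
    hc.elim (fun hc => h.not_adj hb hc hbc) fun hc => h.conf.indep b hb c hc hbc
  have hRA' : ∀ b ∈ A, b ∉ ext → D.side z (s :: (Q ++ [c])) b = κ → ∀ x ∈ s :: (Q ++ [c]), x ≠ m →
      ¬ G.Adj b x := by
    intro b hb hbe hbκ x hx hxm
    rw [← List.cons_append, List.mem_append, List.mem_singleton] at hx
    rcases hx with hx | rfl
    exacts [hRA b hb hbe hbκ x hx hxm, hcA b hb]
  have hPP : ∀ x ∈ P₁, x ∈ P := fun x hx => by simp [hP, hx]
  have hh : ∀ x ∈ P₁.head?, x ∈ P := fun x hx => hPP x (List.mem_of_mem_head? hx)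
  have hl : ∀ x ∈ P₁.getLast?, x ∈ P := fun x hx => hPP x (List.mem_of_mem_getLast? hx)
  have hlast : ∀ b ∈ A, ∀ q ∈ (s :: (Q ++ [c]) ++ post).getLast?, ¬ G.Adj b q := by
    intro b hb q hq hbq
    by_cases hp : post = []
    · subst hp
      rw [List.append_nil, ← List.cons_append, List.getLast?_concat] at hq
      simp only [Option.mem_def, Option.some.injEq] at hq
      exact hcA b hb (hq ▸ hbq)
    · rw [List.getLast?_append_of_ne_nil _ hp] at hq
      exact h.not_adj hb (by rw [hP]; simp [List.mem_of_mem_getLast? hq]) hbq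
  refine h.cut_aux D hPS hAS hR (by simp; omega) (κ := κ) (P₁ := P₁) (post := post) (ext := ext)
    (r := r) (s := s) hP (fun b hb _ p hp hbp => (h.not_adj hb (hh p hp) hbp).elim)
    (fun b hb _ p hp hbp => (h.not_adj hb (hl p hp) hbp).elim)
    (fun b hb _ p hp hbp => (h.not_adj hb (hh p hp) hbp).elim) ?_ ?_ ?_ ?_
    (fun b hb _ _ q hq hbq => (hlast b hb q hq hbq).elim)
    (fun _ _ _ _ _ _ _ b hb _ _ q hq hbq => (hlast b hb q hq hbq).elim)
    (fun x hx => D.mem_cls.2 ⟨h.conf.sub x (by simp [hP, hx]), hpost x hx⟩)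
    (fun x hx hxC => hP₁ x hx (D.mem_cls.1 hxC).2.1 (D.mem_cls.1 hxC).2.2) ?_ hext ?_
    (D.mem_cls.2 ⟨ht, htR, htC⟩) hv (fun hvC' => hvC (D.mem_cls.1 hvC').2.2) hvR
  · have hc1 : (ext ++ s :: (Q ++ [c])).IsChain G.Adj := by
      rcases hext with rfl | rfl
      · exact hR.chain
      · exact List.isChain_cons.2 ⟨by simpa using (hr (by simp)).2.2.2.symm, hR.chain⟩
    have hp : post.IsChain G.Adj := by
      have := h.conf.chain
      rw [hP, List.isChain_append] at this
      exact this.2.1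
    refine List.isChain_append.2 ⟨hc1, hp, fun x hx y hy => ?_⟩
    rw [← List.cons_append, ← List.append_assoc, List.getLast?_concat] at hx
    simp only [Option.mem_def, Option.some.injEq] at hx
    exact hx ▸ hjoin y hy
  · simp only [List.length_append, List.length_cons, List.length_nil]
    omega
  · intro b hb hbC hbe p hp q hq hbp hbq
    have key : ∀ p ∈ s :: (Q ++ [c]) ++ post, G.Adj b p → p = m := by
      intro p hp hbp
      rcases List.mem_append.1 hp with hp | hp
      · exact by_contra fun hpm => hRA' b hb hbe (D.mem_cls.1 hbC).2.2 p hp hpm hbp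
      · exact (h.not_adj hb (by simp [hP, hp]) hbp).elim
    exact (key p hp hbp).trans (key q hq hbq).symm
  · intro b hb hbC hbe p hp hbp
    simp only [List.cons_append, List.head?_cons, Option.mem_def, Option.some.injEq] at hp
    subst hp
    have hms : m = s := by_contra fun hms =>
      hRA' b hb hbe (D.mem_cls.1 hbC).2.2 s (by simp) (Ne.symm hms) hbp
    have := hm hms
    simp only [List.length_append, List.length_cons, List.length_nil]
    omega
  · intro x hx hxP y hy
    rw [← List.cons_append, List.mem_append, List.mem_singleton] at hx
    rcases hx with hx | rfl
    · exact hNR x hx y hy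
    · exact fun hyx => h.not_adj (hc.resolve_left hxP) (by simp [hP, hy]) hyx.symm
  · intro hre
    obtain ⟨hrA, hrR, hrκ, hsr⟩ := hr hre
    refine ⟨hrA, D.mem_cls.2 ⟨h.conf.A_sub r hrA, hrR, hrκ⟩, fun d hd => h.not_adj hrA hd, ?_⟩
    intro y hy hry
    rcases List.mem_cons.1 hy with hy | hy
    · exact hy
    rcases List.mem_append.1 hy with hy | hy
    · have hsub : (s :: Q) <+: s :: (Q ++ [c]) := ⟨[c], by simp⟩
      exact (h.not_adj_of_length_le_two (isChain_of_infix hR.chain hsub.isInfix)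
        (hR.nodup.sublist hsub.sublist) hQ
        (fun hrQ => hrR (by simp [hrQ])) hsr.symm y hy hry).elim
    · rw [List.mem_singleton] at hy
      exact (hcA r hrA (hy ▸ hry)).elim

/-- A vertex `s` with consecutive apex neighbours `l` and `r ∈ A` cannot reach an element of `P`
by a short path, if `l` is on the side of the initial part of `P`. -/
lemma center_path_false (h : MinCE G z W P A) (D : ParityDrawing (Apex G z W S)) (hSW : S ⊆ W)
    (hPS : ∀ x ∈ P, x ∈ S) (hAS : A ⊆ S) {s l r c m : U} {Q : List U} (hl : l ∈ S) (hr : r ∈ A)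
    (hsl : G.Adj s l) (hsr : G.Adj s r) (hlr : l ≠ r) (hcl : D.ConstSide [s, l])
    (hcr : D.ConstSide [s, r]) (hR : SPath G W S (s :: (Q ++ [c]))) (hQ : Q.length ≤ 2)
    (hlR : l ∉ s :: (Q ++ [c])) (hrR : r ∉ s :: (Q ++ [c])) {pre post : List U}
    (hP : P = pre ++ c :: post) (hdis : ∀ x ∈ pre ++ post, x ∉ s :: (Q ++ [c]))
    (hpre : ∃ x ∈ pre, D.side z (s :: (Q ++ [c])) x = D.side z (s :: (Q ++ [c])) l)
    (hlen : Q.length + post.length ≤ 3)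
    (hRA : ∀ b ∈ A, b ≠ r → b ≠ l → ∀ x ∈ s :: Q, x ≠ m → ¬ G.Adj b x)
    (hNR : ∀ x ∈ s :: Q, ∀ y ∈ post, ¬ G.Adj y x) : False := by
  have hz := h.conf.z_notMem
  obtain ⟨K₁, hK₁⟩ := hcl
  obtain ⟨K₂, hK₂⟩ := hcr
  have hsep := D.side_ne hz hSW (hR.head s (by simp)) hl (hAS hr) (hPS c (by simp [hP])) hsl hsr
    hlr hK₁ hK₂ hR hlR hrR
  obtain ⟨x₀, hx₀, hx₀l⟩ := hpre
  have hedge := h.constSide_edge D hPS hAS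
  have hrev : (s :: (Q ++ [c])).reverse = c :: (Q.reverse ++ [s]) := by simp
  have hsep2 := D.side_ne_of_chain hz hSW (Q := Q.reverse) (k := s) hP h.conf.chain h.conf.nodup hPS
    hedge (hrev ▸ hR.reverse) (fun x hx hxR => hdis x hx (List.mem_reverse.1 (hrev ▸ hxR)))
  simp only [← hrev, D.side_reverse] at hsep2
  have hch := h.conf.chain
  have hndP := h.conf.nodup
  rw [hP] at hch hndP
  have hpre' : ∀ x ∈ pre, D.side z (s :: (Q ++ [c])) x = D.side z (s :: (Q ++ [c])) l :=
    fun x hx => (D.side_eq_of_chain hz hR (List.isChain_append.1 hch).1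
      (fun x hx => h.conf.sub x (by simp [hP, hx])) (fun x hx => hdis x (by simp [hx])) x hx x₀
      hx₀).trans hx₀l
  have hr0 : D.side z (s :: (Q ++ [c])) r ≠ D.side z (s :: (Q ++ [c])) l := by
    intro he; rw [he] at hsep; grind
  refine h.cut D hPS hAS hR hQ (Or.inl (by simp [hP])) (κ := D.side z (s :: (Q ++ [c])) r)
    (P₁ := pre ++ [c]) (post := post) (ext := [r]) (r := r) (m := m) (t := r) (v := x₀)
    (by simp [hP])
    ?_ (by simp only [List.length_cons, List.length_nil]; omega) (fun _ => hlen) ?_ ?_ ?_ hNR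
    (Or.inr rfl)
    (fun _ => ⟨hr, hrR, rfl, hsr⟩) (h.conf.A_sub r hr) hrR rfl (h.conf.sub x₀ (by simp [hP, hx₀]))
    (hdis x₀ (by simp [hx₀])) ?_
  · rw [List.isChain_append, List.isChain_cons] at hch
    exact hch.2.1.1
  · intro b hb hbr hbs
    exact hRA b hb (by simpa using hbr) fun hbl => hr0 (hbl ▸ hbs).symm
  · intro x hx
    refine ⟨hdis x (by simp [hx]), ?_⟩
    have := hsep2 x₀ hx₀ x hx
    rw [hx₀l] at this
    grind
  · intro x hx hxR
    rcases List.mem_append.1 hx with hx | hx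
    · rw [hpre' x hx]; exact hr0.symm
    · exact (hxR (by simp at hx; simp [hx])).elim
  · rw [hx₀l]; exact hr0.symm

/-- A vertex `s` with consecutive apex neighbours `l` and `r ∈ A` cannot reach another element of
`A` by a short path, if `l` is on the side of `P`. -/
lemma center_mem_false (h : MinCE G z W P A) (D : ParityDrawing (Apex G z W S)) (hSW : S ⊆ W)
    (hPS : ∀ x ∈ P, x ∈ S) (hAS : A ⊆ S) {s l r c m : U} {Q : List U} (hl : l ∈ S) (hr : r ∈ A)
    (hsl : G.Adj s l) (hsr : G.Adj s r) (hlr : l ≠ r) (hcl : D.ConstSide [s, l])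
    (hcr : D.ConstSide [s, r]) (hR : SPath G W S (s :: (Q ++ [c]))) (hQ : Q.length ≤ 2)
    (hlR : l ∉ s :: (Q ++ [c])) (hrR : r ∉ s :: (Q ++ [c])) (hc : c ∈ A)
    (hdis : ∀ x ∈ P, x ∉ s :: (Q ++ [c]))
    (hpre : ∃ x ∈ P, D.side z (s :: (Q ++ [c])) x = D.side z (s :: (Q ++ [c])) l)
    (hRA : ∀ b ∈ A, b ≠ r → b ≠ l → ∀ x ∈ s :: Q, x ≠ m → ¬ G.Adj b x) : False := by
  have hz := h.conf.z_notMem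
  obtain ⟨K₁, hK₁⟩ := hcl
  obtain ⟨K₂, hK₂⟩ := hcr
  have hsep := D.side_ne hz hSW (hR.head s (by simp)) hl (hAS hr) (hAS hc) hsl hsr
    hlr hK₁ hK₂ hR hlR hrR
  obtain ⟨x₀, hx₀, hx₀l⟩ := hpre
  have hpre' : ∀ x ∈ P, D.side z (s :: (Q ++ [c])) x = D.side z (s :: (Q ++ [c])) l :=
    fun x hx => (D.side_eq_of_chain hz hR h.conf.chain h.conf.sub hdis x hx x₀ hx₀).trans hx₀l
  have hr0 : D.side z (s :: (Q ++ [c])) r ≠ D.side z (s :: (Q ++ [c])) l := by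
    intro he; rw [he] at hsep; grind
  refine h.cut D hPS hAS hR hQ (Or.inr hc) (κ := D.side z (s :: (Q ++ [c])) r)
    (P₁ := P) (post := []) (ext := [r]) (r := r) (m := m) (t := r) (v := x₀) (by simp) (by simp)
    (by simp only [List.length_cons, List.length_nil]; omega) (fun _ => by
      simp only [List.length_nil]; omega) ?_ (by simp) ?_ (by simp)
    (Or.inr rfl) (fun _ => ⟨hr, hrR, rfl, hsr⟩) (h.conf.A_sub r hr) hrR rfl (h.conf.sub x₀ hx₀)
    (hdis x₀ hx₀) ?_
  · intro b hb hbr hbs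
    exact hRA b hb (by simpa using hbr) fun hbl => hr0 (hbl ▸ hbs).symm
  · intro x hx hxR
    rw [hpre' x hx]; exact hr0.symm
  · rw [hx₀l]; exact hr0.symm

end MinCE
end Centers

section Deletion
open Classical

variable {U : Type*} {G : SimpleGraph U} {z : U} {W S A : Finset U} {P : List U}

/-- Deleting several apex neighbours and joining the apex to their neighbours. -/
lemma ParityDrawing.contract_list : ∀ {L : List U} {W S : Finset U}, z ∉ W →
    ∀ _ : ParityDrawing (Apex G z W S), S ⊆ W → L.Nodup → (∀ x ∈ L, x ∈ S) →
    ∀ {W' S' : Finset U}, (∀ x ∈ W', x ∈ W ∧ x ∉ L) →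
    (∀ x ∈ S', x ∈ W' ∧ (x ∈ S ∨ ∃ v ∈ L, G.Adj v x)) →
    Nonempty (ParityDrawing (Apex G z W' S')) := by
  intro L
  induction L with
  | nil =>
    intro W S _ D _ _ _ W' S' hW' hS'
    exact ⟨D.mono (Apex.mono (fun x hx => (hW' x hx).1) fun x hx => by simpa using (hS' x hx).2)⟩
  | cons v L ih =>
    intro W S hz D hSW hnd hLS W' S' hW' hS'
    obtain ⟨hvL, hnd⟩ := List.nodup_cons.1 hnd
    obtain ⟨D'⟩ := D.contract hz hSW (hLS v (by simp))
    refine ih (fun hz' => hz (Finset.mem_of_mem_erase hz')) D' ?_ hnd ?_ ?_ ?_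
    · intro x hx
      rw [Finset.mem_erase, Finset.mem_union, Finset.mem_filter] at hx
      exact Finset.mem_erase.2 ⟨hx.1, hx.2.elim (fun hx => hSW hx) And.left⟩
    · intro x hx
      exact Finset.mem_erase.2 ⟨fun hxv => hvL (hxv ▸ hx),
        Finset.mem_union_left _ (hLS x (by simp [hx]))⟩
    · intro x hx
      have := hW' x hx
      rw [List.mem_cons, not_or] at this
      exact ⟨Finset.mem_erase.2 ⟨this.2.1, this.1⟩, this.2.2⟩
    · intro x hx
      have hxW := hW' x (hS' x hx).1
      rw [List.mem_cons, not_or] at hxW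
      refine ⟨(hS' x hx).1, ?_⟩
      simp only [Finset.mem_erase, Finset.mem_union, Finset.mem_filter]
      rcases (hS' x hx).2 with hxS | ⟨w, hw, hwx⟩
      · exact Or.inl ⟨hxW.2.1, Or.inl hxS⟩
      · rcases List.mem_cons.1 hw with rfl | hw
        · exact Or.inl ⟨hxW.2.1, Or.inr ⟨hxW.1, hwx⟩⟩
        · exact Or.inr ⟨w, hw, hwx⟩

namespace MinCE

/-- Removing a list `K` of vertices and reducing the budget of their neighbours gives a smaller
configuration, which is therefore good. -/
lemma delete (h : MinCE G z W P A) {K P' : List U} {A₀ : Finset U} (hA₀ : A₀ ⊆ A) {v₀ : U}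
    (hv₀ : v₀ ∈ K) (hv₀W : v₀ ∈ W) (hP' : P' <:+: P) (hPK : ∀ x ∈ P, x ∈ P' ∨ x ∈ K)
    (hP'K : ∀ x ∈ P', x ∉ K)
    (hdraw : ∀ W' S' : Finset U, (∀ x ∈ W', x ∈ W ∧ x ∉ K) →
      (∀ x ∈ S', x ∈ W' ∧ ((x ∈ P ∨ x ∈ A) ∨ ∃ v ∈ K, G.Adj v x)) →
      Nonempty (ParityDrawing (Apex G z W' S')))
    (hAN : ∀ a ∈ A, a ∉ K → ∀ v ∈ K, ∀ w ∈ W, w ∉ P → w ∉ K → G.Adj v w → ¬ G.Adj a w)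
    (hNN : ∀ v ∈ K, ∀ w ∈ W, w ∉ P → w ∉ K → G.Adj v w →
      ∀ v' ∈ K, ∀ w' ∈ W, w' ∉ P → w' ∉ K → G.Adj v' w' → ¬ G.Adj w w')
    (hone : ∀ v ∈ K, ∀ w ∈ W, w ∉ P → w ∉ K → G.Adj v w →
      ∀ p ∈ P', ∀ q ∈ P', G.Adj w p → G.Adj w q → p = q)
    (hhead : ∀ v ∈ K, ∀ w ∈ W, w ∉ P → w ∉ K → G.Adj v w → ∀ p ∈ P'.head?, ¬ G.Adj w p)
    (hlast : ∀ v ∈ K, ∀ w ∈ W, w ∉ P → w ∉ K → G.Adj v w → ∀ p ∈ P'.getLast?, G.Adj w p →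
      P'.length ≤ 5)
    (hAK : ∀ a ∈ A₀, a ∉ K → ∀ v ∈ K, v ∉ P → ¬ G.Adj v a)
    (hKK : ∀ w ∈ W, w ∉ P → w ∉ K → ∀ v ∈ K, ∀ v' ∈ K, G.Adj v w → G.Adj v' w → v = v') :
    WD G ((W \ P.toFinset) \ K.toFinset) (cap G A₀ (P.toFinset ∪ K.toFinset)) := by
  set A' : Finset U := ((W \ P.toFinset) \ K.toFinset).filter
    (fun t => t ∈ A ∨ ∃ v ∈ K, G.Adj v t) with hA'
  have memA' : ∀ t, t ∈ A' ↔ ((t ∈ W ∧ t ∉ P) ∧ t ∉ K) ∧ (t ∈ A ∨ ∃ v ∈ K, G.Adj v t) := by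
    intro t; simp [hA']
  have memP : ∀ x ∈ P', x ∈ P := fun x hx => hP'.subset hx
  have hconf : Conf G z (W \ K.toFinset) P' A' :=
  { z_notMem := fun hz => h.conf.z_notMem (Finset.mem_sdiff.1 hz).1
    nodup := h.conf.nodup.sublist hP'.sublist
    chain := isChain_of_infix h.conf.chain hP'
    sub := fun x hx => Finset.mem_sdiff.2 ⟨h.conf.sub x (memP x hx), by simpa using hP'K x hx⟩
    length_le := hP'.length_le.trans h.conf.length_le
    A_sub := fun t ht => by
      rw [memA'] at ht
      exact Finset.mem_sdiff.2 ⟨ht.1.1.1, by simpa using ht.1.2⟩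
    A_notMem := fun t ht htP => ((memA' t).1 ht).1.1.2 (memP t htP)
    indep := by
      intro t ht t' ht' htt
      rw [memA'] at ht ht'
      obtain ⟨⟨⟨hW, hP⟩, hK⟩, hA | ⟨v, hv, hvt⟩⟩ := ht <;>
        obtain ⟨⟨⟨hW', hP'⟩, hK'⟩, hA' | ⟨v', hv', hvt'⟩⟩ := ht'
      · exact h.conf.indep t hA t' hA' htt
      · exact hAN t hA hK v' hv' t' hW' hP' hK' hvt' htt
      · exact hAN t' hA' hK' v hv t hW hP hK hvt htt.symm
      · exact hNN v hv t hW hP hK hvt v' hv' t' hW' hP' hK' hvt' htt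
    one := by
      intro t ht p hp q hq htp htq
      obtain ⟨⟨⟨hW, hP⟩, hK⟩, hA | ⟨v, hv, hvt⟩⟩ := (memA' t).1 ht
      · exact (h.not_adj hA (memP p hp) htp).elim
      · exact hone v hv t hW hP hK hvt p hp q hq htp htq
    head := by
      intro t ht p hp htp
      obtain ⟨⟨⟨hW, hP⟩, hK⟩, hA | ⟨v, hv, hvt⟩⟩ := (memA' t).1 ht
      · exact (h.not_adj hA (memP p (List.mem_of_mem_head? hp)) htp).elim
      · exact (hhead v hv t hW hP hK hvt p hp htp).elim
    last := by
      intro t ht p hp htp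
      obtain ⟨⟨⟨hW, hP⟩, hK⟩, hA | ⟨v, hv, hvt⟩⟩ := (memA' t).1 ht
      · exact (h.not_adj hA (memP p (List.mem_of_mem_getLast? hp)) htp).elim
      · exact hlast v hv t hW hP hK hvt p hp htp
    both := by
      intro t ht p hp htp
      obtain ⟨⟨⟨hW, hP⟩, hK⟩, hA | ⟨v, hv, hvt⟩⟩ := (memA' t).1 ht
      · exact (h.not_adj hA (memP p (List.mem_of_mem_head? hp)) htp).elim
      · exact (hhead v hv t hW hP hK hvt p hp htp).elim
    drawing := by
      refine hdraw _ _ (fun x hx => by simpa using hx) fun x hx => ?_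
      simp only [Finset.mem_union, List.mem_toFinset, memA', Finset.mem_sdiff] at hx ⊢
      rcases hx with hx | ⟨⟨⟨hW, -⟩, hK⟩, hx⟩
      · exact ⟨⟨h.conf.sub x (memP x hx), hP'K x hx⟩, Or.inl (Or.inl (memP x hx))⟩
      · exact ⟨⟨hW, hK⟩, hx.imp_left Or.inr⟩ }
  have hgood := h.ih_card hconf hv₀W (by simp [hv₀]) Finset.sdiff_subset
  have hset : (W \ K.toFinset) \ P'.toFinset = (W \ P.toFinset) \ K.toFinset := by
    ext x
    have h1 := hPK x
    have h2 := memP x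
    simp only [Finset.mem_sdiff, List.mem_toFinset]
    tauto
  rw [Good, hset] at hgood
  refine hgood.mono fun t ht => ?_
  simp only [Finset.mem_sdiff, List.mem_toFinset] at ht
  obtain ⟨⟨htW, htP⟩, htK⟩ := ht
  have hsub : ∀ d ∈ P.toFinset ∪ K.toFinset, d ∈ P' ∨ d ∈ K := fun d hd => by
    rw [Finset.mem_union, List.mem_toFinset, List.mem_toFinset] at hd
    exact hd.elim (hPK d) Or.inr
  by_cases htA : t ∈ A₀
  · refine cap_le_cap (fun _ => (memA' t).2 ⟨⟨⟨htW, htP⟩, htK⟩, Or.inl (hA₀ htA)⟩)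
      fun d hd hdt => ?_
    rw [Finset.mem_union, List.mem_toFinset, List.mem_toFinset] at hd
    by_cases hdP : d ∈ P
    · exact (h.not_adj (hA₀ htA) hdP hdt.symm).elim
    · exact (hAK t htA htK d (hd.resolve_left hdP) hdP hdt).elim
  by_cases hex : ∃ v ∈ K, G.Adj v t
  · obtain ⟨v, hv, hvt⟩ := hex
    have h1 : nbrCount G (P.toFinset ∪ K.toFinset) t ≤ nbrCount G (insert v P'.toFinset) t :=
      nbrCount_le_of_forall fun d hd hdt => by
        rcases hsub d hd with hd | hd
        · exact Finset.mem_insert_of_mem (List.mem_toFinset.2 hd)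
        · exact Finset.mem_insert.2 (Or.inl (hKK t htW htP htK d hd v hv hdt hvt))
    rw [nbrCount_insert (fun hvP => hP'K v (List.mem_toFinset.1 hvP) hv), if_pos hvt] at h1
    rw [cap, cap, if_neg htA, if_pos ((memA' t).2 ⟨⟨⟨htW, htP⟩, htK⟩, Or.inr ⟨v, hv, hvt⟩⟩)]
    omega
  · refine cap_le_cap (fun htA' => (htA htA').elim) fun d hd hdt => ?_
    exact List.mem_toFinset.2 ((hsub d hd).resolve_right fun hd => hex ⟨d, hd, hdt⟩)

end MinCE
end Deletion

section FirstFan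
open Classical

variable {U : Type*} {G : SimpleGraph U} {z : U} {W S A : Finset U} {P P' : List U} {p₀ u a : U}

namespace MinCE

lemma eq_of_length_le_three (h : MinCE G z W P A) {L : List U} {t : U} (hc : L.IsChain G.Adj)
    (hnd : L.Nodup) (hL : L.length ≤ 3) (ht : t ∉ L) :
    ∀ p ∈ L, ∀ q ∈ L, G.Adj t p → G.Adj t q → p = q := by
  have key : ∀ p ∈ L, G.Adj t p → ∃ l r, L = l ++ p :: r ∧ (∀ y ∈ l, ¬ G.Adj t y) ∧
      ∀ y ∈ r, ¬ G.Adj t y := by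
    intro p hp htp
    obtain ⟨l, r, rfl⟩ := List.append_of_mem hp
    simp only [List.length_append, List.length_cons] at hL
    refine ⟨l, r, rfl, ?_, ?_⟩
    · have hrev : ((l ++ p :: r).reverse) = r.reverse ++ p :: l.reverse := by simp
      have hc' : (r.reverse ++ p :: l.reverse).IsChain G.Adj := by
        rw [← hrev, List.isChain_reverse]
        exact hc.imp fun a b => G.adj_symm
      have hnd' : (r.reverse ++ p :: l.reverse).Nodup := hrev ▸ List.nodup_reverse.2 hnd
      have := h.not_adj_of_length_le_two (List.isChain_append.1 hc').2.1
        (List.nodup_append.1 hnd').2.1 (by simp; omega)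
        (fun hm => ht (by simp at hm; simp [hm])) htp
      simpa using this
    · exact h.not_adj_of_length_le_two (List.isChain_append.1 hc).2.1
        (List.nodup_append.1 hnd).2.1 (by omega) (fun hm => ht (by simp [hm])) htp
  intro p hp q hq htp htq
  obtain ⟨l, r, rfl, hl, hr⟩ := key p hp htp
  simp only [List.mem_append, List.mem_cons] at hq
  rcases hq with hq | rfl | hq
  exacts [(hl q hq htq).elim, rfl, (hr q hq htq).elim]

lemma eq_of_adj_head (h : MinCE G z W P A) {c t : U} {L : List U}
    (hc : (c :: L).IsChain G.Adj) (hnd : (c :: L).Nodup) (hL : L.length ≤ 5) (ht : t ∉ L)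
    (htc : G.Adj t c) : ∀ p ∈ L, ∀ q ∈ L, G.Adj t p → G.Adj t q → p = q := by
  intro p hp q hq htp htq
  have hsplit : ∀ x ∈ L, G.Adj t x → x ∈ L.drop 2 := by
    intro x hx htx
    rw [← List.take_append_drop 2 L, List.mem_append] at hx
    refine hx.resolve_left fun hx => ?_
    have hpre : (c :: L.take 2) <+: c :: L := ⟨L.drop 2, by simp⟩
    exact h.not_adj_of_length_le_two (isChain_of_infix hc hpre.isInfix)
      (hnd.sublist hpre.sublist) (by simp)
      (fun hm => ht (List.mem_of_mem_take hm)) htc x hx htx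
  have hsuf : L.drop 2 <:+ c :: L := (List.drop_suffix 2 L).trans (List.suffix_cons c L)
  exact h.eq_of_length_le_three (hc.suffix hsuf) (hnd.sublist hsuf.sublist)
    (by rw [List.length_drop]; omega) (fun hm => ht (List.mem_of_mem_drop hm)) p (hsplit p hp htp)
    q (hsplit q hq htq) htp htq

/-- Some neighbour of the first vertex of `P` has a neighbour in `A`. -/
lemma exists_adj_adj (h : MinCE G z W (p₀ :: P') A) :
    ∃ u ∈ W, u ∉ p₀ :: P' ∧ G.Adj p₀ u ∧ ∃ a ∈ A, G.Adj u a := by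
  by_contra hcon
  push Not at hcon
  obtain ⟨D⟩ := h.conf.drawing
  have hp₀ : p₀ ∈ W := h.conf.sub p₀ (by simp)
  have hnd := List.nodup_cons.1 h.conf.nodup
  have hlen := h.conf.length_le
  rw [List.length_cons] at hlen
  have hSW : (p₀ :: P').toFinset ∪ A ⊆ W := fun x hx => by
    rcases Finset.mem_union.1 hx with hx | hx
    exacts [h.conf.sub x (List.mem_toFinset.1 hx), h.conf.A_sub x hx]
  have hg := h.delete (K := [p₀]) (P' := P') (A₀ := A) subset_rfl (v₀ := p₀) (by simp) hp₀
    (List.suffix_cons p₀ P').isInfix (by simp; tauto)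
    (fun x hx hx' => hnd.1 (List.mem_singleton.1 hx' ▸ hx)) ?_ ?_ ?_ ?_ ?_ ?_ ?_ ?_
  · refine h.bad ?_
    have h1 : (W \ (p₀ :: P').toFinset) \ [p₀].toFinset = W \ (p₀ :: P').toFinset := by
      ext x; simp; tauto
    have h2 : (p₀ :: P').toFinset ∪ [p₀].toFinset = (p₀ :: P').toFinset := by
      ext x; simp
    rwa [h1, h2] at hg
  · intro W' S' hW' hS'
    refine ParityDrawing.contract_list h.conf.z_notMem D hSW (by simp) (by simp) hW'
      fun x hx => ?_
    have := hS' x hx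
    simpa only [Finset.mem_union, List.mem_toFinset] using this
  all_goals simp only [List.mem_singleton, forall_eq]
  · exact fun a ha _ w hw hwP _ hp₀w haw => hcon w hw hwP hp₀w a ha haw.symm
  · exact fun w _ _ _ hw w' _ _ _ hw' hww' => h.tri hw hww' hw'
  · exact fun w _ hwP _ hw p hp q hq hwp hwq => h.eq_of_adj_head h.conf.chain h.conf.nodup
      (by omega) (fun hm => hwP (by simp [hm])) hw.symm p hp q hq hwp hwq
  · intro w _ _ _ hw p hp hwp
    have := (List.isChain_cons.1 h.conf.chain).1 p hp
    exact h.tri this hwp.symm hw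
  · exact fun _ _ _ _ _ _ _ _ => by omega
  · exact fun a _ _ hp₀ => (hp₀ (by simp)).elim
  · exact fun _ _ _ _ _ _ => trivial

end MinCE

/-- A minimal counterexample together with a path `p₀ u a` on its outer face. -/
structure Fan (D : ParityDrawing (Apex G z W S)) (p₀ : U) (P' : List U) (A : Finset U)
    (u a : U) : Prop where
  min : MinCE G z W (p₀ :: P') A
  four : 4 ≤ P'.length
  sub : S ⊆ W
  PS : ∀ x ∈ p₀ :: P', x ∈ S
  AS : A ⊆ S
  uS : u ∈ S
  uP : u ∉ p₀ :: P'
  uA : u ∉ A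
  aA : a ∈ A
  pu : G.Adj p₀ u
  ua : G.Adj u a
  cpu : D.ConstSide [p₀, u]
  cua : D.ConstSide [u, a]

lemma MinCE.exists_fan (h : MinCE G z W (p₀ :: P') A) :
    ∃ (u a : U) (S : Finset U) (D : ParityDrawing (Apex G z W S)), Fan D p₀ P' A u a := by
  obtain ⟨u, huW, huP, hpu, a, ha, hua⟩ := h.exists_adj_adj
  obtain ⟨D⟩ := h.conf.drawing
  have hz := h.conf.z_notMem
  have hnd := List.nodup_cons.1 h.conf.nodup
  have hlen := h.conf.length_le
  rw [List.length_cons] at hlen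
  have haP := h.conf.A_notMem a ha
  have huA : u ∉ A := fun huA => h.conf.indep u huA a ha hua
  have hSW : (p₀ :: P').toFinset ∪ A ⊆ W := fun x hx => by
    rcases Finset.mem_union.1 hx with hx | hx
    exacts [h.conf.sub x (List.mem_toFinset.1 hx), h.conf.A_sub x hx]
  have hpa : ¬ G.Adj p₀ a := fun hpa => h.not_adj ha (by simp) hpa.symm
  have hR : SPath G W ((p₀ :: P').toFinset ∪ A) ([p₀] ++ u :: [a]) :=
    { ne_nil := by simp
      chain := by simp [hpu, hua]
      nodup := by
        have h1 : p₀ ≠ a := fun he => haP (by simp [he])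
        have h2 : p₀ ≠ u := hpu.ne
        have h3 : u ≠ a := hua.ne
        simp [h1, h2, h3]
      mem := by
        have := h.conf.sub p₀ (by simp)
        have := h.conf.A_sub a ha
        simp [*]
      head := by simp
      last := by simp [ha] }
  have hc : D.ConstSide ([p₀] ++ u :: [a]) := by
    refine h.constSide_of_forall D Finset.subset_union_right hR (by simp) ?_
    have key := D.side_eq_of_chain hz hR (L := P') (List.isChain_cons.1 h.conf.chain).2
      (fun x hx => h.conf.sub x (by simp [hx])) (by
        intro x hx hxR
        simp only [List.mem_append, List.mem_cons, List.not_mem_nil, or_false] at hxR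
        rcases hxR with rfl | rfl | rfl
        exacts [hnd.1 hx, huP (by simp [hx]), haP (by simp [hx])])
    intro p hp hpR q hq hqR
    refine key p ((List.mem_cons.1 hp).resolve_left fun he => hpR (by simp [he])) q
      ((List.mem_cons.1 hq).resolve_left fun he => hqR (by simp [he]))
  obtain ⟨D', h1, h2, -⟩ := D.exists_add_edge hz hR (by simpa using hpa) (by simp) (by simp) hc
  refine ⟨u, a, _, D', h, ?_, Finset.insert_subset huW hSW, fun x hx => by
    simp only [Finset.mem_insert, Finset.mem_union, List.mem_toFinset]; tauto,
    fun x hx => by simp [hx], by simp, huP, huA, ha, hpu, hua, h1, h2⟩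
  by_contra hlt
  have hup : ∀ x ∈ p₀ :: P', ∀ y ∈ p₀ :: P', G.Adj x u → G.Adj y u → x ≠ p₀ → y ≠ p₀ → x = y := by
    intro x hx y hy hxu hyu hxp hyp
    exact h.eq_of_adj_head h.conf.chain h.conf.nodup (by omega) (fun hm => huP (by simp [hm]))
      hpu.symm x ((List.mem_cons.1 hx).resolve_left hxp) y ((List.mem_cons.1 hy).resolve_left hyp)
      hxu.symm hyu.symm
  have hg : Good G W (a :: u :: p₀ :: P') (A.erase a) := by
    refine h.ih_cons ?_ (by simp)
    have hb1 : ∀ b ∈ A.erase a, ∀ x ∈ a :: u :: p₀ :: P', G.Adj b x → x = u := by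
      intro b hb x hx hbx
      have hbA := Finset.mem_of_mem_erase hb
      rcases List.mem_cons.1 hx with rfl | hx
      · exact (h.conf.indep b hbA x ha hbx).elim
      rcases List.mem_cons.1 hx with rfl | hx
      exacts [rfl, (h.not_adj hbA hx hbx).elim]
    exact
    { z_notMem := hz
      nodup := List.nodup_cons.2 ⟨fun hm => (List.mem_cons.1 hm).elim (fun he => hua.ne he.symm)
        haP, List.nodup_cons.2 ⟨huP, h.conf.nodup⟩⟩
      chain := by
        have := h.conf.chain
        simp only [List.isChain_cons_cons]
        exact ⟨hua.symm, hpu.symm, this⟩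
      sub := by
        intro x hx
        rcases List.mem_cons.1 hx with rfl | hx
        · exact h.conf.A_sub x ha
        rcases List.mem_cons.1 hx with rfl | hx
        exacts [huW, h.conf.sub x hx]
      length_le := by simp only [List.length_cons]; omega
      A_sub := fun b hb => h.conf.A_sub b (Finset.mem_of_mem_erase hb)
      A_notMem := by
        intro b hb hm
        have hbA := Finset.mem_of_mem_erase hb
        rcases List.mem_cons.1 hm with rfl | hm
        · simp at hb
        rcases List.mem_cons.1 hm with rfl | hm
        exacts [huA hbA, h.conf.A_notMem b hbA hm]
      indep := fun b hb c hc => h.conf.indep b (Finset.mem_of_mem_erase hb) c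
        (Finset.mem_of_mem_erase hc)
      one := fun b hb p hp q hq hbp hbq => (hb1 b hb p hp hbp).trans (hb1 b hb q hq hbq).symm
      head := by
        intro b hb p hp hbp
        have : p = a := by simpa [eq_comm] using hp
        exact (hua.ne ((hb1 b hb p (by simp [this]) hbp).symm.trans this)).elim
      last := by
        intro b hb p hp hbp
        have hpP : p ∈ p₀ :: P' := by
          rw [List.getLast?_cons_cons, List.getLast?_cons_cons] at hp
          exact List.mem_of_mem_getLast? hp
        exact (h.not_adj (Finset.mem_of_mem_erase hb) hpP hbp).elim
      both := by
        intro b hb p hp hbp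
        have : p = a := by simpa [eq_comm] using hp
        exact (hua.ne ((hb1 b hb p (by simp [this]) hbp).symm.trans this)).elim
      drawing := by
        refine ⟨D'.mono (Apex.mono subset_rfl fun x hx => ?_)⟩
        simp only [Finset.mem_insert, Finset.mem_union, List.mem_toFinset, Finset.mem_erase,
          List.mem_cons] at hx ⊢
        rcases hx with (rfl | hx | hx | hx) | hx
        exacts [Or.inr (Or.inr ha), Or.inl hx, Or.inr (Or.inl (Or.inl hx)),
          Or.inr (Or.inl (Or.inr hx)), Or.inr (Or.inr hx.2)] }
  refine h.bad ?_
  refine WD.delete_cap (u := u) (by simp only [Finset.mem_sdiff, List.mem_toFinset]; tauto)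
    (by simpa using huP) ?_ ?_
  · have : nbrCount G (p₀ :: P').toFinset u ≤ 2 := by
      have h3 : nbrCount G ((p₀ :: P').toFinset.erase p₀) u ≤ 1 := nbrCount_le_one (by
        intro x hx y hy hxu hyu
        rw [Finset.mem_erase, List.mem_toFinset] at hx hy
        exact hup x hx.2 y hy.2 hxu hyu hx.1 hy.1)
      have h4 := nbrCount_insert (G := G) (t := u)
        (Finset.notMem_erase p₀ (p₀ :: P').toFinset)
      rw [Finset.insert_erase (by simp), if_pos hpu] at h4
      omega
    rw [cap, if_neg huA]; omega
  refine WD.delete_cap (u := a) ?_ ?_ ?_ ?_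
  · simp only [Finset.mem_erase, Finset.mem_sdiff, List.mem_toFinset]
    exact ⟨hua.ne.symm, h.conf.A_sub a ha, haP⟩
  · simp only [Finset.mem_insert, List.mem_toFinset, not_or]
    exact ⟨hua.ne.symm, haP⟩
  · have : nbrCount G (insert u (p₀ :: P').toFinset) a ≤ 1 := nbrCount_le_one (by
      intro x hx y hy hxa hya
      have key : ∀ x ∈ insert u (p₀ :: P').toFinset, G.Adj x a → x = u := fun x hx hxa =>
        (Finset.mem_insert.1 hx).resolve_right fun hx =>
          h.not_adj ha (List.mem_toFinset.1 hx) hxa.symm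
      rw [key x hx hxa, key y hy hya])
    rw [cap, if_pos ha]; omega
  have hX : ((W \ (p₀ :: P').toFinset).erase u).erase a = W \ (a :: u :: p₀ :: P').toFinset := by
    ext x; simp; tauto
  rw [hX]
  refine hg.mono fun t ht => cap_le_cap (fun htA => Finset.mem_erase.2 ⟨?_, htA⟩) fun d hd _ => ?_
  · rintro rfl
    simp at ht
  · simp only [Finset.mem_insert, List.mem_toFinset, List.mem_cons] at hd ⊢
    exact hd

end FirstFan

section Center
open Classical

variable {U : Type*} {G : SimpleGraph U} {z : U} {W S A : Finset U} {P T : List U}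
  {p₀ s l r : U}

namespace MinCE

lemma not_adj_of_adj_near_last (h : MinCE G z W P A) {a w c : U} {pre post : List U} (ha : a ∈ A)
    (hw : w ∈ W) (hwP : w ∉ P) (haw : G.Adj a w) (hP : P = pre ++ c :: post) (hpre : pre ≠ [])
    (hpost : post ≠ []) (hlen : post.length ≤ 2) : ¬ G.Adj w c := by
  intro hwc
  obtain ⟨D⟩ := h.conf.drawing
  have hz := h.conf.z_notMem
  have haP := h.conf.A_notMem a ha
  have hcP : c ∈ P := by simp [hP]
  have hnd := h.conf.nodup
  have hch := h.conf.chain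
  rw [hP] at hnd hch
  have hcpp : ∀ x ∈ pre ++ post, x ≠ c := by
    rw [List.nodup_append, List.nodup_cons] at hnd
    intro x hx
    rcases List.mem_append.1 hx with hx | hx
    · exact hnd.2.2 x hx c (by simp)
    · exact fun hxc => hnd.2.1.1 (hxc ▸ hx)
  have hSW : P.toFinset ∪ A ⊆ W := fun x hx => by
    rcases Finset.mem_union.1 hx with hx | hx
    exacts [h.conf.sub x (List.mem_toFinset.1 hx), h.conf.A_sub x hx]
  have hPS : ∀ x ∈ P, x ∈ P.toFinset ∪ A := fun x hx => by simp [hx]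
  have hAS : A ⊆ P.toFinset ∪ A := Finset.subset_union_right
  have hR : SPath G W (P.toFinset ∪ A) (a :: ([w] ++ [c])) :=
    { ne_nil := by simp
      chain := by simp [haw, hwc]
      nodup := by
        have h1 : a ≠ c := fun he => haP (he ▸ hcP)
        simp [haw.ne, h1, hwc.ne]
      mem := by
        have := h.conf.A_sub a ha
        have := h.conf.sub c hcP
        simp [*]
      head := by simp [ha]
      last := by simp [hcP] }
  have hdis : ∀ x ∈ pre ++ post, x ∉ a :: ([w] ++ [c]) := by
    intro x hx hxR
    have hxP : x ∈ P := by
      rw [hP]; simp only [List.mem_append, List.mem_cons] at hx ⊢; tauto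
    simp only [List.cons_append, List.nil_append, List.mem_cons, List.not_mem_nil, or_false] at hxR
    rcases hxR with rfl | rfl | rfl
    exacts [haP hxP, hwP hxP, hcpp x hx rfl]
  have hrev : (a :: ([w] ++ [c])).reverse = c :: ([w] ++ [a]) := by simp
  have hsep := D.side_ne_of_chain hz hSW (Q := [w]) (k := a) hP h.conf.chain h.conf.nodup hPS
    (h.constSide_edge D hPS hAS) (hrev ▸ hR.reverse)
    (fun x hx hxR => hdis x hx (List.mem_reverse.1 (hrev ▸ hxR)))
  simp only [← hrev, D.side_reverse] at hsep
  obtain ⟨x₀, hx₀⟩ := List.exists_mem_of_ne_nil _ hpre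
  obtain ⟨y₀, hy₀⟩ := List.exists_mem_of_ne_nil _ hpost
  refine h.cut D hPS hAS hR (by simp) (Or.inl hcP) (κ := D.side z (a :: ([w] ++ [c])) y₀)
    (P₁ := pre ++ [c]) (post := post) (ext := []) (r := a) (m := w) (t := y₀) (v := x₀)
    (by simp [hP]) ?_ (by simp only [List.length_cons, List.length_nil]; omega)
    (fun he => (haw.ne he.symm).elim) ?_ ?_ ?_ ?_ (Or.inl rfl) (by simp)
    (h.conf.sub y₀ (by simp [hP, hy₀])) (hdis y₀ (by simp [hy₀])) rfl
    (h.conf.sub x₀ (by simp [hP, hx₀])) (hdis x₀ (by simp [hx₀])) ?_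
  · rw [List.isChain_append, List.isChain_cons] at hch
    exact hch.2.1.1
  · intro b hb _ _ x hx hxw hbx
    simp only [List.mem_cons, List.not_mem_nil, or_false] at hx
    exact h.conf.indep b hb a ha (hx.resolve_right hxw ▸ hbx)
  · intro x hx
    refine ⟨hdis x (by simp [hx]), ?_⟩
    have h1 := hsep x₀ hx₀ x hx
    have h2 := hsep x₀ hx₀ y₀ hy₀
    grind
  · intro x hx hxR he
    rcases List.mem_append.1 hx with hx | hx
    · have h1 := hsep x hx y₀ hy₀
      rw [he] at h1
      grind
    · exact hxR (by simp at hx; simp [hx])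
  · intro x hx y hy hyx
    simp only [List.mem_cons, List.not_mem_nil, or_false] at hx
    rcases hx with rfl | rfl
    · exact h.not_adj ha (by simp [hP, hy]) hyx.symm
    · exact h.not_adj_of_length_le_two (List.isChain_append.1 hch).2.1
        (List.nodup_append.1 hnd).2.1 hlen (fun hm => hwP (by simp [hP, hm])) hwc y hy hyx.symm
  · intro he
    have h2 := hsep x₀ hx₀ y₀ hy₀
    rw [he] at h2
    grind

/-- A neighbour of a vertex of `A` has no neighbour in the interior of `P`. -/
lemma not_adj_of_adj (h : MinCE G z W P A) {a w c : U} {pre post : List U} (ha : a ∈ A)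
    (hw : w ∈ W) (hwP : w ∉ P) (haw : G.Adj a w) (hP : P = pre ++ c :: post) (hpre : pre ≠ [])
    (hpost : post ≠ []) : ¬ G.Adj w c := by
  by_cases hlen : post.length ≤ 2
  · exact h.not_adj_of_adj_near_last ha hw hwP haw hP hpre hpost hlen
  · have := h.conf.length_le
    simp only [hP, List.length_append, List.length_cons] at this
    exact h.reverse.not_adj_of_adj_near_last ha hw (by simpa using hwP) haw
      (pre := post.reverse) (post := pre.reverse) (by simp [hP]) (by simpa using hpost)
      (by simpa using hpre) (by rw [List.length_reverse]; omega)

end MinCE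

/-- An apex neighbour `s` with consecutive apex neighbours `l` and `r ∈ A`, where `l` is joined
to the first vertex `p₀` of `P` by a path `T`. -/
structure Center (D : ParityDrawing (Apex G z W S)) (P : List U) (A : Finset U) (p₀ s l r : U)
    (T : List U) : Prop where
  min : MinCE G z W P A
  sub : S ⊆ W
  PS : ∀ x ∈ P, x ∈ S
  AS : A ⊆ S
  sS : s ∈ S
  sP : s ∉ P
  sA : s ∉ A
  lS : l ∈ S
  rA : r ∈ A
  sl : G.Adj s l
  sr : G.Adj s r
  lr : l ≠ r
  cl : D.ConstSide [s, l]
  cr : D.ConstSide [s, r]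
  chain : T.IsChain G.Adj
  T_sub : ∀ x ∈ T, x ∈ W
  lT : l ∈ T
  sT : s ∉ T
  TA : ∀ b ∈ A, b ∈ T → b = l
  p₀T : p₀ ∈ T
  head : p₀ ∈ P.head?

namespace Center

variable {D : ParityDrawing (Apex G z W S)} {c m x g : U} {Q pre post : List U}

lemma path_false (C : Center D P A p₀ s l r T) (hch : (s :: (Q ++ [c])).IsChain G.Adj)
    (hnd : (s :: (Q ++ [c])).Nodup) (hQ : Q.length ≤ 2)
    (hQW : ∀ x ∈ Q, x ∈ W ∧ x ∉ T ∧ x ∉ P ∧ x ≠ r) (hcT : c ∉ T) (hP : P = pre ++ c :: post)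
    (hlen : Q.length + post.length ≤ 3)
    (hRA : ∀ b ∈ A, b ≠ r → b ≠ l → ∀ x ∈ s :: Q, x ≠ m → ¬ G.Adj b x)
    (hNR : ∀ x ∈ s :: Q, ∀ y ∈ post, ¬ G.Adj y x) : False := by
  have h := C.min
  have hcP : c ∈ P := by simp [hP]
  have hmem : ∀ x, x ∈ s :: (Q ++ [c]) → x = s ∨ x ∈ Q ∨ x = c := by simp
  have hR : SPath G W S (s :: (Q ++ [c])) :=
    { ne_nil := by simp
      chain := hch
      nodup := hnd
      mem := by
        intro x hx
        rcases hmem x hx with rfl | hx | rfl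
        exacts [C.sub C.sS, (hQW x hx).1, h.conf.sub x hcP]
      head := by simpa using C.sS
      last := by
        rw [← List.cons_append, List.getLast?_concat]; simpa using C.PS c hcP }
  have hTR : ∀ x ∈ T, x ∉ s :: (Q ++ [c]) := by
    intro x hx hxR
    rcases hmem x hxR with rfl | hx' | rfl
    exacts [C.sT hx, (hQW x hx').2.1 hx, hcT hx]
  refine h.center_path_false D C.sub C.PS C.AS C.lS C.rA C.sl C.sr C.lr C.cl C.cr hR hQ
    (hTR l C.lT) ?_ hP ?_ ?_ hlen hRA hNR
  · intro hrR
    rcases hmem r hrR with he | hx' | he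
    exacts [C.sr.ne he.symm, (hQW r hx').2.2.2 rfl, h.conf.A_notMem r C.rA (he ▸ hcP)]
  · intro x hx hxR
    have hxP : x ∈ P := by
      rw [hP]; simp only [List.mem_append, List.mem_cons] at hx ⊢; tauto
    rcases hmem x hxR with rfl | hx' | rfl
    · exact C.sP hxP
    · exact (hQW x hx').2.2.1 hxP
    · have hndP := h.conf.nodup
      rw [hP, List.nodup_append, List.nodup_cons] at hndP
      rcases List.mem_append.1 hx with hx | hx
      · exact hndP.2.2 x hx x (by simp) rfl
      · exact hndP.2.1.1 hx
  · have hhead := C.head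
    refine ⟨p₀, ?_, D.side_eq_of_chain h.conf.z_notMem hR C.chain C.T_sub hTR p₀ C.p₀T l C.lT⟩
    cases pre with
    | nil =>
      rw [hP] at hhead
      simp only [List.nil_append, List.head?_cons, Option.mem_def, Option.some.injEq] at hhead
      exact (hcT (hhead ▸ C.p₀T)).elim
    | cons q pre =>
      rw [hP] at hhead
      simp only [List.cons_append, List.head?_cons, Option.mem_def, Option.some.injEq] at hhead
      simp [hhead]

lemma mem_false (C : Center D P A p₀ s l r T) (hch : (s :: (Q ++ [c])).IsChain G.Adj)
    (hnd : (s :: (Q ++ [c])).Nodup) (hQ : Q.length ≤ 2)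
    (hQW : ∀ x ∈ Q, x ∈ W ∧ x ∉ T ∧ x ∉ P ∧ x ≠ r) (hc : c ∈ A) (hcl : c ≠ l) (hcr : c ≠ r)
    (hRA : ∀ b ∈ A, b ≠ r → b ≠ l → ∀ x ∈ s :: Q, x ≠ m → ¬ G.Adj b x) : False := by
  have h := C.min
  have hmem : ∀ x, x ∈ s :: (Q ++ [c]) → x = s ∨ x ∈ Q ∨ x = c := by simp
  have hR : SPath G W S (s :: (Q ++ [c])) :=
    { ne_nil := by simp
      chain := hch
      nodup := hnd
      mem := by
        intro x hx
        rcases hmem x hx with rfl | hx | rfl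
        exacts [C.sub C.sS, (hQW x hx).1, h.conf.A_sub x hc]
      head := by simpa using C.sS
      last := by
        rw [← List.cons_append, List.getLast?_concat]; simpa using C.AS hc }
  have hTR : ∀ x ∈ T, x ∉ s :: (Q ++ [c]) := by
    intro x hx hxR
    rcases hmem x hxR with rfl | hx' | rfl
    exacts [C.sT hx, (hQW x hx').2.1 hx, hcl (C.TA x hc hx)]
  refine h.center_mem_false D C.sub C.PS C.AS C.lS C.rA C.sl C.sr C.lr C.cl C.cr hR hQ
    (hTR l C.lT) ?_ hc ?_ ⟨p₀, List.mem_of_mem_head? C.head,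
      D.side_eq_of_chain h.conf.z_notMem hR C.chain C.T_sub hTR p₀ C.p₀T l C.lT⟩ hRA
  · intro hrR
    rcases hmem r hrR with he | hx' | he
    exacts [C.sr.ne he.symm, (hQW r hx').2.2.2 rfl, hcr he.symm]
  · intro x hxP hxR
    rcases hmem x hxR with rfl | hx' | rfl
    exacts [C.sP hxP, (hQW x hx').2.2.1 hxP, h.conf.A_notMem x hc hxP]

lemma not_adj_mem (C : Center D P A p₀ s l r T) (hc : c ∈ A) (hcl : c ≠ l) (hcr : c ≠ r) :
    ¬ G.Adj s c := fun hsc =>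
  C.mem_false (Q := []) (m := s) (by simpa using hsc) (by simpa using hsc.ne) (by simp) (by simp)
    hc hcl hcr (by simp)

lemma not_adj_path (C : Center D P A p₀ s l r T) (hP : P = pre ++ c :: post)
    (hlen : post.length ≤ 2) (hcT : c ∉ T) : ¬ G.Adj s c := by
  intro hsc
  have hndP := C.min.conf.nodup
  have hchP := C.min.conf.chain
  rw [hP] at hndP hchP
  refine C.path_false (Q := []) (m := s) (by simpa using hsc) (by simpa using hsc.ne) (by simp)
    (by simp) hcT hP (by simp only [List.length_nil]; omega) (by simp) ?_
  simp only [List.mem_singleton, forall_eq]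
  exact fun y hy hys => C.min.not_adj_of_length_le_two (List.isChain_append.1 hchP).2.1
    (List.nodup_append.1 hndP).2.1 hlen (fun hm => C.sP (by simp [hP, hm])) hsc y hy hys.symm

lemma not_adj_mem₂ (C : Center D P A p₀ s l r T) (hx : x ∈ W) (hxT : x ∉ T) (hxP : x ∉ P)
    (hxr : x ≠ r) (hsx : G.Adj s x) (hc : c ∈ A) (hcl : c ≠ l) (hcr : c ≠ r) :
    ¬ G.Adj x c := by
  intro hxc
  have hsc : s ≠ c := fun he => C.sA (he ▸ hc)
  refine C.mem_false (Q := [x]) (m := x) (by simp [hsx, hxc]) (by simp [hsx.ne, hxc.ne, hsc])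
    (by simp) (by simp [hx, hxT, hxP, hxr]) hc hcl hcr ?_
  simp only [List.mem_cons, List.not_mem_nil, or_false]
  rintro b hb hbr hbl y (rfl | rfl) hyx hby
  exacts [C.not_adj_mem hb hbl hbr hby.symm, hyx rfl]

/-- The vertices following `c` in `P` also avoid `T`. -/
lemma notMem_of_mem_post (C : Center D P A p₀ s l r T) (hTP : ∀ q ∈ P, q ∈ T → q = p₀)
    (hP : P = pre ++ c :: post) {y : U} (hy : y ∈ post) : y ∉ T := by
  intro hyT
  have hyp := hTP y (by simp [hP, hy]) hyT
  have hhead := C.head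
  have hnd := C.min.conf.nodup
  rw [hP] at hhead hnd
  rw [List.nodup_append, List.nodup_cons] at hnd
  cases pre with
  | nil =>
    simp only [List.nil_append, List.head?_cons, Option.mem_def, Option.some.injEq] at hhead
    exact hnd.2.1.1 (hhead.trans hyp.symm ▸ hy)
  | cons q pre =>
    simp only [List.cons_append, List.head?_cons, Option.mem_def, Option.some.injEq] at hhead
    exact hnd.2.2 q (by simp) y (by simp [hy]) (hhead.trans hyp.symm)

lemma not_adj_path_post (C : Center D P A p₀ s l r T) (hTP : ∀ q ∈ P, q ∈ T → q = p₀)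
    (hP : P = pre ++ c :: post) (hlen : post.length ≤ 2) : ∀ y ∈ post, ¬ G.Adj y s := by
  intro y hy hys
  obtain ⟨l₁, l₂, rfl⟩ := List.append_of_mem hy
  simp only [List.length_append, List.length_cons] at hlen
  exact C.not_adj_path (pre := pre ++ c :: l₁) (post := l₂) (by simp [hP]) (by omega)
    (C.notMem_of_mem_post hTP hP hy) hys.symm

lemma not_adj_path₂ (C : Center D P A p₀ s l r T) (hTP : ∀ q ∈ P, q ∈ T → q = p₀) (hx : x ∈ W)
    (hxT : x ∉ T) (hxP : x ∉ P) (hxr : x ≠ r) (hsx : G.Adj s x) (hP : P = pre ++ c :: post)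
    (hlen : post.length ≤ 2) (hcT : c ∉ T) : ¬ G.Adj x c := by
  intro hxc
  have hndP := C.min.conf.nodup
  have hchP := C.min.conf.chain
  rw [hP] at hndP hchP
  have hsc : s ≠ c := fun he => C.sP (by simp [hP, he])
  refine C.path_false (Q := [x]) (m := x) (by simp [hsx, hxc]) (by simp [hsx.ne, hxc.ne, hsc])
    (by simp) (by simp [hx, hxT, hxP, hxr]) hcT hP
    (by simp only [List.length_cons, List.length_nil]; omega) ?_ ?_
  · simp only [List.mem_cons, List.not_mem_nil, or_false]
    rintro b hb hbr hbl y (rfl | rfl) hyx hby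
    exacts [C.not_adj_mem hb hbl hbr hby.symm, hyx rfl]
  · simp only [List.mem_cons, List.not_mem_nil, or_false]
    rintro w (rfl | rfl) y hy hyw
    · exact C.not_adj_path_post hTP hP hlen y hy hyw
    · exact C.min.not_adj_of_length_le_two (List.isChain_append.1 hchP).2.1
        (List.nodup_append.1 hndP).2.1 hlen (fun hm => hxP (by simp [hP, hm])) hxc y hy hyw.symm

lemma not_adj_mem₃ (C : Center D P A p₀ s l r T) (hx : x ∈ W) (hxT : x ∉ T) (hxP : x ∉ P)
    (hxr : x ≠ r) (hsx : G.Adj s x) (hg : g ∈ W) (hgT : g ∉ T) (hgP : g ∉ P) (hgr : g ≠ r)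
    (hgs : g ≠ s) (hxA : x ∉ A) (hxg : G.Adj x g) (hc : c ∈ A) (hcl : c ≠ l) (hcr : c ≠ r) :
    ¬ G.Adj g c := by
  intro hgc
  have hsc : s ≠ c := fun he => C.sA (he ▸ hc)
  have hxc : x ≠ c := fun he => hxA (he ▸ hc)
  refine C.mem_false (Q := [x, g]) (m := g) (by simp [hsx, hxg, hgc])
    (by simp [hsx.ne, hxg.ne, hgc.ne, hsc, hxc, hgs.symm]) (by simp)
    (by simp [hx, hxT, hxP, hxr, hg, hgT, hgP, hgr]) hc hcl hcr ?_
  simp only [List.mem_cons, List.not_mem_nil, or_false]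
  rintro b hb hbr hbl y (rfl | rfl | rfl) hyx hby
  exacts [C.not_adj_mem hb hbl hbr hby.symm, C.not_adj_mem₂ hx hxT hxP hxr hsx hb hbl hbr hby.symm,
    hyx rfl]

lemma not_adj_path₃ (C : Center D P A p₀ s l r T) (hTP : ∀ q ∈ P, q ∈ T → q = p₀) (hx : x ∈ W)
    (hxT : x ∉ T) (hxP : x ∉ P) (hxr : x ≠ r) (hsx : G.Adj s x) (hg : g ∈ W) (hgT : g ∉ T)
    (hgP : g ∉ P) (hgr : g ≠ r) (hgs : g ≠ s) (hxg : G.Adj x g) (hP : P = pre ++ c :: post)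
    (hlen : post.length ≤ 1) (hcT : c ∉ T) : ¬ G.Adj g c := by
  intro hgc
  have hndP := C.min.conf.nodup
  have hchP := C.min.conf.chain
  rw [hP] at hndP hchP
  have hsc : s ≠ c := fun he => C.sP (by simp [hP, he])
  have hxc : x ≠ c := fun he => hxP (by simp [hP, he])
  refine C.path_false (Q := [x, g]) (m := g) (by simp [hsx, hxg, hgc])
    (by simp [hsx.ne, hxg.ne, hgc.ne, hsc, hxc, hgs.symm]) (by simp)
    (by simp [hx, hxT, hxP, hxr, hg, hgT, hgP, hgr]) hcT hP
    (by simp only [List.length_cons, List.length_nil]; omega) ?_ ?_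
  · simp only [List.mem_cons, List.not_mem_nil, or_false]
    rintro b hb hbr hbl y (rfl | rfl | rfl) hyx hby
    exacts [C.not_adj_mem hb hbl hbr hby.symm,
      C.not_adj_mem₂ hx hxT hxP hxr hsx hb hbl hbr hby.symm, hyx rfl]
  · simp only [List.mem_cons, List.not_mem_nil, or_false]
    rintro w (rfl | rfl | rfl) y hy hyw
    · exact C.not_adj_path_post hTP hP (by omega) y hy hyw
    · obtain ⟨l₁, l₂, rfl⟩ := List.append_of_mem hy
      simp only [List.length_append, List.length_cons] at hlen
      exact C.not_adj_path₂ hTP hx hxT hxP hxr hsx (pre := pre ++ c :: l₁) (post := l₂)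
        (by simp [hP]) (by omega) (C.notMem_of_mem_post hTP hP hy) hyw.symm
    · exact C.min.not_adj_of_length_le_two (List.isChain_append.1 hchP).2.1
        (List.nodup_append.1 hndP).2.1 (by omega) (fun hm => hgP (by simp [hP, hm])) hgc y hy
        hyw.symm

end Center
end Center

section FanNeighbours
open Classical

variable {U : Type*} {G : SimpleGraph U} {z : U} {W W₀ S A : Finset U} {P P' : List U}
  {p₀ u a : U}

/-- A short path starting between two apex neighbours `l` and `r` cannot separate `l` from
the path `P` when `P` is joined to `r`. -/
lemma MinCE.cut_sep (h : MinCE G z W P A) (hW : W₀ ⊆ W) (D : ParityDrawing (Apex G z W₀ S))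
    (hSW : S ⊆ W₀) (hA : ∀ b ∈ A, b ∈ W₀ → b ∈ S) {s l r k : U} {Q L : List U} (hl : l ∈ S)
    (hr : r ∈ S) (hsl : G.Adj s l) (hsr : G.Adj s r) (hlr : l ≠ r) (hcl : D.ConstSide [s, l])
    (hcr : D.ConstSide [s, r]) (hR : SPath G W₀ S (s :: (Q ++ [k]))) (hQ : Q.length ≤ 2)
    (hlR : l ∉ s :: (Q ++ [k])) (hL : L.IsChain G.Adj) (hLW : ∀ x ∈ L, x ∈ W₀)
    (hLR : ∀ x ∈ L, x ∉ s :: (Q ++ [k])) (hrL : r ∈ L)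
    (hP : ∀ p ∈ P, p ∈ L ∨ p ∈ s :: (Q ++ [k]))
    (hone : ∀ b ∈ A, b ∈ W₀ → b ∉ s :: (Q ++ [k]) → D.side z (s :: (Q ++ [k])) b =
      D.side z (s :: (Q ++ [k])) l → ∀ x ∈ s :: (Q ++ [k]), ∀ y ∈ s :: (Q ++ [k]),
      G.Adj b x → G.Adj b y → x = y)
    (hcl' : ∀ t ∈ D.cls (s :: (Q ++ [k])) (D.side z (s :: (Q ++ [k])) l), ∀ d ∈ W, d ∉ W₀ →
      G.Adj d t → d ∈ s :: (Q ++ [k])) : False := by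
  have hz : z ∉ W₀ := fun hz => h.conf.z_notMem (hW hz)
  have hrR := hLR r hrL
  obtain ⟨K₁, hK₁⟩ := hcl
  obtain ⟨K₂, hK₂⟩ := hcr
  have hsep := D.side_ne hz hSW (hR.head s (by simp)) hl hr
    (hR.last k (by rw [← List.cons_append, List.getLast?_concat]; simp)) hsl hsr
    hlr hK₁ hK₂ hR hlR hrR
  have hlen : (s :: (Q ++ [k])).length ≤ 4 := by
    simp only [List.length_append, List.length_cons, List.length_nil]
    omega
  refine h.cut_zero hW D hA hR hlen
    (fun b hb hbc => hone b hb (D.mem_cls.1 hbc).1 (D.mem_cls.1 hbc).2.1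
    (D.mem_cls.1 hbc).2.2) ?_ hcl' (D.mem_cls.2 ⟨hSW hl, hlR, rfl⟩) (hW (hSW hr)) ?_ hrR
  · intro p hp hpc
    obtain ⟨-, hpR, hpl⟩ := D.mem_cls.1 hpc
    have hpL := (hP p hp).resolve_right hpR
    rw [D.side_eq_of_chain hz hR hL hLW hLR p hpL r hrL] at hpl
    rw [hpl] at hsep
    grind
  · intro hrc
    have hrl := (D.mem_cls.1 hrc).2.2
    rw [hrl] at hsep
    grind

namespace Fan

variable {D : ParityDrawing (Apex G z W S)} {b c x g s w t : U} {pre post : List U}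

lemma uW (F : Fan D p₀ P' A u a) : u ∈ W := F.sub F.uS

lemma aW (F : Fan D p₀ P' A u a) : a ∈ W := F.sub (F.AS F.aA)

lemma p₀W (F : Fan D p₀ P' A u a) : p₀ ∈ W := F.min.conf.sub p₀ (by simp)

lemma aP (F : Fan D p₀ P' A u a) : a ∉ p₀ :: P' := F.min.conf.A_notMem a F.aA

lemma five (F : Fan D p₀ P' A u a) : P'.length ≤ 5 := by
  have := F.min.conf.length_le
  rw [List.length_cons] at this
  omega

lemma center (F : Fan D p₀ P' A u a) : Center D (p₀ :: P') A p₀ u p₀ a [p₀] where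
  min := F.min
  sub := F.sub
  PS := F.PS
  AS := F.AS
  sS := F.uS
  sP := F.uP
  sA := F.uA
  lS := F.PS p₀ (by simp)
  rA := F.aA
  sl := F.pu.symm
  sr := F.ua
  lr := fun he => F.aP (by simp [he])
  cl := F.cpu.swap
  cr := F.cua
  chain := by simp
  T_sub := by simpa using F.p₀W
  lT := by simp
  sT := fun hm => F.uP (by simp at hm; simp [hm])
  TA := by simp
  p₀T := by simp
  head := by simp

lemma u_mem (F : Fan D p₀ P' A u a) (hb : b ∈ A) (hba : b ≠ a) : ¬ G.Adj u b :=
  F.center.not_adj_mem hb (fun he => F.min.conf.A_notMem b hb (by simp [he])) hba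

lemma u_path (F : Fan D p₀ P' A u a) (hc : c ∈ P') : ¬ G.Adj u c := by
  have h := F.min
  have hnd := h.conf.nodup
  obtain ⟨l₁, l₂, hP⟩ := List.append_of_mem hc
  have h5 := F.five
  by_cases hlen : l₂.length ≤ 2
  · refine F.center.not_adj_path (pre := p₀ :: l₁) (by simp [hP]) hlen fun hm => ?_
    exact (List.nodup_cons.1 hnd).1 (by simp at hm; exact hm ▸ hc)
  · have hpre : (p₀ :: (l₁ ++ [c])) <+: p₀ :: P' := ⟨l₂, by simp [hP]⟩
    refine h.not_adj_of_length_le_two (isChain_of_infix h.conf.chain hpre.isInfix)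
      (hnd.sublist hpre.sublist) ?_
      ?_ F.pu.symm c (by simp)
    · simp only [hP, List.length_append, List.length_cons, List.length_nil] at h5 ⊢
      omega
    · exact fun hm => F.uP (hpre.subset (by simp [hm]))

lemma nu_notMem_path (F : Fan D p₀ P' A u a) (hx : G.Adj u x) (hxp : x ≠ p₀) : x ∉ p₀ :: P' :=
  fun hm => F.u_path ((List.mem_cons.1 hm).resolve_left hxp) hx

lemma nu_notMem (F : Fan D p₀ P' A u a) (hx : G.Adj u x) (hxa : x ≠ a) : x ∉ A :=
  fun hm => F.u_mem hm hxa hx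

lemma nu_mem (F : Fan D p₀ P' A u a) (hxW : x ∈ W) (hx : G.Adj u x) (hxp : x ≠ p₀) (hxa : x ≠ a)
    (hb : b ∈ A) : ¬ G.Adj x b := by
  by_cases hba : b = a
  · exact fun hxb => F.min.tri hx (hba ▸ hxb) F.ua
  · exact F.center.not_adj_mem₂ hxW (by simpa using hxp) (F.nu_notMem_path hx hxp) hxa hx hb
      (fun he => F.min.conf.A_notMem b hb (by simp [he])) hba

lemma notMem_of_eq_append (F : Fan D p₀ P' A u a) (hP : P' = pre ++ c :: post) : c ∉ [p₀] := by
  intro hm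
  refine (List.nodup_cons.1 F.min.conf.nodup).1 ?_
  rw [List.mem_singleton] at hm
  simp [hP, hm]

lemma nu_path (F : Fan D p₀ P' A u a) (hxW : x ∈ W) (hx : G.Adj u x) (hxp : x ≠ p₀) (hxa : x ≠ a)
    (hP : P' = pre ++ c :: post) (hlen : post.length ≤ 2) : ¬ G.Adj x c :=
  F.center.not_adj_path₂ (by simp) hxW (by simpa using hxp) (F.nu_notMem_path hx hxp) hxa hx
    (pre := p₀ :: pre) (by simp [hP]) hlen (F.notMem_of_eq_append hP)

lemma nnu_mem (F : Fan D p₀ P' A u a) (hxW : x ∈ W) (hx : G.Adj u x) (hxp : x ≠ p₀) (hxa : x ≠ a)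
    (hgW : g ∈ W) (hxg : G.Adj x g) (hgu : g ≠ u) (hgP : g ∉ p₀ :: P') (hb : b ∈ A)
    (hba : b ≠ a) : ¬ G.Adj g b :=
  F.center.not_adj_mem₃ hxW (by simpa using hxp) (F.nu_notMem_path hx hxp) hxa hx hgW
    (fun hm => hgP (by simp at hm; simp [hm])) hgP
    (fun he => F.nu_mem hxW hx hxp hxa F.aA (he ▸ hxg)) hgu (F.nu_notMem hx hxa) hxg hb
    (fun he => F.min.conf.A_notMem b hb (by simp [he])) hba

lemma nnu_path (F : Fan D p₀ P' A u a) (hxW : x ∈ W) (hx : G.Adj u x) (hxp : x ≠ p₀) (hxa : x ≠ a)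
    (hgW : g ∈ W) (hxg : G.Adj x g) (hgu : g ≠ u) (hgP : g ∉ p₀ :: P')
    (hP : P' = pre ++ c :: post) (hlen : post.length ≤ 1) : ¬ G.Adj g c :=
  F.center.not_adj_path₃ (by simp) hxW (by simpa using hxp) (F.nu_notMem_path hx hxp) hxa hx hgW
    (fun hm => hgP (by simp at hm; simp [hm])) hgP
    (fun he => F.nu_mem hxW hx hxp hxa F.aA (he ▸ hxg)) hgu hxg
    (pre := p₀ :: pre) (by simp [hP]) hlen (F.notMem_of_eq_append hP)

lemma exists_eq_cons (F : Fan D p₀ P' A u a) : ∃ p₁ P'', P' = p₁ :: P'' := by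
  refine List.exists_cons_of_ne_nil fun he => ?_
  have := F.four
  rw [he, List.length_nil] at this
  omega

/-- A short path from `p₀` to another apex neighbour that avoids `u` and the rest of `P`. -/
lemma cut_p₀ (F : Fan D p₀ P' A u a) {Q : List U} (hR : SPath G W S (p₀ :: (Q ++ [c])))
    (hQ : Q.length ≤ 2) (huR : u ∉ p₀ :: (Q ++ [c])) (hPR : ∀ x ∈ P', x ∉ p₀ :: (Q ++ [c]))
    (hone : ∀ b ∈ A, b ∉ p₀ :: (Q ++ [c]) → ∀ x ∈ p₀ :: (Q ++ [c]), ∀ y ∈ p₀ :: (Q ++ [c]),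
      G.Adj b x → G.Adj b y → x = y) : False := by
  have h := F.min
  obtain ⟨p₁, P'', rfl⟩ := F.exists_eq_cons
  have hch := h.conf.chain
  rw [List.isChain_cons_cons] at hch
  exact h.cut_sep subset_rfl D F.sub (fun b hb _ => F.AS hb) (l := u) (r := p₁) (L := p₁ :: P'')
    F.uS (F.PS p₁ (by simp)) F.pu hch.1 (fun he => F.uP (by simp [he])) F.cpu
    (h.constSide_edge D F.PS F.AS [] p₀ p₁ P'' rfl) hR hQ huR hch.2
    (fun x hx => h.conf.sub x (by simp only [List.mem_cons] at hx ⊢; tauto)) hPR (by simp)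
    (fun p hp => (List.mem_cons.1 hp).elim (fun he => Or.inr (by simp [he])) Or.inl)
    (fun b hb _ hbR _ => hone b hb hbR) (fun _ _ d hd hdW => (hdW hd).elim)

lemma np_mem (F : Fan D p₀ P' A u a) (hsW : s ∈ W) (hs : G.Adj p₀ s) (hsP : s ∉ p₀ :: P')
    (hsu : s ≠ u) (hc : c ∈ A) : ¬ G.Adj s c := by
  intro hsc
  have h := F.min
  have hcP := h.conf.A_notMem c hc
  have hpc : p₀ ≠ c := fun he => hcP (by simp [he])
  have huc : u ≠ c := fun he => F.uA (he ▸ hc)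
  have hR : SPath G W S (p₀ :: ([s] ++ [c])) :=
    { ne_nil := by simp
      chain := by simp [hs, hsc]
      nodup := by simp [hs.ne, hsc.ne, hpc]
      mem := by
        have := F.p₀W
        have := h.conf.A_sub c hc
        simp [*]
      head := by simpa using F.PS p₀ (by simp)
      last := by simpa using F.AS hc }
  refine F.cut_p₀ hR (by simp) (by simp [F.pu.ne.symm, hsu.symm, huc]) ?_
    fun b hb hbR => h.eq_of_length_le_three hR.chain hR.nodup (by simp) hbR
  intro x hx hxR
  simp only [List.cons_append, List.nil_append, List.mem_cons, List.not_mem_nil, or_false] at hxR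
  rcases hxR with rfl | rfl | rfl
  exacts [(List.nodup_cons.1 h.conf.nodup).1 hx, hsP (by simp [hx]), hcP (by simp [hx])]

lemma na_notMem_path (F : Fan D p₀ P' A u a) (hw : G.Adj a w) : w ∉ p₀ :: P' :=
  fun hm => F.min.not_adj F.aA hm hw

lemma na_notMem (F : Fan D p₀ P' A u a) (hw : G.Adj a w) : w ∉ A :=
  fun hm => F.min.conf.indep a F.aA w hm hw

lemma np_na (F : Fan D p₀ P' A u a) (hsW : s ∈ W) (hs : G.Adj p₀ s) (hsP : s ∉ p₀ :: P')
    (hsu : s ≠ u) (hwW : w ∈ W) (hw : G.Adj a w) (hwu : w ≠ u) : ¬ G.Adj s w := by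
  intro hsw
  have h := F.min
  have hpa : p₀ ≠ a := fun he => F.aP (by simp [he])
  have hpw : p₀ ≠ w := fun he => F.na_notMem_path hw (by simp [he])
  have hsa : s ≠ a := fun he => h.not_adj F.aA (by simp) (he ▸ hs.symm)
  have hR : SPath G W S (p₀ :: ([s, w] ++ [a])) :=
    { ne_nil := by simp
      chain := by simp [hs, hsw, hw.symm]
      nodup := by simp [hs.ne, hsw.ne, hpw, hpa, hsa, hw.ne.symm]
      mem := by
        have := F.p₀W
        have := F.aW
        simp [*]
      head := by simpa using F.PS p₀ (by simp)
      last := by simpa using F.AS F.aA }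
  have hm : ∀ b ∈ A, ∀ x ∈ p₀ :: ([s, w] ++ [a]), G.Adj b x → x = w := by
    intro b hb x hx hbx
    simp only [List.cons_append, List.nil_append, List.mem_cons, List.not_mem_nil, or_false] at hx
    rcases hx with rfl | rfl | rfl | rfl
    exacts [(h.not_adj hb (by simp) hbx).elim, (F.np_mem hsW hs hsP hsu hb hbx.symm).elim, rfl,
      (h.conf.indep b hb x F.aA hbx).elim]
  refine F.cut_p₀ hR (by simp) (by simp [F.pu.ne.symm, hsu.symm, hwu.symm, F.ua.ne]) ?_
    fun b hb _ x hx y hy hbx hby => (hm b hb x hx hbx).trans (hm b hb y hy hby).symm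
  intro x hx hxR
  simp only [List.cons_append, List.nil_append, List.mem_cons, List.not_mem_nil, or_false] at hxR
  rcases hxR with rfl | rfl | rfl | rfl
  exacts [(List.nodup_cons.1 h.conf.nodup).1 hx, hsP (by simp [hx]),
    F.na_notMem_path hw (by simp [hx]), F.aP (by simp [hx])]

end Fan
end FanNeighbours

section SecondFan
open Classical

variable {U : Type*} {G : SimpleGraph U} {z : U} {W S A : Finset U} {P' : List U}
  {p₀ u a y b : U}

namespace Fan

variable {D : ParityDrawing (Apex G z W S)} {p x w : U} {pre post : List U}

lemma adj_p₁ (F : Fan D p₀ P' A u a) (hp : p ∈ P'.head?) : G.Adj p₀ p :=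
  (List.isChain_cons.1 F.min.conf.chain).1 p hp

/-- A neighbour of `u` has at most one neighbour in the rest of `P`. -/
lemma nu_one (F : Fan D p₀ P' A u a) (hxW : x ∈ W) (hx : G.Adj u x) (hxp : x ≠ p₀) (hxa : x ≠ a) :
    ∀ p ∈ P', ∀ q ∈ P', G.Adj x p → G.Adj x q → p = q := by
  have h5 := F.five
  have hsplit : ∀ p ∈ P', G.Adj x p → p ∈ P'.take 2 := by
    intro p hp hxp'
    obtain ⟨l₁, l₂, hP⟩ := List.append_of_mem hp
    by_cases hlen : l₂.length ≤ 2
    · exact (F.nu_path hxW hx hxp hxa hP hlen hxp').elim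
    · rw [hP] at h5 ⊢
      simp only [List.length_append, List.length_cons] at h5
      match l₁, h5 with
      | [], _ => simp
      | [_], _ => simp
      | _ :: _ :: _, h5 =>
        simp only [List.length_cons] at h5
        omega
  have hpre : P'.take 2 <+: P' := List.take_prefix 2 P'
  have hch := (List.isChain_cons.1 F.min.conf.chain).2
  have hnd := (List.nodup_cons.1 F.min.conf.nodup).2
  intro p hp q hq hxp' hxq
  refine F.min.eq_of_length_le_three (isChain_of_infix hch hpre.isInfix) (hnd.sublist hpre.sublist)
    (by rw [List.length_take]; omega) (fun hm => ?_) p (hsplit p hp hxp') q (hsplit q hq hxq)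
    hxp' hxq
  exact F.nu_notMem_path hx hxp (by simp [hpre.subset hm])

/-- A neighbour of `a` can only be joined to the end vertices of `P`. -/
lemma na_path (F : Fan D p₀ P' A u a) (hwW : w ∈ W) (hw : G.Adj a w)
    (hP : P' = pre ++ p :: post) (hpost : post ≠ []) : ¬ G.Adj w p :=
  F.min.not_adj_of_adj F.aA hwW (F.na_notMem_path hw) hw (pre := p₀ :: pre) (by simp [hP])
    (by simp) hpost

lemma na_one (F : Fan D p₀ P' A u a) (hwW : w ∈ W) (hw : G.Adj a w) :
    ∀ p ∈ P', ∀ q ∈ P', G.Adj w p → G.Adj w q → p = q := by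
  have key : ∀ p ∈ P', G.Adj w p → P'.getLast? = some p := by
    intro p hp hwp
    obtain ⟨l₁, l₂, hP⟩ := List.append_of_mem hp
    by_cases hl : l₂ = []
    · simp [hP, hl]
    · exact (F.na_path hwW hw hP hl hwp).elim
  intro p hp q hq hwp hwq
  exact Option.some_injective _ ((key p hp hwp).symm.trans (key q hq hwq))

lemma nu_p₁ (F : Fan D p₀ P' A u a) (hx : G.Adj u x) (hxp : x ≠ p₀) (hp : p ∈ P'.head?) :
    ¬ G.Adj x p := by
  intro hxp'
  have hpP : p ∈ P' := List.mem_of_mem_head? hp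
  exact hxp (F.min.sq (x := u) (y := p) (fun he => F.uP (by simp [he, hpP])) hx.symm hxp' F.pu
    (F.adj_p₁ hp))

/-- Some neighbour of `a` other than `u` has a second neighbour in `A`. -/
lemma exists_adj_adj (F : Fan D p₀ P' A u a) :
    ∃ y ∈ W, y ≠ u ∧ G.Adj a y ∧ ∃ b ∈ A, b ≠ a ∧ G.Adj y b := by
  by_contra hcon
  push Not at hcon
  have h := F.min
  have hz := h.conf.z_notMem
  have hnd := List.nodup_cons.1 h.conf.nodup
  have h5 := F.five
  have hup := F.pu.ne.symm
  have hua := F.ua.ne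
  have hpa : p₀ ≠ a := fun he => F.aP (by simp [he])
  have huP' : u ∉ P' := fun hm => F.uP (by simp [hm])
  have haP' : a ∉ P' := fun hm => F.aP (by simp [hm])
  have memK : ∀ {x}, x ∈ [p₀, u, a] ↔ x = p₀ ∨ x = u ∨ x = a := by simp
  have hg := h.delete (K := [p₀, u, a]) (P' := P') (A₀ := A) subset_rfl (v₀ := p₀) (by simp) F.p₀W
    (List.suffix_cons p₀ P').isInfix (by simp; tauto) ?_ ?_ ?_ ?_ ?_ ?_ ?_ ?_ ?_
  · refine h.bad ?_
    refine WD.delete_cap (u := u) ?_ (by simpa using F.uP) ?_ ?_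
    · rw [Finset.mem_sdiff, List.mem_toFinset]
      exact ⟨F.uW, F.uP⟩
    · have hn : nbrCount G (p₀ :: P').toFinset u ≤ 1 := nbrCount_le_one (by
        have key : ∀ x ∈ (p₀ :: P').toFinset, G.Adj x u → x = p₀ := fun x hx hxu =>
          (List.mem_cons.1 (List.mem_toFinset.1 hx)).resolve_right fun hx => F.u_path hx hxu.symm
        exact fun x hx y hy hxu hyu => (key x hx hxu).trans (key y hy hyu).symm)
      rw [cap, if_neg F.uA]
      omega
    refine WD.delete_cap (u := a) ?_ ?_ ?_ ?_
    · rw [Finset.mem_erase, Finset.mem_sdiff, List.mem_toFinset]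
      exact ⟨hua.symm, F.aW, F.aP⟩
    · rw [Finset.mem_insert, List.mem_toFinset, not_or]
      exact ⟨hua.symm, F.aP⟩
    · have hn : nbrCount G (insert u (p₀ :: P').toFinset) a ≤ 1 := nbrCount_le_one (by
        have key : ∀ x ∈ insert u (p₀ :: P').toFinset, G.Adj x a → x = u := fun x hx hxa =>
          (Finset.mem_insert.1 hx).resolve_right fun hx =>
            h.not_adj F.aA (List.mem_toFinset.1 hx) hxa.symm
        exact fun x hx y hy hxa hya => (key x hx hxa).trans (key y hy hya).symm)
      rw [cap, if_pos F.aA]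
      omega
    have h1 : ((W \ (p₀ :: P').toFinset).erase u).erase a =
        (W \ (p₀ :: P').toFinset) \ [p₀, u, a].toFinset := by
      ext x; simp; tauto
    have h2 : insert a (insert u (p₀ :: P').toFinset) =
        (p₀ :: P').toFinset ∪ [p₀, u, a].toFinset := by
      ext x; simp; tauto
    rwa [h1, h2]
  · intro x hx hm
    rcases memK.1 hm with rfl | rfl | rfl
    exacts [hnd.1 hx, huP' hx, haP' hx]
  · intro W' S' hW' hS'
    refine ParityDrawing.contract_list hz D F.sub (L := [p₀, u, a]) (by simp [hup.symm, hua, hpa])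
      ?_ hW' fun x hx => ?_
    · intro x hx
      rcases memK.1 hx with rfl | rfl | rfl
      exacts [F.PS x (by simp), F.uS, F.AS F.aA]
    · exact ⟨(hS' x hx).1, (hS' x hx).2.imp_left fun hx => hx.elim (F.PS x) (fun hx => F.AS hx)⟩
  · intro a' ha' ha'K v hv w hw hwP hwK hvw
    rw [memK, not_or, not_or] at ha'K hwK
    rcases memK.1 hv with rfl | rfl | rfl
    · exact fun haw => F.np_mem hw hvw hwP hwK.2.1 ha' haw.symm
    · exact fun haw => F.nu_mem hw hvw hwK.1 hwK.2.2 ha' haw.symm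
    · exact fun haw => hcon w hw hwK.2.1 hvw a' ha' ha'K.2.2 haw.symm
  · intro v hv w hw hwP hwK hvw v' hv' w' hw' hwP' hwK' hvw' hww
    rw [memK, not_or, not_or] at hwK hwK'
    have k1 : ∀ {s x}, G.Adj p₀ s → G.Adj u x → s ≠ u → x ≠ p₀ → ¬ G.Adj s x :=
      fun hs hx hsu hxp hsx => hxp (h.sq hsu hsx.symm hx.symm hs F.pu)
    have k2 : ∀ {x w}, G.Adj u x → G.Adj a w → x ≠ a → w ≠ u → ¬ G.Adj x w :=
      fun hx hw hxa hwu hxw => hwu (h.sq hxa hxw.symm hw.symm hx F.ua)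
    rcases memK.1 hv with rfl | rfl | rfl <;> rcases memK.1 hv' with rfl | rfl | rfl
    · exact h.tri hvw hww hvw'
    · exact k1 hvw hvw' hwK.2.1 hwK'.1 hww
    · exact F.np_na hw hvw hwP hwK.2.1 hw' hvw' hwK'.2.1 hww
    · exact k1 hvw' hvw hwK'.2.1 hwK.1 hww.symm
    · exact h.tri hvw hww hvw'
    · exact k2 hvw hvw' hwK.2.2 hwK'.2.1 hww
    · exact F.np_na hw' hvw' hwP' hwK'.2.1 hw hvw hwK.2.1 hww.symm
    · exact k2 hvw' hvw hwK'.2.2 hwK.2.1 hww.symm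
    · exact h.tri hvw hww hvw'
  · intro v hv w hw hwP hwK hvw
    rw [memK, not_or, not_or] at hwK
    rcases memK.1 hv with rfl | rfl | rfl
    · exact h.eq_of_adj_head h.conf.chain h.conf.nodup h5 (fun hm => hwP (by simp [hm])) hvw.symm
    · exact F.nu_one hw hvw hwK.1 hwK.2.2
    · exact F.na_one hw hvw
  · intro v hv w hw hwP hwK hvw p hp
    rw [memK, not_or, not_or] at hwK
    rcases memK.1 hv with rfl | rfl | rfl
    · exact fun hwp => h.tri (F.adj_p₁ hp) hwp.symm hvw
    · exact F.nu_p₁ hvw hwK.1 hp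
    · obtain ⟨p₁, P'', rfl⟩ := F.exists_eq_cons
      have hp' : p₁ = p := by simpa using hp
      refine F.na_path hw hvw (pre := []) (post := P'') (by simp [hp']) ?_
      rintro rfl
      have := F.four
      simp at this
  · exact fun _ _ _ _ _ _ _ _ _ _ => h5
  · intro a' ha' ha'K v hv hvP
    rw [memK, not_or, not_or] at ha'K
    rcases memK.1 hv with rfl | rfl | rfl
    · exact (hvP (by simp)).elim
    · exact F.u_mem ha' ha'K.2.2
    · exact h.conf.indep v F.aA a' ha'
  · intro w _ _ hwK v hv v' hv' hvw hvw'
    rw [memK, not_or, not_or] at hwK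
    rcases memK.1 hv with rfl | rfl | rfl <;> rcases memK.1 hv' with rfl | rfl | rfl
    · rfl
    · exact (h.tri F.pu hvw' hvw).elim
    · exact h.sq hwK.2.1 hvw F.pu hvw' F.ua.symm
    · exact (h.tri F.pu hvw hvw').elim
    · rfl
    · exact (h.tri F.ua hvw' hvw).elim
    · exact h.sq hwK.2.1 hvw F.ua.symm hvw' F.pu
    · exact (h.tri F.ua hvw hvw').elim
    · rfl

end Fan

/-- A minimal counterexample together with a path `p₀ u a y b` on its outer face. -/
structure Fan₂ (D : ParityDrawing (Apex G z W S)) (p₀ : U) (P' : List U) (A : Finset U)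
    (u a y b : U) : Prop where
  fan : Fan D p₀ P' A u a
  yS : y ∈ S
  yu : y ≠ u
  ay : G.Adj a y
  bA : b ∈ A
  ba : b ≠ a
  yb : G.Adj y b
  cay : D.ConstSide [a, y]
  cyb : D.ConstSide [y, b]

lemma Fan.exists_fan₂ {D : ParityDrawing (Apex G z W S)} (F : Fan D p₀ P' A u a) :
    ∃ (y b : U) (S : Finset U) (D : ParityDrawing (Apex G z W S)), Fan₂ D p₀ P' A u a y b := by
  obtain ⟨y, hyW, hyu, hay, b, hb, hba, hyb⟩ := F.exists_adj_adj
  have h := F.min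
  have hz := h.conf.z_notMem
  have hyP := F.na_notMem_path hay
  have hR : SPath G W S ([a] ++ y :: [b]) :=
    { ne_nil := by simp
      chain := by simp [hay, hyb]
      nodup := by simp [hay.ne, hyb.ne, hba.symm]
      mem := by
        have := F.aW
        have := h.conf.A_sub b hb
        simp [*]
      head := by simpa using F.AS F.aA
      last := by simpa using F.AS hb }
  have hPR : ∀ x ∈ p₀ :: P', x ∉ [a] ++ y :: [b] := by
    intro x hx hxR
    simp only [List.cons_append, List.nil_append, List.mem_cons (b := a), List.mem_cons (b := y),
      List.mem_singleton] at hxR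
    rcases hxR with rfl | rfl | rfl
    exacts [F.aP hx, hyP hx, h.conf.A_notMem x hb hx]
  have hc : D.ConstSide ([a] ++ y :: [b]) := by
    refine h.constSide_of_forall D F.AS hR (by simp) fun p hp _ q hq _ => ?_
    exact D.side_eq_of_chain hz hR h.conf.chain h.conf.sub hPR p hp q hq
  obtain ⟨D', h1, h2, h3⟩ := D.exists_add_edge hz hR (by simpa using h.conf.indep a F.aA b hb)
    (by simp) (by simp) hc
  have hyp : y ≠ p₀ := fun he => hyP (by simp [he])
  refine ⟨y, b, _, D', ⟨?_, by simp, hyu, hay, hb, hba, hyb, h1, h2⟩⟩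
  exact ⟨h, F.four, Finset.insert_subset hyW F.sub,
    fun x hx => Finset.mem_insert_of_mem (F.PS x hx),
    fun x hx => Finset.mem_insert_of_mem (F.AS hx), Finset.mem_insert_of_mem F.uS, F.uP, F.uA, F.aA,
    F.pu, F.ua, h3 _ (by simp [hyp, hyu]) F.cpu, h3 _ (by simp [hyu, hay.ne.symm]) F.cua⟩

end SecondFan

section SecondFanNeighbours
open Classical

variable {U : Type*} {G : SimpleGraph U} {z : U} {W S A : Finset U} {P' : List U}
  {p₀ u a y b : U}

namespace Fan₂

variable {D : ParityDrawing (Apex G z W S)} {c g m t w : U} {P₁ Q pre post : List U}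

lemma yW (F : Fan₂ D p₀ P' A u a y b) : y ∈ W := F.fan.sub F.yS

lemma bW (F : Fan₂ D p₀ P' A u a y b) : b ∈ W := F.fan.sub (F.fan.AS F.bA)

lemma yP (F : Fan₂ D p₀ P' A u a y b) : y ∉ p₀ :: P' := F.fan.na_notMem_path F.ay

lemma yA (F : Fan₂ D p₀ P' A u a y b) : y ∉ A := F.fan.na_notMem F.ay

lemma bP (F : Fan₂ D p₀ P' A u a y b) : b ∉ p₀ :: P' := F.fan.min.conf.A_notMem b F.bA

lemma mem_arm : c ∈ [p₀, u, a] ↔ c = p₀ ∨ c = u ∨ c = a := by simp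

lemma center (F : Fan₂ D p₀ P' A u a y b) : Center D (p₀ :: P') A p₀ y a b [p₀, u, a] where
  min := F.fan.min
  sub := F.fan.sub
  PS := F.fan.PS
  AS := F.fan.AS
  sS := F.yS
  sP := F.yP
  sA := F.yA
  lS := F.fan.AS F.fan.aA
  rA := F.bA
  sl := F.ay.symm
  sr := F.yb
  lr := F.ba.symm
  cl := F.cay.swap
  cr := F.cyb
  chain := by simp [F.fan.pu, F.fan.ua]
  T_sub := by simp [F.fan.p₀W, F.fan.uW, F.fan.aW]
  lT := by simp
  sT := by
    rw [mem_arm]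
    rintro (he | he | he)
    exacts [F.yP (by simp [he]), F.yu he, F.ay.ne he.symm]
  TA := by
    intro c hc hcT
    rcases mem_arm.1 hcT with rfl | rfl | rfl
    exacts [(F.fan.min.conf.A_notMem c hc (by simp)).elim, (F.fan.uA hc).elim, rfl]
  p₀T := by simp
  head := by simp

lemma eq_p₀ (F : Fan₂ D p₀ P' A u a y b) : ∀ q ∈ p₀ :: P', q ∈ [p₀, u, a] → q = p₀ := by
  intro q hq hqT
  rcases mem_arm.1 hqT with rfl | rfl | rfl
  exacts [rfl, (F.fan.uP hq).elim, (F.fan.aP hq).elim]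

lemma notMem_arm (F : Fan₂ D p₀ P' A u a y b) (hc : c ∈ P') : c ∉ [p₀, u, a] := fun hm =>
  (List.nodup_cons.1 F.fan.min.conf.nodup).1 (F.eq_p₀ c (by simp [hc]) hm ▸ hc)

lemma y_mem (F : Fan₂ D p₀ P' A u a y b) (hc : c ∈ A) (hca : c ≠ a) (hcb : c ≠ b) : ¬ G.Adj y c :=
  F.center.not_adj_mem hc hca hcb

lemma y_path (F : Fan₂ D p₀ P' A u a y b) (hc : c ∈ p₀ :: P') : ¬ G.Adj y c := by
  rcases List.mem_cons.1 hc with rfl | hc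
  · exact fun hyc => F.fan.aP (by simp [F.fan.min.sq F.yu F.ay F.fan.ua.symm hyc.symm F.fan.pu])
  · obtain ⟨l₁, l₂, hP⟩ := List.append_of_mem hc
    by_cases hl : l₂ = []
    · subst hl
      exact F.center.not_adj_path (pre := p₀ :: l₁) (post := []) (by simp [hP]) (by simp)
        (F.notMem_arm hc)
    · exact F.fan.na_path F.yW F.ay hP hl

/-- The analogue of `Center.path_false` for the other end of `P`. -/
lemma path_false (F : Fan₂ D p₀ P' A u a y b) (hch : (y :: (Q ++ [c])).IsChain G.Adj)
    (hnd : (y :: (Q ++ [c])).Nodup) (hQ : Q.length ≤ 2)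
    (hQW : ∀ x ∈ Q, x ∈ W ∧ x ∉ [p₀, u, a] ∧ x ∉ p₀ :: P' ∧ x ≠ b)
    (hP : p₀ :: P' = pre ++ c :: post) (hpost : post ≠ []) (hlen : Q.length + pre.length ≤ 3)
    (hRA : ∀ d ∈ A, d ≠ a → d ≠ b → ∀ x ∈ y :: Q, x ≠ m → ¬ G.Adj d x)
    (hNR : ∀ x ∈ y :: Q, ∀ q ∈ pre, ¬ G.Adj q x) : False := by
  have h := F.fan.min
  have hz := h.conf.z_notMem
  have hcP : c ∈ p₀ :: P' := by simp [hP]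
  have hmem : ∀ x, x ∈ y :: (Q ++ [c]) → x = y ∨ x ∈ Q ∨ x = c := by simp
  have hR : SPath G W S (y :: (Q ++ [c])) :=
    { ne_nil := by simp
      chain := hch
      nodup := hnd
      mem := by
        intro x hx
        rcases hmem x hx with rfl | hx | rfl
        exacts [F.yW, (hQW x hx).1, h.conf.sub x hcP]
      head := by simpa using F.yS
      last := by
        rw [← List.cons_append, List.getLast?_concat]; simpa using F.fan.PS c hcP }
  have hdis : ∀ x ∈ pre ++ post, x ∉ y :: (Q ++ [c]) := by
    intro x hx hxR
    have hxP : x ∈ p₀ :: P' := by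
      rw [hP]; simp only [List.mem_append, List.mem_cons] at hx ⊢; tauto
    rcases hmem x hxR with rfl | hx' | rfl
    · exact F.yP hxP
    · exact (hQW x hx').2.2.1 hxP
    · have hndP := h.conf.nodup
      rw [hP, List.nodup_append, List.nodup_cons] at hndP
      rcases List.mem_append.1 hx with hx | hx
      · exact hndP.2.2 x hx x (by simp) rfl
      · exact hndP.2.1.1 hx
  have harm : ∀ x ∈ [p₀, u, a], x ≠ c → x ∉ y :: (Q ++ [c]) := by
    intro x hx hxc hxR
    rcases hmem x hxR with rfl | hx' | he
    exacts [F.center.sT hx, (hQW x hx').2.1 hx, hxc he]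
  have huc : u ≠ c := fun he => F.fan.uP (he ▸ hcP)
  have hac : a ≠ c := fun he => F.fan.aP (he ▸ hcP)
  have huR := harm u (by simp) huc
  have haR := harm a (by simp) hac
  have hbR : b ∉ y :: (Q ++ [c]) := by
    intro hbR
    rcases hmem b hbR with he | hx' | rfl
    exacts [F.yb.ne he.symm, (hQW b hx').2.2.2 rfl, F.bP hcP]
  have hua : D.side z (y :: (Q ++ [c])) u = D.side z (y :: (Q ++ [c])) a :=
    D.side_eq_of_adj hz hR F.fan.uW F.fan.aW huR haR F.fan.ua
  obtain ⟨K₁, hK₁⟩ := F.cay.swap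
  obtain ⟨K₂, hK₂⟩ := F.cyb
  have hsep := D.side_ne hz F.fan.sub F.yS (F.fan.AS F.fan.aA) (F.fan.AS F.bA) (F.fan.PS c hcP)
    F.ay.symm F.yb F.ba.symm hK₁ hK₂ hR haR hbR
  have hrev : (y :: (Q ++ [c])).reverse = c :: (Q.reverse ++ [y]) := by simp
  have hedge := h.constSide_edge D F.fan.PS F.fan.AS
  have hRrev : SPath G W S (c :: (Q.reverse ++ [y])) := hrev ▸ hR.reverse
  refine h.reverse.center_path_false D F.fan.sub (fun x hx => F.fan.PS x (List.mem_reverse.1 hx))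
    F.fan.AS (F.fan.AS F.bA) F.fan.aA F.yb F.ay.symm F.ba F.cyb F.cay.swap hR hQ hbR haR
    (pre := post.reverse) (post := pre.reverse) (by rw [hP]; simp) ?_ ?_
    (by rwa [List.length_reverse]) hRA (by simpa using hNR)
  · intro x hx
    refine hdis x ?_
    simp only [List.mem_append, List.mem_reverse] at hx ⊢
    exact hx.symm
  · suffices ∃ x ∈ post, D.side z (y :: (Q ++ [c])) a + D.side z (y :: (Q ++ [c])) x = 1 by
      obtain ⟨x, hx, hax⟩ := this
      exact ⟨x, by simpa using hx, by grind⟩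
    cases pre with
    | nil =>
      obtain ⟨p₁, P'', rfl⟩ := F.fan.exists_eq_cons
      simp only [List.nil_append, List.cons.injEq] at hP
      obtain ⟨rfl, rfl⟩ := hP
      obtain ⟨K₃, hK₃⟩ := F.fan.cpu
      obtain ⟨K₄, hK₄⟩ := hedge [] p₀ p₁ P'' rfl
      have hup : u ≠ p₁ := fun he => F.fan.uP (by simp [he])
      have := D.side_ne hz F.fan.sub (F.fan.PS p₀ (by simp)) F.fan.uS (F.fan.PS p₁ (by simp)) F.yS
        F.fan.pu (F.fan.adj_p₁ (by simp)) hup hK₃ hK₄ hRrev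
        (fun hm => huR (List.mem_reverse.1 (hrev ▸ hm)))
        (fun hm => hdis p₁ (by simp) (List.mem_reverse.1 (hrev ▸ hm)))
      simp only [← hrev, D.side_reverse] at this
      exact ⟨p₁, by simp, hua ▸ this⟩
    | cons q pre =>
      have hP' := hP
      simp only [List.cons_append, List.cons.injEq] at hP'
      obtain ⟨rfl, -⟩ := hP'
      have hpR := hdis p₀ (by simp)
      have hpu := D.side_eq_of_adj hz hR F.fan.p₀W F.fan.uW hpR huR F.fan.pu
      have hsep2 := D.side_ne_of_chain hz F.fan.sub (Q := Q.reverse) (k := y) hP h.conf.chain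
        h.conf.nodup F.fan.PS hedge hRrev
        (fun x hx hxR => hdis x hx (List.mem_reverse.1 (hrev ▸ hxR)))
      simp only [← hrev, D.side_reverse] at hsep2
      obtain ⟨x, hx⟩ := List.exists_mem_of_ne_nil _ hpost
      have := hsep2 p₀ (by simp) x hx
      exact ⟨x, hx, by rw [← hua, ← hpu]; exact this⟩

lemma ny_notMem_path (F : Fan₂ D p₀ P' A u a y b) (ht : G.Adj y t) : t ∉ p₀ :: P' :=
  fun hm => F.y_path hm ht

lemma ny_notMem (F : Fan₂ D p₀ P' A u a y b) (ht : G.Adj y t) (hta : t ≠ a) (htb : t ≠ b) :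
    t ∉ A := fun hm => F.y_mem hm hta htb ht

lemma ny_notMem_arm (F : Fan₂ D p₀ P' A u a y b) (ht : G.Adj y t) (hta : t ≠ a) :
    t ∉ [p₀, u, a] := by
  rw [mem_arm]
  rintro (rfl | rfl | rfl)
  exacts [F.ny_notMem_path ht (by simp), F.fan.min.tri F.ay ht F.fan.ua.symm, hta rfl]

lemma ny_mem (F : Fan₂ D p₀ P' A u a y b) (htW : t ∈ W) (ht : G.Adj y t) (hta : t ≠ a)
    (htb : t ≠ b) (hc : c ∈ A) : ¬ G.Adj t c := by
  by_cases hca : c = a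
  · exact fun htc => F.fan.min.tri ht (hca ▸ htc) F.ay.symm
  by_cases hcb : c = b
  · exact fun htc => F.fan.min.tri ht (hcb ▸ htc) F.yb
  exact F.center.not_adj_mem₂ htW (F.ny_notMem_arm ht hta) (F.ny_notMem_path ht) htb ht hc hca hcb

lemma ny_path (F : Fan₂ D p₀ P' A u a y b) (htW : t ∈ W) (ht : G.Adj y t) (hta : t ≠ a)
    (htb : t ≠ b) (hc : c ∈ p₀ :: P') : ¬ G.Adj t c := by
  intro htc
  have h := F.fan.min
  have htT := F.ny_notMem_arm ht hta
  have htP := F.ny_notMem_path ht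
  have h5 := h.conf.length_le
  have h4 := F.fan.four
  obtain ⟨l₁, l₂, hP⟩ := List.append_of_mem hc
  have hle := congrArg List.length hP
  simp only [List.length_append, List.length_cons] at hle h5
  by_cases hl : l₂.length ≤ 2
  · refine F.center.not_adj_path₂ F.eq_p₀ htW htT htP htb ht hP hl (F.notMem_arm ?_) htc
    cases l₁ with
    | nil =>
      simp only [List.length_nil] at hle
      omega
    | cons q l₁ =>
      simp only [List.cons_append, List.cons.injEq] at hP
      simp [hP.2]
  · have hyc : y ≠ c := fun he => F.yP (he ▸ hc)
    have hrev : (p₀ :: P').reverse = l₂.reverse ++ c :: l₁.reverse := by simp [hP]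
    have hch := h.reverse.conf.chain
    have hnd := h.reverse.conf.nodup
    rw [hrev] at hch hnd
    refine F.path_false (Q := [t]) (m := t) (by simp [ht, htc]) (by simp [ht.ne, htc.ne, hyc])
      (by simp) (by simp only [List.mem_singleton, forall_eq]; exact ⟨htW, htT, htP, htb⟩) hP
      (fun he => hl (by simp [he])) (by simp only [List.length_cons, List.length_nil]; omega) ?_ ?_
    · simp only [List.mem_cons, List.not_mem_nil, or_false]
      rintro d hd hda hdb x (rfl | rfl) hxt hdx
      exacts [F.y_mem hd hda hdb hdx.symm, hxt rfl]
    · simp only [List.mem_cons, List.not_mem_nil, or_false]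
      rintro x (rfl | rfl) q hq hqx
      · exact F.y_path (by simp [hP, hq]) hqx.symm
      · exact h.not_adj_of_length_le_two (List.isChain_append.1 hch).2.1
          (List.nodup_append.1 hnd).2.1 (by rw [List.length_reverse]; omega)
          (fun hm => htP (by rw [List.mem_reverse] at hm; simp [hP, hm])) htc q (by simpa using hq)
          hqx.symm

lemma nny_notMem_arm (F : Fan₂ D p₀ P' A u a y b) (htW : t ∈ W) (ht : G.Adj y t) (hta : t ≠ a)
    (htb : t ≠ b) (hg : G.Adj t g) : g ∉ [p₀, u, a] := by
  rw [mem_arm]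
  rintro (rfl | rfl | rfl)
  · exact F.ny_path htW ht hta htb (by simp) hg
  · exact F.yu (F.fan.min.sq hta ht F.ay.symm hg.symm F.fan.ua)
  · exact F.ny_mem htW ht hta htb F.fan.aA hg

lemma nny_mem (F : Fan₂ D p₀ P' A u a y b) (htW : t ∈ W) (ht : G.Adj y t) (hta : t ≠ a)
    (htb : t ≠ b) (hgW : g ∈ W) (hg : G.Adj t g) (hgy : g ≠ y) (hc : c ∈ A) : ¬ G.Adj g c := by
  intro hgc
  by_cases hca : c = a
  · subst hca
    exact hgy (F.fan.min.sq hta hg.symm hgc ht F.ay.symm)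
  by_cases hcb : c = b
  · subst hcb
    exact hgy (F.fan.min.sq htb hg.symm hgc ht F.yb)
  exact F.center.not_adj_mem₃ htW (F.ny_notMem_arm ht hta) (F.ny_notMem_path ht) htb ht hgW
    (F.nny_notMem_arm htW ht hta htb hg) (fun hm => F.ny_path htW ht hta htb hm hg)
    (fun he => F.ny_mem htW ht hta htb F.bA (he ▸ hg)) hgy (F.ny_notMem ht hta htb) hg hc hca hcb
    hgc

lemma nny_path (F : Fan₂ D p₀ P' A u a y b) (htW : t ∈ W) (ht : G.Adj y t) (hta : t ≠ a)
    (htb : t ≠ b) (hgW : g ∈ W) (hg : G.Adj t g) (hgy : g ≠ y) (hP : P' = pre ++ c :: post)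
    (hlen : post.length ≤ 1) : ¬ G.Adj g c :=
  F.center.not_adj_path₃ F.eq_p₀ htW (F.ny_notMem_arm ht hta) (F.ny_notMem_path ht) htb ht hgW
    (F.nny_notMem_arm htW ht hta htb hg) (fun hm => F.ny_path htW ht hta htb hm hg)
    (fun he => F.ny_mem htW ht hta htb F.bA (he ▸ hg)) hgy hg (pre := p₀ :: pre) (by simp [hP]) hlen
    (F.notMem_arm (by simp [hP]))

lemma nny_p₀ (F : Fan₂ D p₀ P' A u a y b) (htW : t ∈ W) (ht : G.Adj y t) (hta : t ≠ a)
    (htb : t ≠ b) (hgW : g ∈ W) (hg : G.Adj t g) (hgy : g ≠ y) : ¬ G.Adj g p₀ := by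
  intro hgp
  have hgT := F.nny_notMem_arm htW ht hta htb hg
  have htT := F.ny_notMem_arm ht hta
  have htP := F.ny_notMem_path ht
  have hgP : g ∉ p₀ :: P' := fun hm => F.ny_path htW ht hta htb hm hg
  have hyp : y ≠ p₀ := fun he => F.yP (by simp [he])
  have htp : t ≠ p₀ := fun he => htP (by simp [he])
  have h4 := F.fan.four
  refine F.path_false (Q := [t, g]) (m := g) (pre := []) (post := P') (by simp [ht, hg, hgp])
    (by simp [ht.ne, hg.ne, hgp.ne, hyp, htp, hgy.symm]) (by simp) ?_ rfl
    (fun he => by rw [he, List.length_nil] at h4; omega) (by simp) ?_ (by simp)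
  · simp only [List.mem_cons (b := t), List.mem_cons (b := g), List.not_mem_nil, or_false]
    rintro x (rfl | rfl)
    exacts [⟨htW, htT, htP, htb⟩, ⟨hgW, hgT, hgP, fun he => F.ny_mem htW ht hta htb F.bA (he ▸ hg)⟩]
  · simp only [List.mem_cons, List.not_mem_nil, or_false]
    rintro d hd hda hdb x (rfl | rfl | rfl) hxg hdx
    exacts [F.y_mem hd hda hdb hdx.symm, F.ny_mem htW ht hta htb hd hdx.symm, hxg rfl]

/-- A neighbour `w` of `a` other than `u` and `y` does not lie on a path `a w c`. -/
lemma na_false (F : Fan₂ D p₀ P' A u a y b) (hwW : w ∈ W) (hw : G.Adj a w) (hwu : w ≠ u)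
    (hwy : w ≠ y) (hcS : c ∈ S) (hwc : G.Adj w c) (hca : c ≠ a) (hP : P₁ <+: p₀ :: P')
    (hhead : p₀ ∈ P₁.head?) (hPc : ∀ p ∈ p₀ :: P', p ∈ P₁ ∨ p = c) (hcP : c ∉ P₁) : False := by
  have h := F.fan.min
  have huc : u ≠ c := fun he => h.tri hw (he ▸ hwc) F.fan.ua.symm
  have hyc : y ≠ c := fun he => h.tri hw (he ▸ hwc) F.ay
  have hR : SPath G W S (a :: ([w] ++ [c])) :=
    { ne_nil := by simp
      chain := by simp [hw, hwc]
      nodup := by simp [hw.ne, hwc.ne, hca.symm]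
      mem := by
        have := F.fan.aW
        have := F.fan.sub hcS
        simp [*]
      head := by simpa using F.fan.AS F.fan.aA
      last := by simpa using hcS }
  refine h.cut_sep subset_rfl D F.fan.sub (fun d hd _ => F.fan.AS hd) (l := y) (r := u)
    (L := u :: P₁) F.yS F.fan.uS F.ay F.fan.ua.symm F.yu F.cay F.fan.cua.swap hR (by simp)
    (by simp [F.ay.ne.symm, hwy.symm, hyc]) ?_ ?_ ?_ (by simp) ?_
    (fun d hd _ hdR _ => h.eq_of_length_le_three hR.chain hR.nodup (by simp) hdR)
    (fun _ _ d hd hdW => (hdW hd).elim)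
  · refine List.isChain_cons.2 ⟨fun q hq => ?_, isChain_of_infix h.conf.chain hP.isInfix⟩
    exact Option.mem_unique hq hhead ▸ F.fan.pu.symm
  · intro x hx
    rcases List.mem_cons.1 hx with rfl | hx
    exacts [F.fan.uW, h.conf.sub x (hP.subset hx)]
  · intro x hx hxR
    simp only [List.cons_append, List.nil_append, List.mem_cons (b := a), List.mem_cons (b := w),
      List.mem_singleton] at hxR
    rcases List.mem_cons.1 hx with rfl | hx
    · rcases hxR with he | he | he
      exacts [F.fan.ua.ne he, hwu he.symm, huc he]
    · rcases hxR with rfl | rfl | rfl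
      exacts [F.fan.aP (hP.subset hx), F.fan.na_notMem_path hw (hP.subset hx), hcP hx]
  · intro p hp
    refine (hPc p hp).imp (fun hp => by simp [hp]) fun he => by simp [he]

lemma na_mem (F : Fan₂ D p₀ P' A u a y b) (hwW : w ∈ W) (hw : G.Adj a w) (hwu : w ≠ u)
    (hwy : w ≠ y) (hc : c ∈ A) (hca : c ≠ a) : ¬ G.Adj w c := fun hwc =>
  F.na_false hwW hw hwu hwy (F.fan.AS hc) hwc hca (List.prefix_rfl) (by simp) (fun _ => Or.inl)
    (F.fan.min.conf.A_notMem c hc)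

lemma na_path (F : Fan₂ D p₀ P' A u a y b) (hwW : w ∈ W) (hw : G.Adj a w) (hwu : w ≠ u)
    (hwy : w ≠ y) (hc : c ∈ p₀ :: P') : ¬ G.Adj w c := by
  intro hwc
  have hnd := F.fan.min.conf.nodup
  rcases List.mem_cons.1 hc with rfl | hc'
  · exact F.fan.aP (by simp [F.fan.min.sq hwu hw F.fan.ua.symm hwc.symm F.fan.pu])
  obtain ⟨l₁, l₂, hP⟩ := List.append_of_mem hc'
  by_cases hl : l₂ = []
  · subst hl hP
    refine F.na_false hwW hw hwu hwy (F.fan.PS c hc) hwc (fun he => F.fan.aP (he ▸ hc))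
      (P₁ := p₀ :: l₁) ⟨[c], by simp⟩ (by simp) (fun p hp => ?_) ?_
    · simp only [List.mem_cons, List.mem_append, List.not_mem_nil, or_false] at hp ⊢
      tauto
    · intro hm
      rw [← List.cons_append, List.nodup_append] at hnd
      exact hnd.2.2 c hm c (by simp) rfl
  · exact F.fan.na_path hwW hw hP hl hwc

end Fan₂
end SecondFanNeighbours

section ThirdDeletion
open Classical

variable {U : Type*} {G : SimpleGraph U} {z : U} {W S A : Finset U} {P' : List U}
  {p₀ u a y b : U}

namespace Fan₂

variable {D : ParityDrawing (Apex G z W S)} {c t v v' w x p : U}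

lemma uy (F : Fan₂ D p₀ P' A u a y b) : ¬ G.Adj u y := fun huy => F.fan.min.tri F.fan.ua F.ay huy

lemma mem_triple : c ∈ [u, a, y] ↔ c = u ∨ c = a ∨ c = y := by simp

lemma not_good (F : Fan₂ D p₀ P' A u a y b) :
    ¬ WD G ((((W \ (p₀ :: P').toFinset).erase y).erase a).erase u)
      (cap G (A.erase b) (insert u (insert a (insert y (p₀ :: P').toFinset)))) := by
  intro hg
  have h := F.fan.min
  have hua := F.fan.ua.ne
  refine h.bad ?_
  refine WD.save_cap (u := y) (w := b) ?_ ?_ F.yb (by simpa using F.yP) F.yA F.bA ?_ ?_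
  · rw [Finset.mem_sdiff, List.mem_toFinset]
    exact ⟨F.yW, F.yP⟩
  · rw [Finset.mem_sdiff, List.mem_toFinset]
    exact ⟨F.bW, F.bP⟩
  · exact nbrCount_eq_zero fun x hx hxy => F.y_path (List.mem_toFinset.1 hx) hxy.symm
  refine WD.delete_cap (u := a) ?_ ?_ ?_ ?_
  · rw [Finset.mem_erase, Finset.mem_sdiff, List.mem_toFinset]
    exact ⟨F.ay.ne, F.fan.aW, F.fan.aP⟩
  · rw [Finset.mem_insert, List.mem_toFinset, not_or]
    exact ⟨F.ay.ne, F.fan.aP⟩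
  · have hn : nbrCount G (insert y (p₀ :: P').toFinset) a ≤ 1 := nbrCount_le_one (by
      have key : ∀ x ∈ insert y (p₀ :: P').toFinset, G.Adj x a → x = y := fun x hx hxa =>
        (Finset.mem_insert.1 hx).resolve_right fun hx =>
          h.not_adj F.fan.aA (List.mem_toFinset.1 hx) hxa.symm
      exact fun x hx x' hx' hxa hxa' => (key x hx hxa).trans (key x' hx' hxa').symm)
    rw [cap]
    split_ifs <;> omega
  refine WD.delete_cap (u := u) ?_ ?_ ?_ hg
  · rw [Finset.mem_erase, Finset.mem_erase, Finset.mem_sdiff, List.mem_toFinset]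
    exact ⟨hua, F.yu.symm, F.fan.uW, F.fan.uP⟩
  · rw [Finset.mem_insert, Finset.mem_insert, List.mem_toFinset, not_or, not_or]
    exact ⟨hua, F.yu.symm, F.fan.uP⟩
  · have hn : nbrCount G (insert y (p₀ :: P').toFinset) u ≤ 1 := nbrCount_le_one (by
      have key : ∀ x ∈ insert y (p₀ :: P').toFinset, G.Adj x u → x = p₀ := by
        intro x hx hxu
        rcases Finset.mem_insert.1 hx with rfl | hx
        · exact (F.uy hxu.symm).elim
        · exact (List.mem_cons.1 (List.mem_toFinset.1 hx)).resolve_right fun hx =>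
            F.fan.u_path hx hxu.symm
      exact fun x hx x' hx' hxa hxa' => (key x hx hxa).trans (key x' hx' hxa').symm)
    have ha : a ∉ insert y (p₀ :: P').toFinset := by
      rw [Finset.mem_insert, List.mem_toFinset, not_or]
      exact ⟨F.ay.ne, F.fan.aP⟩
    have hins := nbrCount_insert (G := G) (t := u) ha
    rw [if_pos F.fan.ua.symm] at hins
    rw [cap, if_neg fun hm => F.fan.uA (Finset.mem_of_mem_erase hm)]
    omega

/-- The neighbours of `u`, `a`, `y` outside of `P` avoid `A`. -/
lemma triple_mem (F : Fan₂ D p₀ P' A u a y b) (hv : v ∈ [u, a, y]) (hw : w ∈ W)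
    (hwP : w ∉ p₀ :: P') (hwK : w ∉ [u, a, y]) (hvw : G.Adj v w) (hc : c ∈ A) (hca : c ≠ a) :
    ¬ G.Adj w c := by
  rw [mem_triple, not_or, not_or] at hwK
  rcases mem_triple.1 hv with rfl | rfl | rfl
  · exact F.fan.nu_mem hw hvw (fun he => hwP (by simp [he])) hwK.2.1 hc
  · exact F.na_mem hw hvw hwK.1 hwK.2.2 hc hca
  · by_cases hwb : w = b
    · exact hwb ▸ F.fan.min.conf.indep b F.bA c hc
    · exact F.ny_mem hw hvw hwK.2.1 hwb hc

/-- The neighbours of `a`, `y` outside of `P` avoid `P`. -/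
lemma pair_path (F : Fan₂ D p₀ P' A u a y b) (hv : v = a ∨ v = y) (hw : w ∈ W)
    (hwK : w ∉ [u, a, y]) (hvw : G.Adj v w) (hp : p ∈ p₀ :: P') : ¬ G.Adj w p := by
  rw [mem_triple, not_or, not_or] at hwK
  rcases hv with rfl | rfl
  · exact F.na_path hw hvw hwK.1 hwK.2.2 hp
  · by_cases hwb : w = b
    · exact hwb ▸ F.fan.min.not_adj F.bA hp
    · exact F.ny_path hw hvw hwK.2.1 hwb hp

lemma triple_p₀ (F : Fan₂ D p₀ P' A u a y b) (hv : v ∈ [u, a, y]) (hw : w ∈ W)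
    (hwK : w ∉ [u, a, y]) (hvw : G.Adj v w) : ¬ G.Adj w p₀ := by
  rcases mem_triple.1 hv with rfl | hv
  · exact fun hwp => F.fan.min.tri F.fan.pu hvw hwp.symm
  · exact F.pair_path hv hw hwK hvw (by simp)

lemma triple_last (F : Fan₂ D p₀ P' A u a y b) (hv : v ∈ [u, a, y]) (hw : w ∈ W)
    (hwP : w ∉ p₀ :: P') (hwK : w ∉ [u, a, y]) (hvw : G.Adj v w)
    (hp : p ∈ (p₀ :: P').getLast?) : ¬ G.Adj w p := by
  rcases mem_triple.1 hv with rfl | hv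
  · rw [mem_triple, not_or, not_or] at hwK
    obtain ⟨p₁, P'', rfl⟩ := F.fan.exists_eq_cons
    rw [List.getLast?_cons_cons] at hp
    obtain ⟨l, hl⟩ := List.mem_getLast?_eq_getLast hp
    have hP : p₁ :: P'' = (p₁ :: P'').dropLast ++ p :: [] := by
      rw [hl, List.dropLast_append_getLast]
    exact F.fan.nu_path hw hvw (fun he => hwP (by simp [he])) hwK.2.1 hP (by simp)
  · exact F.pair_path hv hw hwK hvw (List.mem_of_mem_getLast? hp)

lemma triple_one (F : Fan₂ D p₀ P' A u a y b) (hv : v ∈ [u, a, y]) (hw : w ∈ W)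
    (hwP : w ∉ p₀ :: P') (hwK : w ∉ [u, a, y]) (hvw : G.Adj v w) :
    ∀ p ∈ p₀ :: P', ∀ q ∈ p₀ :: P', G.Adj w p → G.Adj w q → p = q := by
  intro p hp q hq hwp hwq
  have hp₀ := F.triple_p₀ hv hw hwK hvw
  rcases mem_triple.1 hv with rfl | hv
  · rw [mem_triple, not_or, not_or] at hwK
    refine F.fan.nu_one hw hvw (fun he => hwP (by simp [he])) hwK.2.1 p
      ((List.mem_cons.1 hp).resolve_left fun he => hp₀ (he ▸ hwp)) q
      ((List.mem_cons.1 hq).resolve_left fun he => hp₀ (he ▸ hwq)) hwp hwq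
  · exact (F.pair_path hv hw hwK hvw hp hwp).elim

lemma triple_eq (F : Fan₂ D p₀ P' A u a y b) (hwK : w ∉ [u, a, y]) (hv : v ∈ [u, a, y])
    (hv' : v' ∈ [u, a, y]) (hvw : G.Adj v w) (hvw' : G.Adj v' w) : v = v' := by
  have h := F.fan.min
  rw [mem_triple, not_or, not_or] at hwK
  rcases mem_triple.1 hv with rfl | rfl | rfl <;> rcases mem_triple.1 hv' with rfl | rfl | rfl
  · rfl
  · exact (h.tri F.fan.ua hvw' hvw).elim
  · exact h.sq hwK.2.1 hvw F.fan.ua hvw' F.ay.symm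
  · exact (h.tri F.fan.ua hvw hvw').elim
  · rfl
  · exact (h.tri F.ay hvw' hvw).elim
  · exact h.sq hwK.2.1 hvw F.ay.symm hvw' F.fan.ua
  · exact (h.tri F.ay hvw hvw').elim
  · rfl

lemma triple_indep (F : Fan₂ D p₀ P' A u a y b)
    (hno : ∀ x ∈ W, x ≠ p₀ → x ≠ a → G.Adj u x → ∀ t ∈ W, t ≠ a → t ≠ b → G.Adj y t → ¬ G.Adj x t)
    (hv : v ∈ [u, a, y]) (hv' : v' ∈ [u, a, y]) (hw : w ∈ W) (hx : x ∈ W) (hwP : w ∉ p₀ :: P')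
    (hxP : x ∉ p₀ :: P') (hwK : w ∉ [u, a, y]) (hxK : x ∉ [u, a, y]) (hvw : G.Adj v w)
    (hvx : G.Adj v' x) : ¬ G.Adj w x := by
  have h := F.fan.min
  have k1 : ∀ {x w}, G.Adj u x → G.Adj a w → x ≠ a → w ≠ u → ¬ G.Adj x w :=
    fun hx hw hxa hwu hxw => hwu (h.sq hxa hxw.symm hw.symm hx F.fan.ua)
  have k2 : ∀ {t w}, G.Adj y t → G.Adj a w → t ≠ a → w ≠ y → ¬ G.Adj t w :=
    fun ht hw hta hwy htw => hwy (h.sq hta htw.symm hw.symm ht F.ay.symm)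
  have k3 : ∀ {x t}, x ∈ W → t ∈ W → x ∉ p₀ :: P' → x ∉ [u, a, y] → t ∉ [u, a, y] → G.Adj u x →
      G.Adj y t → ¬ G.Adj x t := by
    intro x t hxW htW hxP hxK htK hx ht
    rw [mem_triple, not_or, not_or] at hxK htK
    have hxp : x ≠ p₀ := fun he => hxP (by simp [he])
    by_cases htb : t = b
    · exact htb ▸ F.fan.nu_mem hxW hx hxp hxK.2.1 F.bA
    · exact hno x hxW hxp hxK.2.1 hx t htW htK.2.1 htb ht
  intro hwx
  have hwK' := hwK
  have hxK' := hxK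
  rw [mem_triple, not_or, not_or] at hwK' hxK'
  rcases mem_triple.1 hv with rfl | rfl | rfl <;> rcases mem_triple.1 hv' with rfl | rfl | rfl
  · exact h.tri hvw hwx hvx
  · exact k1 hvw hvx hwK'.2.1 hxK'.1 hwx
  · exact k3 hw hx hwP hwK hxK hvw hvx hwx
  · exact k1 hvx hvw hxK'.2.1 hwK'.1 hwx.symm
  · exact h.tri hvw hwx hvx
  · exact k2 hvx hvw hxK'.2.1 hwK'.2.2 hwx.symm
  · exact k3 hx hw hxP hxK hwK hvx hvw hwx.symm
  · exact k2 hvw hvx hwK'.2.1 hxK'.2.2 hwx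
  · exact h.tri hvw hwx hvx

lemma triple_AK (F : Fan₂ D p₀ P' A u a y b) (hc : c ∈ A.erase b) (hca : c ≠ a)
    (hv : v ∈ [u, a, y]) : ¬ G.Adj v c := by
  obtain ⟨hcb, hc⟩ := Finset.mem_erase.1 hc
  rcases mem_triple.1 hv with rfl | rfl | rfl
  exacts [F.fan.u_mem hc hca, F.fan.min.conf.indep v F.fan.aA c hc, F.y_mem hc hca hcb]

/-- Some neighbours of `u` and `y` are joined by an edge. -/
lemma exists_adj_adj (F : Fan₂ D p₀ P' A u a y b) : ∃ x ∈ W, x ≠ p₀ ∧ x ≠ a ∧ G.Adj u x ∧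
    ∃ t ∈ W, t ≠ a ∧ t ≠ b ∧ G.Adj y t ∧ G.Adj x t := by
  by_contra hcon
  push Not at hcon
  have h := F.fan.min
  have hg := h.delete (K := [u, a, y]) (P' := p₀ :: P') (A₀ := A.erase b) (Finset.erase_subset _ _)
    (v₀ := u) (by simp) F.fan.uW List.infix_rfl (fun _ hx => Or.inl hx) ?_ ?_
    (fun c hc hcK v hv w hw hwP hwK hvw hcw => F.triple_mem hv hw hwP hwK hvw hc
      (fun he => hcK (by simp [he])) hcw.symm)
    (fun v hv w hw hwP hwK hvw v' hv' w' hw' hwP' hwK' hvw' => F.triple_indep hcon hv hv' hw hw'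
      hwP hwP' hwK hwK' hvw hvw')
    (fun v hv w hw hwP hwK hvw => F.triple_one hv hw hwP hwK hvw) ?_
    (fun v hv w hw hwP hwK hvw p hp hwp => (F.triple_last hv hw hwP hwK hvw hp hwp).elim)
    (fun c hc hcK v hv _ => F.triple_AK hc (fun he => hcK (by simp [he])) hv)
    (fun w _ _ hwK v hv v' hv' => F.triple_eq hwK hv hv')
  · refine F.not_good ?_
    have h1 : (((W \ (p₀ :: P').toFinset).erase y).erase a).erase u =
        (W \ (p₀ :: P').toFinset) \ [u, a, y].toFinset := by
      ext x; simp; tauto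
    have h2 : insert u (insert a (insert y (p₀ :: P').toFinset)) =
        (p₀ :: P').toFinset ∪ [u, a, y].toFinset := by
      ext x; simp; tauto
    rwa [h1, h2]
  · intro x hx hm
    rcases mem_triple.1 hm with rfl | rfl | rfl
    exacts [F.fan.uP hx, F.fan.aP hx, F.yP hx]
  · intro W' S' hW' hS'
    refine ParityDrawing.contract_list h.conf.z_notMem D F.fan.sub (L := [u, a, y])
      (by simp [F.fan.ua.ne, F.ay.ne, F.yu.symm]) ?_ hW' fun x hx => ?_
    · intro x hx
      rcases mem_triple.1 hx with rfl | rfl | rfl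
      exacts [F.fan.uS, F.fan.AS F.fan.aA, F.yS]
    · exact ⟨(hS' x hx).1, (hS' x hx).2.imp_left fun hx =>
        hx.elim (F.fan.PS x) (fun hx => F.fan.AS hx)⟩
  · intro v hv w hw _ hwK hvw p hp
    have hp' : p₀ = p := by simpa using hp
    exact hp' ▸ F.triple_p₀ hv hw hwK hvw

end Fan₂
end ThirdDeletion

section FanQuadrilateral
open Classical

variable {U : Type*} {G : SimpleGraph U} {z : U} {W S A : Finset U} {P' : List U}
  {p₀ u a y b x t : U}

/-- Two adjacent vertices `x`, `t` attached to the vertices `u`, `y` of a `Fan₂`. -/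
structure Fan₃ (D : ParityDrawing (Apex G z W S)) (p₀ : U) (P' : List U) (A : Finset U)
    (u a y b x t : U) : Prop where
  fan₂ : Fan₂ D p₀ P' A u a y b
  xW : x ∈ W
  xp : x ≠ p₀
  xa : x ≠ a
  ux : G.Adj u x
  tW : t ∈ W
  ta : t ≠ a
  tb : t ≠ b
  yt : G.Adj y t
  xt : G.Adj x t

namespace Fan₃

variable {D : ParityDrawing (Apex G z W S)} {c w : U}

lemma ut (F : Fan₃ D p₀ P' A u a y b x t) : u ≠ t := fun he => F.fan₂.uy (he ▸ F.yt.symm)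

lemma xy (F : Fan₃ D p₀ P' A u a y b x t) : x ≠ y := fun he => F.fan₂.uy (he ▸ F.ux)

lemma xP (F : Fan₃ D p₀ P' A u a y b x t) : x ∉ p₀ :: P' := F.fan₂.fan.nu_notMem_path F.ux F.xp

lemma xA (F : Fan₃ D p₀ P' A u a y b x t) : x ∉ A := F.fan₂.fan.nu_notMem F.ux F.xa

lemma tP (F : Fan₃ D p₀ P' A u a y b x t) : t ∉ p₀ :: P' := F.fan₂.ny_notMem_path F.yt

lemma tA (F : Fan₃ D p₀ P' A u a y b x t) : t ∉ A := F.fan₂.ny_notMem F.yt F.ta F.tb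

lemma x_mem (F : Fan₃ D p₀ P' A u a y b x t) (hc : c ∈ A) : ¬ G.Adj x c :=
  F.fan₂.fan.nu_mem F.xW F.ux F.xp F.xa hc

lemma t_mem (F : Fan₃ D p₀ P' A u a y b x t) (hc : c ∈ A) : ¬ G.Adj t c :=
  F.fan₂.ny_mem F.tW F.yt F.ta F.tb hc

lemma mem_quad : c ∈ [u, x, t, y] ↔ c = u ∨ c = x ∨ c = t ∨ c = y := by simp

lemma a_notMem (F : Fan₃ D p₀ P' A u a y b x t) : a ∉ [u, x, t, y] := by
  rw [mem_quad]
  rintro (he | he | he | he)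
  exacts [F.fan₂.fan.ua.ne he.symm, F.xa he.symm, F.ta he.symm, F.fan₂.ay.ne he]

lemma b_notMem (F : Fan₃ D p₀ P' A u a y b x t) : b ∉ [u, x, t, y] := by
  rw [mem_quad]
  rintro (he | he | he | he)
  exacts [F.fan₂.fan.uA (he ▸ F.fan₂.bA), F.xA (he ▸ F.fan₂.bA), F.tb he.symm,
    F.fan₂.yA (he ▸ F.fan₂.bA)]

lemma path_notMem (F : Fan₃ D p₀ P' A u a y b x t) : ∀ p ∈ p₀ :: P', p ∉ [u, x, t, y] := by
  intro p hp hm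
  rcases mem_quad.1 hm with rfl | rfl | rfl | rfl
  exacts [F.fan₂.fan.uP hp, F.xP hp, F.tP hp, F.fan₂.yP hp]

lemma spath (F : Fan₃ D p₀ P' A u a y b x t) : SPath G W S [u, x, t, y] where
  ne_nil := by simp
  chain := by simp [F.ux, F.xt, F.yt.symm]
  nodup := by simp [F.ux.ne, F.ut, F.fan₂.yu.symm, F.xt.ne, F.xy, F.yt.ne.symm]
  mem := by simp [F.fan₂.fan.uW, F.xW, F.tW, F.fan₂.yW]
  head := by simpa using F.fan₂.fan.uS
  last := by simpa using F.fan₂.yS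

lemma side_b (F : Fan₃ D p₀ P' A u a y b x t) :
    D.side z [u, x, t, y] b ≠ D.side z [u, x, t, y] a := by
  have hF := F.fan₂.fan
  obtain ⟨K₁, hK₁⟩ := F.fan₂.cay.swap
  obtain ⟨K₂, hK₂⟩ := F.fan₂.cyb
  have hrev : [u, x, t, y].reverse = y :: ([t, x] ++ [u]) := by simp
  have hm : ∀ {c}, c ∉ [u, x, t, y] → c ∉ y :: ([t, x] ++ [u]) := fun hc hm =>
    hc (List.mem_reverse.1 (hrev ▸ hm))
  have := D.side_ne hF.min.conf.z_notMem hF.sub F.fan₂.yS (hF.AS hF.aA) (hF.AS F.fan₂.bA) hF.uS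
    F.fan₂.ay.symm F.fan₂.yb F.fan₂.ba.symm hK₁ hK₂ (hrev ▸ F.spath.reverse) (hm F.a_notMem)
    (hm F.b_notMem)
  rw [← hrev, D.side_reverse, D.side_reverse] at this
  intro he
  grind

lemma side_path (F : Fan₃ D p₀ P' A u a y b x t) :
    ∀ p ∈ p₀ :: P', D.side z [u, x, t, y] p ≠ D.side z [u, x, t, y] a := by
  intro p hp
  have hF := F.fan₂.fan
  have hz := hF.min.conf.z_notMem
  obtain ⟨K₁, hK₁⟩ := hF.cpu.swap
  obtain ⟨K₂, hK₂⟩ := hF.cua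
  have hpa : p₀ ≠ a := fun he => hF.aP (by simp [he])
  have := D.side_ne (Q := [x, t]) hz hF.sub hF.uS (hF.PS p₀ (by simp)) (hF.AS hF.aA) F.fan₂.yS
    hF.pu.symm hF.ua hpa hK₁ hK₂ F.spath (F.path_notMem p₀ (by simp)) F.a_notMem
  rw [D.side_eq_of_chain hz F.spath hF.min.conf.chain hF.min.conf.sub F.path_notMem p hp p₀
    (by simp)]
  intro he
  change D.side z [u, x, t, y] p₀ + D.side z [u, x, t, y] a = 1 at this
  grind

/-- The vertex `a` is alone on its side. -/
lemma cls_eq (F : Fan₃ D p₀ P' A u a y b x t) (hc : c ∈ W) (hcR : c ∉ [u, x, t, y])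
    (hca : D.side z [u, x, t, y] c = D.side z [u, x, t, y] a) : c = a := by
  by_contra hne
  have hF := F.fan₂.fan
  have h := hF.min
  have hz := h.conf.z_notMem
  set C := (D.cls [u, x, t, y] (D.side z [u, x, t, y] a)).erase a with hC
  have hmem : ∀ {c}, c ∈ C ↔ c ≠ a ∧ c ∈ W ∧ c ∉ [u, x, t, y] ∧
      D.side z [u, x, t, y] c = D.side z [u, x, t, y] a := by
    intro c
    rw [hC, Finset.mem_erase, D.mem_cls]
  have hRW : ∀ d ∈ [a, u, x, t, y], d ∈ W := by
    simp [hF.aW, hF.uW, F.xW, F.tW, F.fan₂.yW]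
  have hCR : ∀ d ∈ [a, u, x, t, y], d ∉ C := by
    intro d hd hdC
    obtain ⟨h1, -, h2, -⟩ := hmem.1 hdC
    exact (List.mem_cons.1 hd).elim h1 h2
  have hCW : C ⊆ W := fun d hd => (hmem.1 hd).2.1
  have hCA : ∀ d ∈ A ∩ C, ∀ r ∈ [a, u, x, t, y], ¬ G.Adj d r := by
    intro d hd r hr
    obtain ⟨hdA, hdC⟩ := Finset.mem_inter.1 hd
    obtain ⟨hda, -, -, hds⟩ := hmem.1 hdC
    have hdb : d ≠ b := fun he => F.side_b (he ▸ hds)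
    rcases List.mem_cons.1 hr with rfl | hr
    · exact h.conf.indep d hdA r hF.aA
    · rcases mem_quad.1 hr with rfl | rfl | rfl | rfl
      exacts [fun hd => hF.u_mem hdA hda hd.symm, fun hd => F.x_mem hdA hd.symm,
        fun hd => F.t_mem hdA hd.symm, fun hd => F.fan₂.y_mem hdA hda hdb hd.symm]
  have hconf : Conf G z (C ∪ [a, u, x, t, y].toFinset) [a, u, x, t, y] (A ∩ C) :=
    { z_notMem := by
        rw [Finset.mem_union, List.mem_toFinset]
        exact fun hm => hz (hm.elim (fun hm => hCW hm) (hRW z))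
      nodup := List.nodup_cons.2 ⟨F.a_notMem, F.spath.nodup⟩
      chain := List.isChain_cons_cons.2 ⟨hF.ua.symm, F.spath.chain⟩
      sub := fun d hd => Finset.mem_union_right _ (List.mem_toFinset.2 hd)
      length_le := by simp
      A_sub := fun d hd => Finset.mem_union_left _ (Finset.mem_inter.1 hd).2
      A_notMem := fun d hd hdR => hCR d hdR (Finset.mem_inter.1 hd).2
      indep := fun d hd e he =>
        h.conf.indep d (Finset.mem_inter.1 hd).1 e (Finset.mem_inter.1 he).1
      one := fun d hd p hp q hq hdp => (hCA d hd p hp hdp).elim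
      head := fun d hd p hp hdp => (hCA d hd p (List.mem_of_mem_head? hp) hdp).elim
      last := fun d hd p hp hdp => (hCA d hd p (List.mem_of_mem_getLast? hp) hdp).elim
      both := fun d hd p hp hdp => (hCA d hd p (List.mem_of_mem_head? hp) hdp).elim
      drawing := by
        obtain ⟨D'⟩ := D.split hz F.spath
          (h.noChord F.spath.chain F.spath.nodup (by simp)) (D.side z [u, x, t, y] a)
        have haC : a ∈ D.cls [u, x, t, y] (D.side z [u, x, t, y] a) :=
          D.mem_cls.2 ⟨hF.aW, F.a_notMem, rfl⟩
        refine ⟨D'.mono fun e f => Apex.mono ?_ ?_ e f⟩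
        · intro d hd
          rw [Finset.mem_union, List.mem_toFinset] at hd ⊢
          rcases hd with hd | hd
          · exact Or.inl (Finset.mem_of_mem_erase hd)
          · exact (List.mem_cons.1 hd).imp_left (by rintro rfl; exact haC)
        · intro d hd
          rw [Finset.mem_union, List.mem_toFinset] at hd ⊢
          rw [Finset.mem_inter]
          rcases hd with hd | hd
          · exact (List.mem_cons.1 hd).imp_left (by rintro rfl; exact ⟨hF.AS hF.aA, haC⟩)
          · obtain ⟨hdA, hdC⟩ := Finset.mem_inter.1 hd
            exact Or.inl ⟨hF.AS hdA, Finset.mem_of_mem_erase hdC⟩ }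
  refine h.cut_off hconf hCW hRW hCR (fun p hp hpC => F.side_path p hp (hmem.1 hpC).2.2.2) ?_
    (hmem.2 ⟨hne, hc, hcR, hca⟩) F.fan₂.bW (fun hb => F.side_b (hmem.1 hb).2.2.2) ?_
  · intro d hd e he hed
    obtain ⟨-, h1, h2, h3⟩ := hmem.1 hd
    rw [or_iff_not_imp_right, List.mem_cons, not_or]
    rintro ⟨hea, heR⟩
    exact hmem.2 ⟨hea, he, heR, by rw [D.side_eq_of_adj hz F.spath he h1 heR h2 hed, h3]⟩
  · rw [List.mem_cons, not_or]
    exact ⟨F.fan₂.ba, F.b_notMem⟩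

lemma na (F : Fan₃ D p₀ P' A u a y b x t) (hw : w ∈ W) (haw : G.Adj a w) : w = u ∨ w = y := by
  have hF := F.fan₂.fan
  have h := hF.min
  by_contra! hne
  have hwR : w ∉ [u, x, t, y] := by
    rw [mem_quad]
    rintro (he | rfl | rfl | he)
    exacts [hne.1 he, h.tri hF.ua haw F.ux, h.tri F.fan₂.ay F.yt haw, hne.2 he]
  exact haw.ne (F.cls_eq hw hwR
    (D.side_eq_of_adj h.conf.z_notMem F.spath hw hF.aW hwR F.a_notMem haw.symm)).symm

/-- The drawing after the removal of `a`, with `x` and `t` joined to the apex. -/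
lemma exists_drawing (F : Fan₃ D p₀ P' A u a y b x t) :
    ∃ D' : ParityDrawing (Apex G z (W.erase a) (insert t (insert x (S.erase a)))),
      D'.ConstSide [u, x] ∧ D'.ConstSide [x, t] ∧ D'.ConstSide [t, y] ∧
        D'.ConstSide [p₀, u] := by
  have hF := F.fan₂.fan
  have h := hF.min
  have hz : z ∉ W.erase a := fun hz => h.conf.z_notMem (Finset.mem_of_mem_erase hz)
  set D₀ : ParityDrawing (Apex G z (W.erase a) (S.erase a)) := D.mono fun e f =>
    Apex.mono (Finset.erase_subset _ _) (Finset.erase_subset _ _) e f with hD₀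
  have hS : SPath G (W.erase a) (S.erase a) [u, x, t, y] :=
    { ne_nil := by simp
      chain := F.spath.chain
      nodup := F.spath.nodup
      mem := fun c hc => Finset.mem_erase.2 ⟨fun he => F.a_notMem (he ▸ hc), F.spath.mem c hc⟩
      head := by simpa using ⟨hF.ua.ne, hF.uS⟩
      last := by simpa using ⟨F.fan₂.ay.ne.symm, F.fan₂.yS⟩ }
  have hc₀ : D₀.ConstSide [u, x, t, y] := by
    refine ⟨D.side z [u, x, t, y] a + 1, fun c hc hcR => ?_⟩
    change D.side z [u, x, t, y] c = _
    obtain ⟨hca, hcW⟩ := Finset.mem_erase.1 hc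
    have := fun he => hca (F.cls_eq hcW hcR he)
    generalize D.side z [u, x, t, y] c = k at *
    generalize D.side z [u, x, t, y] a = l at *
    revert this
    revert k l
    decide
  have hp₀ : D₀.ConstSide [p₀, u] := by
    obtain ⟨K, hK⟩ := hF.cpu
    exact ⟨K, fun c hc => hK c (Finset.mem_of_mem_erase hc)⟩
  have htp : t ≠ p₀ := fun he => F.tP (by simp [he])
  have hch : ∀ c ∈ [u], ∀ d ∈ [t, y], ¬ G.Adj c d := by
    simpa using ⟨fun hut => h.tri F.ux F.xt hut, F.fan₂.uy⟩
  have hch' : ∀ c ∈ [x], ∀ d ∈ [y], ¬ G.Adj c d := by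
    simpa using fun hxy => h.tri F.xt F.yt.symm hxy
  have hS₁ : SPath G (W.erase a) (insert x (S.erase a)) [x, t, y] :=
    { ne_nil := by simp
      chain := (List.isChain_cons_cons.1 F.spath.chain).2
      nodup := (List.nodup_cons.1 F.spath.nodup).2
      mem := fun c hc => hS.mem c (List.mem_cons_of_mem _ hc)
      head := by simp
      last := fun c hc => Finset.mem_insert_of_mem (hS.last c (by simpa using hc)) }
  obtain ⟨D₁, h1, h2, h3⟩ := D₀.exists_add_edge hz (R₁ := [u]) (R₂ := [t, y]) (u := x) hS hch
    (by simp) (by simp) hc₀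
  obtain ⟨D₂, h4, h5, h6⟩ := D₁.exists_add_edge hz (R₁ := [x]) (R₂ := [y]) (u := t) hS₁ hch'
    (by simp) (by simp) h2
  refine ⟨D₂, h6 _ ?_ h1, h4, h5, h6 _ ?_ (h3 _ ?_ hp₀)⟩
  · simp [F.ut.symm, F.xt.ne.symm]
  · simp [F.ut.symm, htp]
  · simp [F.ux.ne.symm, F.xp]

end Fan₃
end FanQuadrilateral

section FanQuadrilateralNeighbours
open Classical

variable {U : Type*} {G : SimpleGraph U} {z : U} {W S A : Finset U} {P' : List U}
  {p₀ u a y b x t : U}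

namespace Fan₃

variable {D : ParityDrawing (Apex G z W S)} {c g h' t' x' s l r k : U} {Q L : List U}
  {D' : ParityDrawing (Apex G z (W.erase a) (insert t (insert x (S.erase a))))}

lemma uS' (F : Fan₃ D p₀ P' A u a y b x t) : u ∈ insert t (insert x (S.erase a)) := by
  simp [F.fan₂.fan.uS, F.fan₂.fan.ua.ne]

lemma yS' (F : Fan₃ D p₀ P' A u a y b x t) : y ∈ insert t (insert x (S.erase a)) := by
  simp [F.fan₂.yS, F.fan₂.ay.ne.symm]

lemma PS' (F : Fan₃ D p₀ P' A u a y b x t) :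
    ∀ p ∈ p₀ :: P', p ∈ insert t (insert x (S.erase a)) := by
  intro p hp
  simp only [Finset.mem_insert, Finset.mem_erase]
  exact Or.inr (Or.inr ⟨fun he => F.fan₂.fan.aP (he ▸ hp), F.fan₂.fan.PS p hp⟩)

lemma sub' (F : Fan₃ D p₀ P' A u a y b x t) : insert t (insert x (S.erase a)) ⊆ W.erase a := by
  intro c hc
  simp only [Finset.mem_insert, Finset.mem_erase] at hc ⊢
  rcases hc with rfl | rfl | ⟨hca, hc⟩
  exacts [⟨F.ta, F.tW⟩, ⟨F.xa, F.xW⟩, ⟨hca, F.fan₂.fan.sub hc⟩]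

lemma cut (F : Fan₃ D p₀ P' A u a y b x t) (hl : l ∈ insert t (insert x (S.erase a)))
    (hr : r ∈ insert t (insert x (S.erase a))) (hsl : G.Adj s l) (hsr : G.Adj s r) (hlr : l ≠ r)
    (hcl : D'.ConstSide [s, l]) (hcr : D'.ConstSide [s, r])
    (hR : SPath G (W.erase a) (insert t (insert x (S.erase a))) (s :: (Q ++ [k])))
    (hQ : Q.length ≤ 2) (hlR : l ∉ s :: (Q ++ [k])) (hL : L.IsChain G.Adj)
    (hLW : ∀ c ∈ L, c ∈ W.erase a) (hLR : ∀ c ∈ L, c ∉ s :: (Q ++ [k])) (hrL : r ∈ L)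
    (hP : ∀ p ∈ p₀ :: P', p ∈ L) {m : U}
    (hone : ∀ c ∈ A, c ≠ a → ∀ d ∈ s :: (Q ++ [k]), G.Adj c d → d = m)
    (hv : ∀ v, v = u ∨ v = y → v ∉ s :: (Q ++ [k]) →
      D'.side z (s :: (Q ++ [k])) v ≠ D'.side z (s :: (Q ++ [k])) l) : False := by
  have hF := F.fan₂.fan
  refine hF.min.cut_sep (Finset.erase_subset _ _) D' F.sub' ?_ hl hr hsl hsr hlr hcl hcr hR hQ hlR
    hL hLW hLR hrL (fun p hp => Or.inl (hP p hp)) ?_ ?_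
  · intro c hc hcW
    simp only [Finset.mem_insert, Finset.mem_erase]
    exact Or.inr (Or.inr ⟨Finset.ne_of_mem_erase hcW, hF.AS hc⟩)
  · intro c hc hcW _ _ d hd e he hcd hce
    have hca := Finset.ne_of_mem_erase hcW
    exact (hone c hc hca d hd hcd).trans (hone c hc hca e he hce).symm
  · intro v hv' d hd hdW hdv
    have hda : d = a := by
      by_contra hne
      exact hdW (Finset.mem_erase.2 ⟨hne, hd⟩)
    subst hda
    obtain ⟨hvW, hvR, hvl⟩ := D'.mem_cls.1 hv'
    exact (hv v (F.na (Finset.mem_of_mem_erase hvW) hdv) hvR hvl).elim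

lemma t'_mem (F : Fan₃ D p₀ P' A u a y b x t) (htW' : t' ∈ W) (hyt' : G.Adj y t') (hta' : t' ≠ a)
    (hc : c ∈ A) : ¬ G.Adj t' c := by
  by_cases htb : t' = b
  · exact htb ▸ F.fan₂.fan.min.conf.indep b F.fan₂.bA c hc
  · exact F.fan₂.ny_mem htW' hyt' hta' htb hc

lemma g_mem (F : Fan₃ D p₀ P' A u a y b x t) (hgW : g ∈ W) (hxg : G.Adj x g) (hgu : g ≠ u)
    (hgP : g ∉ p₀ :: P') (hc : c ∈ A) : ¬ G.Adj g c := by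
  by_cases hca : c = a
  · exact fun hgc => hgu (F.fan₂.fan.min.sq F.xa hxg.symm (hca ▸ hgc) F.ux F.fan₂.fan.ua)
  · exact F.fan₂.fan.nnu_mem F.xW F.ux F.xp F.xa hgW hxg hgu hgP hc hca

lemma h_notMem_path (F : Fan₃ D p₀ P' A u a y b x t) (hth : G.Adj t h') : h' ∉ p₀ :: P' :=
  fun hm => F.fan₂.ny_path F.tW F.yt F.ta F.tb hm hth

lemma xt_indep (F : Fan₃ D p₀ P' A u a y b x t) (hcux : D'.ConstSide [u, x])
    (hcxt : D'.ConstSide [x, t]) (hgW : g ∈ W) (hxg : G.Adj x g) (hgu : g ≠ u) (hgt : g ≠ t)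
    (hgP : g ∉ p₀ :: P') (htW' : t' ∈ W) (hyt' : G.Adj y t') (hta' : t' ≠ a) (htt' : t' ≠ t) :
    ¬ G.Adj g t' := by
  intro hgt'
  have hF := F.fan₂.fan
  have h := hF.min
  have hz : z ∉ W.erase a := fun hz => h.conf.z_notMem (Finset.mem_of_mem_erase hz)
  have hxt' : x ≠ t' := fun he => h.tri F.yt F.xt.symm (he ▸ hyt')
  have hgy : g ≠ y := fun he => h.tri F.xt F.yt.symm (he ▸ hxg)
  have hut' : u ≠ t' := fun he => F.fan₂.uy (he ▸ hyt'.symm)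
  have hga : g ≠ a := fun he => F.x_mem hF.aA (he ▸ hxg)
  have htP' := F.fan₂.ny_notMem_path hyt'
  have hR : SPath G (W.erase a) (insert t (insert x (S.erase a))) (x :: ([g, t'] ++ [y])) :=
    { ne_nil := by simp
      chain := by simp [hxg, hgt', hyt'.symm]
      nodup := by simp [hxg.ne, hxt', F.xy, hgt'.ne, hgy, hyt'.ne.symm]
      mem := by
        simp [F.xa, F.xW, hga, hgW, hta', htW', F.fan₂.ay.ne.symm, F.fan₂.yW]
      head := by simp
      last := by simpa using F.yS' }
  have hmem : ∀ {c}, c ∈ x :: ([g, t'] ++ [y]) → c = x ∨ c = g ∨ c = t' ∨ c = y := by simp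
  have htR : t ∉ x :: ([g, t'] ++ [y]) := by
    intro hm
    rcases hmem hm with he | he | he | he
    exacts [F.xt.ne he.symm, hgt he.symm, htt' he.symm, F.yt.ne he.symm]
  have huR : u ∉ x :: ([g, t'] ++ [y]) := by
    intro hm
    rcases hmem hm with he | he | he | he
    exacts [F.ux.ne he, hgu he.symm, hut' he, F.fan₂.yu he.symm]
  obtain ⟨K₁, hK₁⟩ := id hcxt
  obtain ⟨K₂, hK₂⟩ := hcux.swap
  have hsep := D'.side_ne hz F.sub' (by simp) (by simp) F.uS' F.yS' F.xt F.ux.symm F.ut.symm hK₁ hK₂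
    hR htR huR
  refine F.cut (by simp) F.uS' F.xt F.ux.symm F.ut.symm hcxt hcux.swap hR (by simp) htR
    (L := u :: p₀ :: P') (List.isChain_cons_cons.2 ⟨hF.pu.symm, h.conf.chain⟩) ?_ ?_ (by simp)
    (fun p hp => List.mem_cons_of_mem _ hp) (m := y) ?_ ?_
  · intro c hc
    rw [Finset.mem_erase]
    rcases List.mem_cons.1 hc with rfl | hc
    exacts [⟨hF.ua.ne, hF.uW⟩, ⟨fun he => hF.aP (he ▸ hc), h.conf.sub c hc⟩]
  · intro c hc hm
    rcases List.mem_cons.1 hc with rfl | hc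
    · exact huR hm
    · rcases hmem hm with rfl | rfl | rfl | rfl
      exacts [F.xP hc, hgP hc, htP' hc, F.fan₂.yP hc]
  · intro c hc hca d hd hcd
    rcases hmem hd with rfl | rfl | rfl | rfl
    exacts [(F.x_mem hc hcd.symm).elim, (F.g_mem hgW hxg hgu hgP hc hcd.symm).elim,
      (F.t'_mem htW' hyt' hta' hc hcd.symm).elim, rfl]
  · rintro v (rfl | rfl) hvR
    · intro he
      rw [he] at hsep
      grind
    · exact (hvR (by simp)).elim

lemma tu_indep (F : Fan₃ D p₀ P' A u a y b x t) (hcux : D'.ConstSide [u, x])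
    (hcxt : D'.ConstSide [x, t]) (hcty : D'.ConstSide [t, y]) (hcpu : D'.ConstSide [p₀, u])
    (hhW : h' ∈ W) (hth : G.Adj t h') (hhx : h' ≠ x) (hhy : h' ≠ y) (hxW' : x' ∈ W)
    (hux' : G.Adj u x') (hxa' : x' ≠ a) (hxx' : x' ≠ x) (hxP' : x' ∉ p₀ :: P') :
    ¬ G.Adj x' h' := by
  intro hxh
  have hF := F.fan₂.fan
  have h := hF.min
  have hz : z ∉ W.erase a := fun hz => h.conf.z_notMem (Finset.mem_of_mem_erase hz)
  have huh : u ≠ h' := fun he => h.tri F.ux F.xt (he ▸ hth.symm)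
  have hxt' : x' ≠ t := fun he => h.tri F.ux F.xt (he ▸ hux')
  have hxy' : x' ≠ y := fun he => F.fan₂.uy (he ▸ hux')
  have hha : h' ≠ a := fun he => F.t_mem hF.aA (he ▸ hth)
  have hhP := F.h_notMem_path hth
  have hxp' : x' ≠ p₀ := fun he => hxP' (by simp [he])
  have hR : SPath G (W.erase a) (insert t (insert x (S.erase a))) (u :: ([x', h'] ++ [t])) :=
    { ne_nil := by simp
      chain := by simp [hux', hxh, hth.symm]
      nodup := by simp [hux'.ne, huh, F.ut, hxh.ne, hxt', hth.ne.symm]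
      mem := by
        simp [hF.ua.ne, hF.uW, hxa', hxW', hha, hhW, F.ta, F.tW]
      head := by simpa using F.uS'
      last := by simp }
  have hmem : ∀ {c}, c ∈ u :: ([x', h'] ++ [t]) → c = u ∨ c = x' ∨ c = h' ∨ c = t := by simp
  have hxR : x ∉ u :: ([x', h'] ++ [t]) := by
    intro hm
    rcases hmem hm with he | he | he | he
    exacts [F.ux.ne he.symm, hxx' he.symm, hhx he.symm, F.xt.ne he]
  have hyR : y ∉ u :: ([x', h'] ++ [t]) := by
    intro hm
    rcases hmem hm with he | he | he | he
    exacts [F.fan₂.yu he, hxy' he.symm, hhy he.symm, F.yt.ne he]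
  have hPR : ∀ p ∈ p₀ :: P', p ∉ u :: ([x', h'] ++ [t]) := by
    intro p hp hm
    rcases hmem hm with rfl | rfl | rfl | rfl
    exacts [hF.uP hp, hxP' hp, hhP hp, F.tP hp]
  refine F.cut (by simp) (F.PS' p₀ (by simp)) F.ux hF.pu.symm F.xp hcux hcpu.swap hR (by simp) hxR
    h.conf.chain (fun p hp => F.sub' (F.PS' p hp)) hPR (by simp) (fun _ hp => hp) (m := u) ?_ ?_
  · intro c hc hca d hd hcd
    rcases hmem hd with rfl | rfl | rfl | rfl
    exacts [rfl, (hF.nu_mem hxW' hux' hxp' hxa' hc hcd.symm).elim,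
      (F.fan₂.nny_mem F.tW F.yt F.ta F.tb hhW hth hhy hc hcd.symm).elim,
      (F.t_mem hc hcd.symm).elim]
  · rintro v (rfl | rfl) hvR
    · exact (hvR (by simp)).elim
    · have hrev : (u :: ([x', h'] ++ [t])).reverse = t :: ([h', x'] ++ [u]) := by simp
      have hm : ∀ {c}, c ∉ u :: ([x', h'] ++ [t]) → c ∉ t :: ([h', x'] ++ [u]) := fun hc hm =>
        hc (List.mem_reverse.1 (hrev ▸ hm))
      obtain ⟨K₁, hK₁⟩ := hcxt.swap
      obtain ⟨K₂, hK₂⟩ := hcty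
      have hsep := D'.side_ne hz F.sub' (by simp) (by simp) F.yS' F.uS' F.xt.symm F.yt.symm F.xy
        hK₁ hK₂ (hrev ▸ hR.reverse) (hm hxR) (hm hyR)
      rw [← hrev, D'.side_reverse, D'.side_reverse] at hsep
      intro he
      rw [he] at hsep
      grind

lemma uy_indep (F : Fan₃ D p₀ P' A u a y b x t) (hcux : D'.ConstSide [u, x])
    (hcpu : D'.ConstSide [p₀, u]) (hxW' : x' ∈ W) (hux' : G.Adj u x') (hxa' : x' ≠ a)
    (hxx' : x' ≠ x) (hxP' : x' ∉ p₀ :: P') (htW' : t' ∈ W) (hyt' : G.Adj y t') (hta' : t' ≠ a)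
    (hxt : x ≠ t') : ¬ G.Adj x' t' := by
  intro hxt'
  have hF := F.fan₂.fan
  have h := hF.min
  have hut' : u ≠ t' := fun he => F.fan₂.uy (he ▸ hyt'.symm)
  have hxy' : x' ≠ y := fun he => F.fan₂.uy (he ▸ hux')
  have htP' := F.fan₂.ny_notMem_path hyt'
  have hxp' : x' ≠ p₀ := fun he => hxP' (by simp [he])
  have hR : SPath G (W.erase a) (insert t (insert x (S.erase a))) (u :: ([x', t'] ++ [y])) :=
    { ne_nil := by simp
      chain := by simp [hux', hxt', hyt'.symm]
      nodup := by simp [hux'.ne, hut', F.fan₂.yu.symm, hxt'.ne, hxy', hyt'.ne.symm]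
      mem := by
        simp [hF.ua.ne, hF.uW, hxa', hxW', hta', htW', F.fan₂.ay.ne.symm, F.fan₂.yW]
      head := by simpa using F.uS'
      last := by simpa using F.yS' }
  have hmem : ∀ {c}, c ∈ u :: ([x', t'] ++ [y]) → c = u ∨ c = x' ∨ c = t' ∨ c = y := by simp
  have hxR : x ∉ u :: ([x', t'] ++ [y]) := by
    intro hm
    rcases hmem hm with he | he | he | he
    exacts [F.ux.ne he.symm, hxx' he.symm, hxt he, F.xy he]
  have hPR : ∀ p ∈ p₀ :: P', p ∉ u :: ([x', t'] ++ [y]) := by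
    intro p hp hm
    rcases hmem hm with rfl | rfl | rfl | rfl
    exacts [hF.uP hp, hxP' hp, htP' hp, F.fan₂.yP hp]
  refine F.cut (by simp) (F.PS' p₀ (by simp)) F.ux hF.pu.symm F.xp hcux hcpu.swap hR (by simp) hxR
    h.conf.chain (fun p hp => F.sub' (F.PS' p hp)) hPR (by simp) (fun _ hp => hp) (m := y) ?_ ?_
  · intro c hc hca d hd hcd
    rcases hmem hd with rfl | rfl | rfl | rfl
    exacts [(hF.u_mem hc hca hcd.symm).elim, (hF.nu_mem hxW' hux' hxp' hxa' hc hcd.symm).elim,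
      (F.t'_mem htW' hyt' hta' hc hcd.symm).elim, rfl]
  · rintro v (rfl | rfl) hvR
    · exact (hvR (by simp)).elim
    · exact (hvR (by simp)).elim

end Fan₃
end FanQuadrilateralNeighbours

section FourthDeletion
open Classical

variable {U : Type*} {G : SimpleGraph U} {z : U} {W S A : Finset U} {P' : List U}
  {p₀ u a y b x t : U}

/-- A vertex that avoids the first and the last two vertices of `P` has at most one neighbour
in `P`. -/
lemma Fan.one_of_not_adj {D : ParityDrawing (Apex G z W S)} (F : Fan D p₀ P' A u a) {g : U}
    (hgP : g ∉ p₀ :: P') (hgp : ¬ G.Adj g p₀)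
    (hpost : ∀ pre c post, P' = pre ++ c :: post → post.length ≤ 1 → ¬ G.Adj g c) :
    ∀ p ∈ p₀ :: P', ∀ q ∈ p₀ :: P', G.Adj g p → G.Adj g q → p = q := by
  have h5 := F.five
  have hsplit : ∀ p ∈ p₀ :: P', G.Adj g p → p ∈ P'.take 3 := by
    intro p hp hgp'
    obtain ⟨l₁, l₂, hP⟩ := List.append_of_mem
      ((List.mem_cons.1 hp).resolve_left fun he => hgp (he ▸ hgp'))
    by_cases hlen : l₂.length ≤ 1
    · exact (hpost l₁ p l₂ hP hlen hgp').elim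
    · rw [hP] at h5 ⊢
      simp only [List.length_append, List.length_cons] at h5
      match l₁, h5 with
      | [], _ => simp
      | [_], _ => simp
      | [_, _], _ => simp
      | _ :: _ :: _ :: _, h5 =>
        simp only [List.length_cons] at h5
        omega
  have hpre : P'.take 3 <+: P' := List.take_prefix 3 P'
  have hch := (List.isChain_cons.1 F.min.conf.chain).2
  have hnd := (List.nodup_cons.1 F.min.conf.nodup).2
  intro p hp q hq hxp' hxq
  refine F.min.eq_of_length_le_three (isChain_of_infix hch hpre.isInfix) (hnd.sublist hpre.sublist)
    (by rw [List.length_take]; omega) (fun hm => ?_) p (hsplit p hp hxp') q (hsplit q hq hxq)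
    hxp' hxq
  exact hgP (by simp [hpre.subset hm])

namespace Fan₃

variable {D : ParityDrawing (Apex G z W S)} {c v v' w w' p : U}

lemma mem_five : c ∈ [u, a, y, x, t] ↔ c = u ∨ c = a ∨ c = y ∨ c = x ∨ c = t := by simp

lemma triple_of_five (h : c ∉ [u, a, y, x, t]) : c ∉ [u, a, y] := by
  rw [mem_five] at h
  rw [Fan₂.mem_triple]
  tauto

lemma not_good (F : Fan₃ D p₀ P' A u a y b x t) :
    ¬ WD G ((W \ (p₀ :: P').toFinset) \ [u, a, y, x, t].toFinset)
      (cap G (A.erase b) ((p₀ :: P').toFinset ∪ [u, a, y, x, t].toFinset)) := by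
  intro hg
  have hF := F.fan₂.fan
  have h := hF.min
  refine F.fan₂.not_good ?_
  have hx1 : x ∉ insert a (insert y (p₀ :: P').toFinset) := by
    simp only [Finset.mem_insert, List.mem_toFinset, not_or]
    exact ⟨F.xa, F.xy, F.xP⟩
  have ht1 : t ∉ insert u (insert a (insert y (p₀ :: P').toFinset)) := by
    simp only [Finset.mem_insert, List.mem_toFinset, not_or]
    exact ⟨F.ut.symm, F.ta, F.yt.ne.symm, F.tP⟩
  have hu1 : u ∉ insert a (insert y (p₀ :: P').toFinset) := by
    simp only [Finset.mem_insert, List.mem_toFinset, not_or]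
    exact ⟨hF.ua.ne, F.fan₂.yu.symm, hF.uP⟩
  refine WD.delete_cap (u := x) ?_ ?_ ?_ (WD.delete_cap (u := t) ?_ ?_ ?_ ?_)
  · simp only [Finset.mem_erase, Finset.mem_sdiff, List.mem_toFinset]
    exact ⟨F.ux.ne.symm, F.xa, F.xy, F.xW, F.xP⟩
  · rw [Finset.mem_insert, not_or]
    exact ⟨F.ux.ne.symm, hx1⟩
  · have hn : nbrCount G (insert a (insert y (p₀ :: P').toFinset)) x ≤ 1 := nbrCount_le_one (by
      have key : ∀ d ∈ insert a (insert y (p₀ :: P').toFinset), G.Adj d x → d ∈ p₀ :: P' := by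
        intro d hd hdx
        simp only [Finset.mem_insert, List.mem_toFinset] at hd
        rcases hd with rfl | rfl | hd
        · exact (h.tri hF.ua hdx F.ux).elim
        · exact (h.tri F.xt F.yt.symm hdx.symm).elim
        · exact hd
      intro d hd e he hdx hex
      have hxK : x ∉ [u, a, y] := by
        rw [Fan₂.mem_triple, not_or, not_or]
        exact ⟨F.ux.ne.symm, F.xa, F.xy⟩
      exact F.fan₂.triple_one (v := u) (by simp) F.xW F.xP hxK F.ux d (key d hd hdx) e
        (key e he hex) hdx.symm hex.symm)
    have hins := nbrCount_insert (G := G) (t := x) hu1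
    rw [if_pos F.ux] at hins
    rw [cap, if_neg fun hm => F.xA (Finset.mem_of_mem_erase hm)]
    omega
  · simp only [Finset.mem_erase, Finset.mem_sdiff, List.mem_toFinset]
    exact ⟨F.xt.ne.symm, F.ut.symm, F.ta, F.yt.ne.symm, F.tW, F.tP⟩
  · rw [Finset.mem_insert, not_or]
    exact ⟨F.xt.ne.symm, ht1⟩
  · have hn : nbrCount G (insert u (insert a (insert y (p₀ :: P').toFinset))) t ≤ 1 :=
      nbrCount_le_one (by
        have key : ∀ d ∈ insert u (insert a (insert y (p₀ :: P').toFinset)),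
            G.Adj d t → d = y := by
          intro d hd hdt
          simp only [Finset.mem_insert, List.mem_toFinset] at hd
          rcases hd with rfl | rfl | rfl | hd
          · exact (h.tri F.ux F.xt hdt).elim
          · exact (h.tri F.fan₂.ay F.yt hdt).elim
          · rfl
          · exact (F.fan₂.ny_path F.tW F.yt F.ta F.tb hd hdt.symm).elim
        exact fun d hd e he hdt het => (key d hd hdt).trans (key e he het).symm)
    have hx2 : x ∉ insert u (insert a (insert y (p₀ :: P').toFinset)) := by
      rw [Finset.mem_insert, not_or]
      exact ⟨F.ux.ne.symm, hx1⟩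
    have hins := nbrCount_insert (G := G) (t := t) hx2
    rw [if_pos F.xt] at hins
    rw [cap, if_neg fun hm => F.tA (Finset.mem_of_mem_erase hm)]
    omega
  · have h1 : (((((W \ (p₀ :: P').toFinset).erase y).erase a).erase u).erase x).erase t =
        (W \ (p₀ :: P').toFinset) \ [u, a, y, x, t].toFinset := by
      ext c; simp; tauto
    have h2 : insert t (insert x (insert u (insert a (insert y (p₀ :: P').toFinset)))) =
        (p₀ :: P').toFinset ∪ [u, a, y, x, t].toFinset := by
      ext c; simp; tauto
    rwa [h1, h2]

lemma five_cases (F : Fan₃ D p₀ P' A u a y b x t) (hv : v ∈ [u, a, y, x, t]) (hw : w ∈ W)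
    (hwK : w ∉ [u, a, y, x, t]) (hvw : G.Adj v w) :
    (v = u ∧ G.Adj u w) ∨ (v = y ∧ G.Adj y w) ∨ (v = x ∧ G.Adj x w) ∨ (v = t ∧ G.Adj t w) := by
  rcases mem_five.1 hv with rfl | rfl | rfl | rfl | rfl
  · exact Or.inl ⟨rfl, hvw⟩
  · exact (hwK (by rcases F.na hw hvw with rfl | rfl <;> simp)).elim
  · exact Or.inr (Or.inl ⟨rfl, hvw⟩)
  · exact Or.inr (Or.inr (Or.inl ⟨rfl, hvw⟩))
  · exact Or.inr (Or.inr (Or.inr ⟨rfl, hvw⟩))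

lemma five_mem (F : Fan₃ D p₀ P' A u a y b x t) (hv : v ∈ [u, a, y, x, t]) (hw : w ∈ W)
    (hwP : w ∉ p₀ :: P') (hwK : w ∉ [u, a, y, x, t]) (hvw : G.Adj v w) (hc : c ∈ A)
    (hca : c ≠ a) : ¬ G.Adj w c := by
  have hwK' := triple_of_five hwK
  rw [mem_five] at hwK
  rcases mem_five.1 hv with rfl | rfl | rfl | rfl | rfl
  · exact F.fan₂.triple_mem (by simp) hw hwP hwK' hvw hc hca
  · exact F.fan₂.triple_mem (by simp) hw hwP hwK' hvw hc hca
  · exact F.fan₂.triple_mem (by simp) hw hwP hwK' hvw hc hca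
  · exact F.g_mem hw hvw (fun he => hwK (Or.inl he)) hwP hc
  · exact F.fan₂.nny_mem F.tW F.yt F.ta F.tb hw hvw (fun he => hwK (Or.inr (Or.inr (Or.inl he)))) hc

lemma five_p₀ (F : Fan₃ D p₀ P' A u a y b x t) (hv : v ∈ [u, a, y, x, t]) (hw : w ∈ W)
    (hwK : w ∉ [u, a, y, x, t]) (hvw : G.Adj v w) : ¬ G.Adj w p₀ := by
  have hwK' := triple_of_five hwK
  rw [mem_five] at hwK
  rcases mem_five.1 hv with rfl | rfl | rfl | rfl | rfl
  · exact F.fan₂.triple_p₀ (by simp) hw hwK' hvw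
  · exact F.fan₂.triple_p₀ (by simp) hw hwK' hvw
  · exact F.fan₂.triple_p₀ (by simp) hw hwK' hvw
  · exact fun hwp => hwK (Or.inl (F.fan₂.fan.min.sq F.xp hvw.symm hwp F.ux F.fan₂.fan.pu.symm))
  · exact F.fan₂.nny_p₀ F.tW F.yt F.ta F.tb hw hvw (fun he => hwK (Or.inr (Or.inr (Or.inl he))))

lemma xt_path (F : Fan₃ D p₀ P' A u a y b x t) (hv : v = x ∨ v = t) (hw : w ∈ W)
    (hwP : w ∉ p₀ :: P') (hwK : w ∉ [u, a, y, x, t]) (hvw : G.Adj v w) :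
    ∀ pre c post, P' = pre ++ c :: post → post.length ≤ 1 → ¬ G.Adj w c := by
  intro pre c post hP hpost
  rw [mem_five] at hwK
  rcases hv with rfl | rfl
  · exact F.fan₂.fan.nnu_path F.xW F.ux F.xp F.xa hw hvw (fun he => hwK (Or.inl he)) hwP hP hpost
  · exact F.fan₂.nny_path F.tW F.yt F.ta F.tb hw hvw
      (fun he => hwK (Or.inr (Or.inr (Or.inl he)))) hP hpost

lemma mem_five_iff : c ∈ [u, a, y, x, t] ↔ c ∈ [u, a, y] ∨ c = x ∨ c = t := by
  simp only [List.mem_cons, List.not_mem_nil, or_false]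
  tauto

lemma five_one (F : Fan₃ D p₀ P' A u a y b x t) (hv : v ∈ [u, a, y, x, t]) (hw : w ∈ W)
    (hwP : w ∉ p₀ :: P') (hwK : w ∉ [u, a, y, x, t]) (hvw : G.Adj v w) :
    ∀ p ∈ p₀ :: P', ∀ q ∈ p₀ :: P', G.Adj w p → G.Adj w q → p = q := by
  rcases mem_five_iff.1 hv with hv' | hv'
  · exact F.fan₂.triple_one hv' hw hwP (triple_of_five hwK) hvw
  · exact F.fan₂.fan.one_of_not_adj hwP (F.five_p₀ hv hw hwK hvw) (F.xt_path hv' hw hwP hwK hvw)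

lemma five_last (F : Fan₃ D p₀ P' A u a y b x t) (hv : v ∈ [u, a, y, x, t]) (hw : w ∈ W)
    (hwP : w ∉ p₀ :: P') (hwK : w ∉ [u, a, y, x, t]) (hvw : G.Adj v w)
    (hp : p ∈ (p₀ :: P').getLast?) : ¬ G.Adj w p := by
  rcases mem_five_iff.1 hv with hv' | hv'
  · exact F.fan₂.triple_last hv' hw hwP (triple_of_five hwK) hvw hp
  · obtain ⟨p₁, P'', rfl⟩ := F.fan₂.fan.exists_eq_cons
    rw [List.getLast?_cons_cons] at hp
    obtain ⟨l, hl⟩ := List.mem_getLast?_eq_getLast hp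
    have hP : p₁ :: P'' = (p₁ :: P'').dropLast ++ p :: [] := by
      rw [hl, List.dropLast_append_getLast]
    exact F.xt_path hv' hw hwP hwK hvw _ _ _ hP (by simp)

lemma five_indep (F : Fan₃ D p₀ P' A u a y b x t) (hv : v ∈ [u, a, y, x, t])
    (hv' : v' ∈ [u, a, y, x, t]) (hw : w ∈ W) (hw' : w' ∈ W) (hwP : w ∉ p₀ :: P')
    (hwP' : w' ∉ p₀ :: P') (hwK : w ∉ [u, a, y, x, t]) (hwK' : w' ∉ [u, a, y, x, t])
    (hvw : G.Adj v w) (hvw' : G.Adj v' w') : ¬ G.Adj w w' := by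
  have hF := F.fan₂.fan
  have h := hF.min
  obtain ⟨D', hux, hxt, hty, hpu⟩ := F.exists_drawing
  have ksame : ∀ {v w w'}, G.Adj v w → G.Adj v w' → ¬ G.Adj w w' := fun h1 h2 h3 => h.tri h1 h3 h2
  have kadj : ∀ {v v' w w'}, G.Adj v v' → v ∈ [u, a, y, x, t] → v' ∈ [u, a, y, x, t] →
      w ∉ [u, a, y, x, t] → w' ∉ [u, a, y, x, t] → G.Adj v w → G.Adj v' w' → ¬ G.Adj w w' := by
    intro v v' w w' hvv hv hv' hw hw' h1 h2 h3
    exact hw' (h.sq (by rintro rfl; exact hw hv') h2.symm h3.symm hvv h1 ▸ hv)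
  have kuy : ∀ {w w'}, w ∈ W → w' ∈ W → w ∉ p₀ :: P' → w ∉ [u, a, y, x, t] →
      w' ∉ [u, a, y, x, t] → G.Adj u w → G.Adj y w' → ¬ G.Adj w w' := by
    intro w w' hw hw' hwP hwK hwK' h1 h2
    rw [mem_five] at hwK hwK'
    push Not at hwK hwK'
    exact F.uy_indep hux hpu hw h1 hwK.2.1 hwK.2.2.2.1 hwP hw' h2 hwK'.2.1 hwK'.2.2.2.1.symm
  have kut : ∀ {w w'}, w ∈ W → w' ∈ W → w ∉ p₀ :: P' → w ∉ [u, a, y, x, t] →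
      w' ∉ [u, a, y, x, t] → G.Adj u w → G.Adj t w' → ¬ G.Adj w w' := by
    intro w w' hw hw' hwP hwK hwK' h1 h2
    rw [mem_five] at hwK hwK'
    push Not at hwK hwK'
    exact F.tu_indep hux hxt hty hpu hw' h2 hwK'.2.2.2.1 hwK'.2.2.1 hw h1 hwK.2.1 hwK.2.2.2.1 hwP
  have kxy : ∀ {w w'}, w ∈ W → w' ∈ W → w ∉ p₀ :: P' → w ∉ [u, a, y, x, t] →
      w' ∉ [u, a, y, x, t] → G.Adj x w → G.Adj y w' → ¬ G.Adj w w' := by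
    intro w w' hw hw' hwP hwK hwK' h1 h2
    rw [mem_five] at hwK hwK'
    push Not at hwK hwK'
    exact F.xt_indep hux hxt hw h1 hwK.1 hwK.2.2.2.2 hwP hw' h2 hwK'.2.1 hwK'.2.2.2.2
  rcases F.five_cases hv hw hwK hvw with ⟨-, h1⟩ | ⟨-, h1⟩ | ⟨-, h1⟩ | ⟨-, h1⟩ <;>
    rcases F.five_cases hv' hw' hwK' hvw' with ⟨-, h2⟩ | ⟨-, h2⟩ | ⟨-, h2⟩ | ⟨-, h2⟩
  · exact ksame h1 h2
  · exact kuy hw hw' hwP hwK hwK' h1 h2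
  · exact kadj F.ux (by simp) (by simp) hwK hwK' h1 h2
  · exact kut hw hw' hwP hwK hwK' h1 h2
  · exact fun hww => kuy hw' hw hwP' hwK' hwK h2 h1 hww.symm
  · exact ksame h1 h2
  · exact fun hww => kxy hw' hw hwP' hwK' hwK h2 h1 hww.symm
  · exact kadj F.yt (by simp) (by simp) hwK hwK' h1 h2
  · exact kadj F.ux.symm (by simp) (by simp) hwK hwK' h1 h2
  · exact kxy hw hw' hwP hwK hwK' h1 h2
  · exact ksame h1 h2
  · exact kadj F.xt (by simp) (by simp) hwK hwK' h1 h2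
  · exact fun hww => kut hw' hw hwP' hwK' hwK h2 h1 hww.symm
  · exact kadj F.yt.symm (by simp) (by simp) hwK hwK' h1 h2
  · exact kadj F.xt.symm (by simp) (by simp) hwK hwK' h1 h2
  · exact ksame h1 h2

lemma five_eq (F : Fan₃ D p₀ P' A u a y b x t) (hw : w ∈ W) (hwK : w ∉ [u, a, y, x, t])
    (hv : v ∈ [u, a, y, x, t]) (hv' : v' ∈ [u, a, y, x, t]) (hvw : G.Adj v w)
    (hvw' : G.Adj v' w) : v = v' := by
  have hF := F.fan₂.fan
  have h := hF.min
  have k2 : ∀ {v v' m}, m ∈ [u, a, y, x, t] → G.Adj v m → G.Adj v' m → G.Adj v w → G.Adj v' w →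
      v = v' := fun hm h1 h2 h3 h4 => h.sq (by rintro rfl; exact hwK hm) h1 h3 h2 h4
  have huy : G.Adj u w → ¬ G.Adj y w := fun h1 h2 =>
    F.fan₂.yu (k2 (m := a) (by simp) F.fan₂.ay.symm hF.ua h2 h1)
  have hut : G.Adj u w → ¬ G.Adj t w := fun h1 h2 =>
    F.ut (k2 (m := x) (by simp) F.ux F.xt.symm h1 h2)
  have hxy : G.Adj x w → ¬ G.Adj y w := fun h1 h2 =>
    F.xy (k2 (m := t) (by simp) F.xt F.yt h1 h2)
  have hux : G.Adj u w → ¬ G.Adj x w := fun h1 h2 => h.tri F.ux h2 h1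
  have hxt : G.Adj x w → ¬ G.Adj t w := fun h1 h2 => h.tri F.xt h2 h1
  have hyt : G.Adj y w → ¬ G.Adj t w := fun h1 h2 => h.tri F.yt h2 h1
  rcases F.five_cases hv hw hwK hvw with ⟨e, h1⟩ | ⟨e, h1⟩ | ⟨e, h1⟩ | ⟨e, h1⟩ <;>
    rcases F.five_cases hv' hw hwK hvw' with ⟨e', h2⟩ | ⟨e', h2⟩ | ⟨e', h2⟩ | ⟨e', h2⟩ <;>
      first | exact e.trans e'.symm | tauto

lemma elim (F : Fan₃ D p₀ P' A u a y b x t) : False := by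
  have hF := F.fan₂.fan
  have h := hF.min
  refine F.not_good (h.delete (K := [u, a, y, x, t]) (P' := p₀ :: P') (A₀ := A.erase b)
    (Finset.erase_subset _ _) (v₀ := u) (by simp) hF.uW List.infix_rfl (fun _ hx => Or.inl hx) ?_ ?_
    (fun c hc hcK v hv w hw hwP hwK hvw hcw => F.five_mem hv hw hwP hwK hvw hc
      (fun he => hcK (by simp [he])) hcw.symm)
    (fun v hv w hw hwP hwK hvw v' hv' w' hw' hwP' hwK' hvw' => F.five_indep hv hv' hw hw'
      hwP hwP' hwK hwK' hvw hvw')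
    (fun v hv w hw hwP hwK hvw => F.five_one hv hw hwP hwK hvw) ?_
    (fun v hv w hw hwP hwK hvw p hp hwp => (F.five_last hv hw hwP hwK hvw hp hwp).elim)
    ?_ (fun w hw _ hwK v hv v' hv' => F.five_eq hw hwK hv hv'))
  · intro c hc hm
    rcases mem_five.1 hm with rfl | rfl | rfl | rfl | rfl
    exacts [hF.uP hc, hF.aP hc, F.fan₂.yP hc, F.xP hc, F.tP hc]
  · intro W' S' hW' hS'
    set W₁ : Finset U := W.filter (· ∉ [u, a, y]) with hW₁
    set S₁ : Finset U := W₁.filter (fun c => c ∈ S ∨ ∃ v ∈ [u, a, y], G.Adj v c) with hS₁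
    have hmem₁ : ∀ {c}, c ∈ W₁ ↔ c ∈ W ∧ c ∉ [u, a, y] := Finset.mem_filter
    have hmemS : ∀ {c}, c ∈ S₁ ↔ c ∈ W₁ ∧ (c ∈ S ∨ ∃ v ∈ [u, a, y], G.Adj v c) :=
      Finset.mem_filter
    have hz₁ : z ∉ W₁ := fun hz => h.conf.z_notMem (hmem₁.1 hz).1
    have hxK : x ∉ [u, a, y] := by
      rw [Fan₂.mem_triple, not_or, not_or]
      exact ⟨F.ux.ne.symm, F.xa, F.xy⟩
    have htK : t ∉ [u, a, y] := by
      rw [Fan₂.mem_triple, not_or, not_or]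
      exact ⟨F.ut.symm, F.ta, F.yt.ne.symm⟩
    obtain ⟨D₁⟩ := ParityDrawing.contract_list h.conf.z_notMem D hF.sub (L := [u, a, y])
      (W' := W₁) (S' := S₁) (by simp [hF.ua.ne, F.fan₂.ay.ne, F.fan₂.yu.symm])
      (by simp [hF.uS, hF.AS hF.aA, F.fan₂.yS]) (fun c => hmem₁.1) (fun c => hmemS.1)
    refine ParityDrawing.contract_list hz₁ D₁ (Finset.filter_subset _ _) (L := [x, t])
      (by simp [F.xt.ne]) ?_ ?_ ?_
    · intro c hc
      simp only [List.mem_cons, List.not_mem_nil, or_false] at hc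
      rcases hc with rfl | rfl
      · exact hmemS.2 ⟨hmem₁.2 ⟨F.xW, hxK⟩, Or.inr ⟨u, by simp, F.ux⟩⟩
      · exact hmemS.2 ⟨hmem₁.2 ⟨F.tW, htK⟩, Or.inr ⟨y, by simp, F.yt⟩⟩
    · intro c hc
      obtain ⟨hcW, hcK⟩ := hW' c hc
      refine ⟨hmem₁.2 ⟨hcW, triple_of_five hcK⟩, fun hm => hcK ?_⟩
      simp only [List.mem_cons, List.not_mem_nil, or_false] at hm ⊢
      tauto
    · intro c hc
      obtain ⟨hcW', hc⟩ := hS' c hc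
      refine ⟨hcW', ?_⟩
      obtain ⟨hcW, hcK⟩ := hW' c hcW'
      have hc₁ : c ∈ W₁ := hmem₁.2 ⟨hcW, triple_of_five hcK⟩
      rcases hc with (hc | hc) | ⟨v, hv, hvc⟩
      · exact Or.inl (hmemS.2 ⟨hc₁, Or.inl (hF.PS c hc)⟩)
      · exact Or.inl (hmemS.2 ⟨hc₁, Or.inl (hF.AS hc)⟩)
      · rcases mem_five_iff.1 hv with hv | hv
        · exact Or.inl (hmemS.2 ⟨hc₁, Or.inr ⟨v, hv, hvc⟩⟩)
        · exact Or.inr ⟨v, by simpa using hv, hvc⟩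
  · intro v hv w hw _ hwK hvw p hp
    have hp' : p₀ = p := by simpa using hp
    exact hp' ▸ F.five_p₀ hv hw hwK hvw
  · intro c hc hcK v hv _ hvc
    rcases mem_five_iff.1 hv with hv | rfl | rfl
    · exact F.fan₂.triple_AK hc (fun he => hcK (by simp [he])) hv hvc
    · exact F.x_mem (Finset.mem_of_mem_erase hc) hvc
    · exact F.t_mem (Finset.mem_of_mem_erase hc) hvc

end Fan₃
end FourthDeletion

section MainTheorem
open Classical

variable {U : Type*} {G : SimpleGraph U}

/-- Graphs without triangles and four-cycles have no minimal counterexample to the extension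
statement. -/
lemma MinCE.elim {z : U} {W A : Finset U} {P : List U} (h : MinCE G z W P A) : False := by
  obtain ⟨p₀, P', rfl⟩ := List.exists_cons_of_ne_nil h.ne_nil
  obtain ⟨u, a, S, D, F⟩ := h.exists_fan
  obtain ⟨y, b, S', D', F₂⟩ := F.exists_fan₂
  obtain ⟨x, xW, xp, xa, ux, t, tW, ta, tb, yt, xt⟩ := F₂.exists_adj_adj
  exact Fan₃.elim ⟨F₂, xW, xp, xa, ux, tW, ta, tb, yt, xt⟩

/-- The extension statement: a configuration of a graph without triangles and four-cycles is
good. -/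
lemma Conf.good (tri : ∀ {a b c}, G.Adj a b → G.Adj b c → G.Adj a c → False)
    (sq : ∀ {x y a b}, x ≠ y → G.Adj a x → G.Adj a y → G.Adj b x → G.Adj b y → a = b)
    {z : U} {W A : Finset U} {P : List U} (h : Conf G z W P A) : Good G W P A := by
  obtain ⟨n, hn⟩ : ∃ n, 7 * W.card + 6 = n + P.length :=
    ⟨7 * W.card + 6 - P.length, by have := h.length_le; omega⟩
  induction n using Nat.strong_induction_on generalizing W P A with
  | _ n ih =>
    by_contra hbad
    refine MinCE.elim ⟨h, tri, sq, fun W' P' A' h' hlt => ?_, hbad⟩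
    have := h'.length_le
    exact ih (7 * W'.card + 6 - P'.length) (by omega) h' (by omega)

end MainTheorem

section Girth

variable {U : Type*} {G : SimpleGraph U}

lemma not_triangle_of_girth (hgirth : ∀ (v : U) (w : G.Walk v v), w.IsCycle → 5 ≤ w.length)
    {a b c : U} (hab : G.Adj a b) (hbc : G.Adj b c) (hac : G.Adj a c) : False := by
  have h := hgirth a (.cons hab (.cons hbc (.cons hac.symm .nil))) (by
    simp [Walk.isCycle_def, hab.ne, hab.ne', hbc.ne, hac.ne, hac.ne'])
  simp at h

lemma eq_of_adj_adj_of_girth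
    (hgirth : ∀ (v : U) (w : G.Walk v v), w.IsCycle → 5 ≤ w.length)
    {x y a b : U} (hxy : x ≠ y) (hax : G.Adj a x) (hay : G.Adj a y) (hbx : G.Adj b x)
    (hby : G.Adj b y) : a = b := by
  by_contra hab
  have h := hgirth a (.cons hax (.cons hbx.symm (.cons hby (.cons hay.symm .nil)))) (by
    simp [Walk.isCycle_def, hab, Ne.symm hab, hxy, hax.ne, hax.ne', hay.ne, hay.ne',
      hbx.ne', hby.ne])
  simp at h

end Girth

/-- Every planar graph with girth at least `5` is
`(I,F)`-colorable. -/
theorem planar_girth_five_IFColorable {V : Type}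
    (G : SimpleGraph V) (hplanar : IsPlanarGraph G)
    (hgirth : ∀ (v : V) (w : G.Walk v v), w.IsCycle → 5 ≤ w.length) :
    IFColorable G := by
  classical
  obtain ⟨vtx, arc, hemb⟩ := hplanar
  obtain ⟨D⟩ := hemb.nonempty_parityDrawing
  refine IFColorable.of_finite_parts fun X => ?_
  set H := G.map Function.Embedding.some with hH
  set W := X.map Function.Embedding.some with hW
  have hadj : ∀ {u v}, H.Adj (some u) (some v) ↔ G.Adj u v := by
    intro u v
    exact G.map_adj_apply
  have hsome : ∀ {u v}, H.Adj u v → ∃ a b, G.Adj a b ∧ some a = u ∧ some b = v := by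
    rintro _ _ ⟨-, a, b, hab, rfl, rfl⟩
    exact ⟨a, b, hab, rfl, rfl⟩
  have hconf : Conf H none W [] ∅ :=
    { z_notMem := by simp [hW]
      nodup := by simp
      chain := by simp
      sub := by simp
      length_le := by simp
      A_sub := by simp
      A_notMem := by simp
      indep := by simp
      one := by simp
      head := by simp
      last := by simp
      both := by simp
      drawing := D.nonempty_apex W }
  have hgood := hconf.good ?_ ?_
  · have hWD : WD H W (fun _ => 3) := by
      have hcap : cap H ∅ ∅ = fun _ => 3 := by
        funext t
        simp [cap, nbrCount]
      simpa [Good, hcap] using hgood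
    obtain ⟨c, hind, hfor⟩ := hWD.exists_coloring
    refine ⟨fun v => c (some v), fun u hu v hv huv => hind _ (by simpa [hW]) _ (by simpa [hW])
      (hadj.2 huv), fun v p hp hpX hpc => ?_⟩
    refine hfor _ (p.map (Embedding.map Function.Embedding.some G).toHom)
      (hp.map (Embedding.map Function.Embedding.some G).injective) ?_ ?_
    · intro x hx
      rw [Walk.support_map, List.mem_map] at hx
      obtain ⟨y, hy, rfl⟩ := hx
      exact Finset.mem_map_of_mem _ (hpX y hy)
    · intro x hx
      rw [Walk.support_map, List.mem_map] at hx
      obtain ⟨y, hy, rfl⟩ := hx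
      exact hpc y hy
  · intro a b c hab hbc hac
    obtain ⟨a, b, -, rfl, rfl⟩ := hsome hab
    obtain ⟨-, c, -, -, rfl⟩ := hsome hbc
    exact not_triangle_of_girth hgirth (hadj.1 hab) (hadj.1 hbc) (hadj.1 hac)
  · intro x y a b hxy hax hay hbx hby
    obtain ⟨a, x, -, rfl, rfl⟩ := hsome hax
    obtain ⟨b, y, -, rfl, rfl⟩ := hsome hby
    exact congrArg some (eq_of_adj_adj_of_girth hgirth (fun h => hxy (congrArg some h))
      (hadj.1 hax) (hadj.1 hay) (hadj.1 hbx) (hadj.1 hby))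

end IFPaper
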